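/- Let n ≥ 2 and let Λ be a countable subset of 𝔹ₙ. Then there exists a holomorphic map φ : 𝔻 → ℂⁿ which is injective, is an immersion (φ'(ζ) ≠ 0 for every ζ ∈ 𝔻), has image contained in 𝔹ₙ with Λ ⊆ φ(𝔻), and is complete: for every divergent path γ : [0,1) → 𝔻 the path φ ∘ γ has infinite length. In particular (taking Λ dense) the image φ(𝔻) can be made dense in 𝔹ₙ. (Simply connected case of the Alarcón–Forstnerič hitting theorem.) -/

import Mathlib

open Set Metric
open scoped ENNReal

noncomputable section

/-- A path `γ : [0,1) → E` is a divergent path in the open set `Ω` if it is continuous on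
`[0,1)`, takes values in `Ω`, and eventually leaves every compact subset of `Ω`. -/
def DivergentPathIn {E : Type*} [TopologicalSpace E] (Ω : Set E) (γ : ℝ → E) : Prop :=
  ContinuousOn γ (Set.Ico 0 1) ∧
  (∀ t ∈ Set.Ico (0 : ℝ) 1, γ t ∈ Ω) ∧
  ∀ K : Set E, K ⊆ Ω → IsCompact K →
    ∃ t₀ ∈ Set.Ico (0 : ℝ) 1, ∀ t ∈ Set.Ico t₀ 1, γ t ∉ K

/-- An entire function of one variable is a uniform limit of polynomials on every disc. -/
theorem exists_polynomial_approx_entire {g : ℂ → ℂ} (hg : Differentiable ℂ g) (R : ℝ) {ε : ℝ}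
    (hε : 0 < ε) : ∃ p : Polynomial ℂ, ∀ z : ℂ, ‖z‖ ≤ R → ‖g z - p.eval z‖ ≤ ε := by
  have h1 := hg.hasFPowerSeriesOnBall 0 (R := (|R| + 1).toNNReal) (Real.toNNReal_pos.2
    (by positivity))
  have h3 := h1.tendstoUniformlyOn (r' := (|R| + 1 / 2).toNNReal) ENNReal.coe_lt_top
  rw [Metric.tendstoUniformlyOn_iff] at h3
  obtain ⟨n, hn⟩ := (h3 ε hε).exists
  set q := cauchyPowerSeries g 0 (|R| + 1).toNNReal with hq
  refine ⟨∑ k ∈ Finset.range n, Polynomial.C (q k (fun _ => 1)) * Polynomial.X ^ k, ?_⟩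
  intro z hz
  have h4 := hn z (by
    have := le_abs_self R
    simp only [mem_ball, dist_zero_right]
    rw [Real.coe_toNNReal _ (by positivity)]
    linarith)
  rw [dist_eq_norm, zero_add] at h4
  refine le_trans (le_of_eq ?_) h4.le
  congr 2
  simp only [FormalMultilinearSeries.partialSum, Polynomial.eval_finsetSum]
  refine Finset.sum_congr rfl fun k _ => ?_
  have : (fun _ : Fin k => z) = fun i : Fin k => z • (1 : ℂ) := by simp
  rw [this, ContinuousMultilinearMap.map_smul_univ]
  simp only [Finset.prod_const, Finset.card_univ, Fintype.card_fin, smul_eq_mul,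
    Polynomial.eval_mul, Polynomial.eval_C, Polynomial.eval_pow, Polynomial.eval_X]
  exact mul_comm _ _

section ExpAlgebra

variable {E : Type*} [NormedAddCommGroup E] [NormedSpace ℂ E]

variable (E) in
/-- The algebra of functions generated by the exponentials of linear forms. -/
def expAlgebra : Subalgebra ℂ (E → ℂ) :=
  Algebra.adjoin ℂ {f | ∃ k : E →L[ℂ] ℂ, f = fun z => Complex.exp (k z)}

/-- Locally uniform limits of exponential polynomials. -/
def ExpApprox (f : E → ℂ) : Prop :=
  ∀ R ε : ℝ, 0 < ε → ∃ P ∈ expAlgebra E, ∀ z, ‖z‖ ≤ R → ‖f z - P z‖ ≤ ε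

theorem expAlgebra_eq_span :
    Subalgebra.toSubmodule (expAlgebra E) =
      Submodule.span ℂ {f | ∃ k : E →L[ℂ] ℂ, f = fun z => Complex.exp (k z)} := by
  have hM : (Submonoid.closure {f : E → ℂ | ∃ k : E →L[ℂ] ℂ, f = fun z => Complex.exp (k z)} :
      Set (E → ℂ)) = {f | ∃ k : E →L[ℂ] ℂ, f = fun z => Complex.exp (k z)} := by
    let M : Submonoid (E → ℂ) :=
      { carrier := {f | ∃ k : E →L[ℂ] ℂ, f = fun z => Complex.exp (k z)}
        one_mem' := ⟨0, by ext; simp⟩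
        mul_mem' := by
          rintro _ _ ⟨k, rfl⟩ ⟨l, rfl⟩
          exact ⟨k + l, by ext; simp [Complex.exp_add]⟩ }
    refine le_antisymm ?_ Submonoid.subset_closure
    exact (Submonoid.closure_le (S := M)).2 le_rfl
  rw [expAlgebra, Algebra.adjoin_eq_span, hM]

theorem continuous_of_mem_expAlgebra {P : E → ℂ} (hP : P ∈ expAlgebra E) : Continuous P := by
  induction hP using Algebra.adjoin_induction with
  | mem x hx => obtain ⟨k, rfl⟩ := hx; fun_prop
  | algebraMap r => exact continuous_const
  | add x y _ _ hx hy => exact hx.add hy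
  | mul x y _ _ hx hy => exact hx.mul hy

theorem exists_bound_of_continuous [FiniteDimensional ℂ E] {F : Type*} [NormedAddCommGroup F]
    {f : E → F} (hf : Continuous f) (R : ℝ) :
    ∃ M : ℝ, 0 < M ∧ ∀ z, ‖z‖ ≤ R → ‖f z‖ ≤ M := by
  have : ProperSpace E := FiniteDimensional.proper ℂ E
  obtain ⟨M, hM⟩ := (isCompact_closedBall (0 : E) R).exists_bound_of_continuousOn hf.continuousOn
  exact ⟨max M 1, by positivity, fun z hz => (hM z (by simpa using hz)).trans (le_max_left _ _)⟩

variable {f g : E → ℂ}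

theorem ExpApprox.of_mem (hf : f ∈ expAlgebra E) : ExpApprox f :=
  fun _ ε hε => ⟨f, hf, fun z _ => by simpa using hε.le⟩

theorem ExpApprox.const (c : ℂ) : ExpApprox (fun _ : E => c) :=
  .of_mem ((expAlgebra E).algebraMap_mem c)

theorem ExpApprox.add (hf : ExpApprox f) (hg : ExpApprox g) : ExpApprox (fun z => f z + g z) := by
  intro R ε hε
  obtain ⟨P, hP, hfP⟩ := hf R (ε / 2) (by positivity)
  obtain ⟨Q, hQ, hgQ⟩ := hg R (ε / 2) (by positivity)
  refine ⟨P + Q, add_mem hP hQ, fun z hz => ?_⟩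
  have : f z + g z - (P + Q) z = (f z - P z) + (g z - Q z) := by simp; ring
  rw [this]
  linarith [norm_add_le (f z - P z) (g z - Q z), hfP z hz, hgQ z hz]

theorem ExpApprox.of_approx (h : ∀ R ε : ℝ, 0 < ε → ∃ g, ExpApprox g ∧
    ∀ z, ‖z‖ ≤ R → ‖f z - g z‖ ≤ ε) : ExpApprox f := by
  intro R ε hε
  obtain ⟨g, hg, hfg⟩ := h R (ε / 2) (by positivity)
  obtain ⟨P, hP, hgP⟩ := hg R (ε / 2) (by positivity)
  refine ⟨P, hP, fun z hz => ?_⟩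
  have : f z - P z = (f z - g z) + (g z - P z) := by ring
  rw [this]
  linarith [norm_add_le (f z - g z) (g z - P z), hfg z hz, hgP z hz]

variable [FiniteDimensional ℂ E]

theorem ExpApprox.exists_bound (hf : ExpApprox f) (R : ℝ) :
    ∃ M : ℝ, 0 < M ∧ ∀ z, ‖z‖ ≤ R → ‖f z‖ ≤ M := by
  obtain ⟨P, hP, hfP⟩ := hf R 1 one_pos
  obtain ⟨M, hM, hPM⟩ := exists_bound_of_continuous (continuous_of_mem_expAlgebra hP) R
  refine ⟨M + 1, by positivity, fun z hz => ?_⟩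
  have := norm_add_le (f z - P z) (P z)
  rw [sub_add_cancel] at this
  linarith [hfP z hz, hPM z hz]

theorem ExpApprox.mul (hf : ExpApprox f) (hg : ExpApprox g) : ExpApprox (fun z => f z * g z) := by
  intro R ε hε
  obtain ⟨M, hM, hgM⟩ := hg.exists_bound R
  obtain ⟨P, hP, hfP⟩ := hf R (ε / 2 / M) (by positivity)
  obtain ⟨N, hN, hPN⟩ := exists_bound_of_continuous (continuous_of_mem_expAlgebra hP) R
  obtain ⟨Q, hQ, hgQ⟩ := hg R (ε / 2 / N) (by positivity)
  refine ⟨P * Q, mul_mem hP hQ, fun z hz => ?_⟩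
  have : f z * g z - (P * Q) z = (f z - P z) * g z + P z * (g z - Q z) := by
    simp only [Pi.mul_apply]; ring
  rw [this]
  have h1 : ‖(f z - P z) * g z‖ ≤ ε / 2 / M * M := by
    rw [norm_mul]
    exact mul_le_mul (hfP z hz) (hgM z hz) (norm_nonneg _) (by positivity)
  have h2 : ‖P z * (g z - Q z)‖ ≤ N * (ε / 2 / N) := by
    rw [norm_mul]
    exact mul_le_mul (hPN z hz) (hgQ z hz) (norm_nonneg _) (by positivity)
  rw [div_mul_cancel₀ _ hM.ne'] at h1
  rw [mul_div_cancel₀ _ hN.ne'] at h2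
  linarith [norm_add_le ((f z - P z) * g z) (P z * (g z - Q z))]

theorem ExpApprox.const_mul (hf : ExpApprox f) (c : ℂ) : ExpApprox (fun z => c * f z) :=
  (ExpApprox.const c).mul hf

theorem ExpApprox.sub (hf : ExpApprox f) (hg : ExpApprox g) : ExpApprox (fun z => f z - g z) := by
  simpa [sub_eq_add_neg] using hf.add (hg.const_mul (-1))

theorem ExpApprox.polynomial (hf : ExpApprox f) (p : Polynomial ℂ) :
    ExpApprox (fun z => p.eval (f z)) := by
  induction p using Polynomial.induction_on' with
  | add p q hp hq => simpa using hp.add hq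
  | monomial n a =>
    simp only [Polynomial.eval_monomial]
    refine ExpApprox.const_mul ?_ a
    induction n with
    | zero => simpa using ExpApprox.const 1
    | succ n ih => simpa [pow_succ] using ih.mul hf

theorem ExpApprox.comp_entire (hf : ExpApprox f) {u : ℂ → ℂ} (hu : Differentiable ℂ u) :
    ExpApprox (fun z => u (f z)) := by
  refine .of_approx fun R ε hε => ?_
  obtain ⟨M, hM, hfM⟩ := hf.exists_bound R
  obtain ⟨p, hp⟩ := exists_polynomial_approx_entire hu M hε
  exact ⟨_, hf.polynomial p, fun z hz => hp _ (hfM z hz)⟩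

theorem ExpApprox.linear (k : E →L[ℂ] ℂ) : ExpApprox (fun z => k z) := by
  refine .of_approx fun R ε hε => ?_
  obtain ⟨M, hM, hkM⟩ := exists_bound_of_continuous k.continuous R
  have hd : HasDerivAt (fun z : ℂ => Complex.exp z) 1 0 := by
    simpa using Complex.hasDerivAt_exp 0
  rw [hasDerivAt_iff_isLittleO] at hd
  obtain ⟨δ, hδ, hd⟩ := Metric.eventually_nhds_iff.1 (hd.def (show 0 < ε / M by positivity))
  set τ : ℝ := δ / (2 * M) with hτ
  have hτ0 : 0 < τ := by positivity
  refine ⟨fun z => (τ : ℂ)⁻¹ * (Complex.exp (((τ : ℂ) • k) z) - 1),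
    (((ExpApprox.of_mem (Algebra.subset_adjoin ⟨(τ : ℂ) • k, rfl⟩)).sub
      (.const 1)).const_mul _), fun z hz => ?_⟩
  have h1 := @hd (τ * k z) (by
    rw [dist_zero_right, norm_mul, Complex.norm_real, Real.norm_of_nonneg hτ0.le]
    calc τ * ‖k z‖ ≤ τ * M := by gcongr; exact hkM z hz
      _ = δ / 2 := by rw [hτ]; field_simp
      _ < δ := by linarith)
  have hτc : (τ : ℂ) ≠ 0 := by exact_mod_cast hτ0.ne'
  have h2 : k z - (τ : ℂ)⁻¹ * (Complex.exp (((τ : ℂ) • k) z) - 1) =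
      -(τ : ℂ)⁻¹ * (Complex.exp (τ * k z) - Complex.exp 0 - (τ * k z - 0) • 1) := by
    simp only [smul_apply, smul_eq_mul, Complex.exp_zero]
    field_simp
    ring
  rw [h2, norm_mul, norm_neg, norm_inv, Complex.norm_real, Real.norm_of_nonneg hτ0.le]
  calc τ⁻¹ * ‖_‖ ≤ τ⁻¹ * (ε / M * ‖(τ : ℂ) * k z - 0‖) := by gcongr
    _ = ε / M * ‖k z‖ := by
      rw [sub_zero, norm_mul, Complex.norm_real, Real.norm_of_nonneg hτ0.le]; field_simp
    _ ≤ ε / M * M := by gcongr; exact hkM z hz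
    _ = ε := by field_simp

theorem ExpApprox.comp {Φ : E → E} (hf : ExpApprox f) (hΦ : Continuous Φ)
    (h : ∀ k : E →L[ℂ] ℂ, ExpApprox (fun z => k (Φ z))) : ExpApprox (fun z => f (Φ z)) := by
  have key : ∀ P ∈ expAlgebra E, ExpApprox (fun z => P (Φ z)) := by
    intro P hP
    induction hP using Algebra.adjoin_induction with
    | mem x hx => obtain ⟨k, rfl⟩ := hx; exact (h k).comp_entire Complex.differentiable_exp
    | algebraMap r => exact .const r
    | add x y _ _ hx hy => exact hx.add hy
    | mul x y _ _ hx hy => exact hx.mul hy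
  refine .of_approx fun R ε hε => ?_
  obtain ⟨M, hM, hΦM⟩ := exists_bound_of_continuous hΦ R
  obtain ⟨P, hP, hfP⟩ := hf M ε hε
  exact ⟨_, key P hP, fun z hz => hfP _ (hΦM z hz)⟩

end ExpAlgebra

section Automorphisms

variable {E : Type*} [NormedAddCommGroup E] [NormedSpace ℂ E]

/-- Holomorphic automorphisms of `E` the coordinates of whose inverses are locally uniform limits
of exponential polynomials. -/
structure IsHolAut (Φ : E ≃ E) : Prop where
  contDiff : ContDiff ℂ 1 Φ
  contDiff_symm : ContDiff ℂ 1 Φ.symm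
  expApprox_symm : ∀ k : E →L[ℂ] ℂ, ExpApprox (fun z => k (Φ.symm z))

theorem IsHolAut.trans [FiniteDimensional ℂ E] {Φ Ψ : E ≃ E} (hΦ : IsHolAut Φ)
    (hΨ : IsHolAut Ψ) : IsHolAut (Φ.trans Ψ) where
  contDiff := hΨ.contDiff.comp hΦ.contDiff
  contDiff_symm := hΦ.contDiff_symm.comp hΨ.contDiff_symm
  expApprox_symm k := (hΦ.expApprox_symm k).comp hΨ.contDiff_symm.continuous hΨ.expApprox_symm

theorem IsHolAut.refl [FiniteDimensional ℂ E] : IsHolAut (Equiv.refl E) where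
  contDiff := contDiff_id
  contDiff_symm := contDiff_id
  expApprox_symm k := .linear k

/-- The shear `z ↦ z + u (ℓ z)` where `u` takes values in the kernel of `ℓ`. -/
@[simps]
def shear (ℓ : E →L[ℂ] ℂ) (u : ℂ → E) (hu : ∀ t, ℓ (u t) = 0) : E ≃ E where
  toFun z := z + u (ℓ z)
  invFun z := z - u (ℓ z)
  left_inv z := by simp [hu]
  right_inv z := by simp [hu]

theorem isHolAut_shear [FiniteDimensional ℂ E] (ℓ : E →L[ℂ] ℂ) (u : ℂ → E)
    (hu : ∀ t, ℓ (u t) = 0) (hd : Differentiable ℂ u) : IsHolAut (shear ℓ u hu) where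
  contDiff := contDiff_id.add (hd.contDiff.comp ℓ.contDiff)
  contDiff_symm := contDiff_id.sub (hd.contDiff.comp ℓ.contDiff)
  expApprox_symm k := by
    have := (ExpApprox.linear k).sub
      ((ExpApprox.linear ℓ).comp_entire (k.differentiable.comp hd))
    simpa using this

/-- The overshear `z ↦ z + (exp (u (ℓ z)) - 1) • A z` along a projection `A` with values in the
kernel of `ℓ`. -/
@[simps]
def overshear (ℓ : E →L[ℂ] ℂ) (A : E →L[ℂ] E) (hA : ∀ z, A (A z) = A z) (hℓ : ∀ z, ℓ (A z) = 0)
    (u : ℂ → ℂ) : E ≃ E where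
  toFun z := z + (Complex.exp (u (ℓ z)) - 1) • A z
  invFun z := z + (Complex.exp (-u (ℓ z)) - 1) • A z
  left_inv z := by
    have h := Complex.exp_add (u (ℓ z)) (-u (ℓ z))
    rw [add_neg_cancel, Complex.exp_zero] at h
    simp only [map_add, map_smul, hℓ, hA, smul_zero, add_zero, smul_add, smul_smul, add_assoc]
    rw [← add_smul, ← add_smul]
    convert add_zero z using 2
    convert zero_smul ℂ (A z) using 2
    linear_combination -h
  right_inv z := by
    have h := Complex.exp_add (u (ℓ z)) (-u (ℓ z))
    rw [add_neg_cancel, Complex.exp_zero] at h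
    simp only [map_add, map_smul, hℓ, hA, smul_zero, add_zero, smul_add, smul_smul, add_assoc]
    rw [← add_smul, ← add_smul]
    convert add_zero z using 2
    convert zero_smul ℂ (A z) using 2
    linear_combination -h

theorem isHolAut_overshear [FiniteDimensional ℂ E] (ℓ : E →L[ℂ] ℂ) (A : E →L[ℂ] E)
    (hA : ∀ z, A (A z) = A z) (hℓ : ∀ z, ℓ (A z) = 0) {u : ℂ → ℂ} (hu : Differentiable ℂ u) :
    IsHolAut (overshear ℓ A hA hℓ u) where
  contDiff := by
    refine contDiff_id.add (ContDiff.smul ?_ A.contDiff)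
    exact ((Complex.contDiff_exp.comp (hu.contDiff.comp ℓ.contDiff))).sub contDiff_const
  contDiff_symm := by
    refine contDiff_id.add (ContDiff.smul ?_ A.contDiff)
    exact ((Complex.contDiff_exp.comp (hu.contDiff.comp ℓ.contDiff).neg)).sub contDiff_const
  expApprox_symm k := by
    have := (ExpApprox.linear k).add ((((ExpApprox.linear ℓ).comp_entire
      (Complex.differentiable_exp.comp hu.neg)).sub (.const 1)).mul
      (ExpApprox.linear (k.comp A)))
    simpa using this

theorem isHolAut_addRight [FiniteDimensional ℂ E] (v : E) : IsHolAut (Equiv.addRight v) where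
  contDiff := contDiff_id.add contDiff_const
  contDiff_symm := by
    have : ((Equiv.addRight v).symm : E → E) = fun z => z + -v := by ext; simp
    rw [this]
    exact contDiff_id.add contDiff_const
  expApprox_symm k := by
    have := (ExpApprox.linear k).add (.const (k (-v)))
    simpa using this

end Automorphisms

/-- A discrete Grönwall inequality. -/
theorem norm_iterate_sub_le {E : Type*} [NormedAddCommGroup E] {s : E → E} {z : ℕ → E} {N : ℕ}
    {L b ρ τ : ℝ} (hL : 0 ≤ L) (hb : 0 ≤ b) (hτ : 0 ≤ τ)
    (h : ∀ j < N, ∀ y, ‖y - z j‖ ≤ ρ → ‖s y - z (j + 1)‖ ≤ (1 + L * τ) * ‖y - z j‖ + b * τ)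
    (hρ : b * (N * τ) * Real.exp (L * (N * τ)) ≤ ρ) (j : ℕ) (hj : j ≤ N) :
    ‖s^[j] (z 0) - z j‖ ≤ b * (j * τ) * Real.exp (L * (j * τ)) := by
  induction j with
  | zero => simp
  | succ j ih =>
    have ih := ih (by omega)
    have hjN : (j : ℝ) ≤ N := by exact_mod_cast (by omega : j ≤ N)
    have h1 := h j (by omega) (s^[j] (z 0)) (ih.trans (le_trans (by gcongr) hρ))
    rw [Function.iterate_succ_apply']
    have h2 : 1 + L * τ ≤ Real.exp (L * τ) := by linarith [Real.add_one_le_exp (L * τ)]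
    have h3 : Real.exp (L * ((j + 1 : ℕ) * τ)) = Real.exp (L * τ) * Real.exp (L * (j * τ)) := by
      rw [← Real.exp_add]; congr 1; push_cast; ring
    have h4 : 1 ≤ Real.exp (L * ((j + 1 : ℕ) * τ)) := Real.one_le_exp (by positivity)
    calc _ ≤ _ := h1
      _ ≤ Real.exp (L * τ) * (b * (j * τ) * Real.exp (L * (j * τ))) +
          b * τ * Real.exp (L * ((j + 1 : ℕ) * τ)) := by
        refine add_le_add (mul_le_mul h2 ih (norm_nonneg _) (by positivity)) ?_
        exact le_mul_of_one_le_right (by positivity) h4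
      _ = _ := by rw [h3]; push_cast; ring

section FlowApproximation

variable {E : Type*} [NormedAddCommGroup E] [NormedSpace ℂ E]

/-- Vector fields whose flow is approximated, to first order in time, by automorphisms. -/
def FlowApprox (V : E → E) : Prop :=
  ∀ R ε : ℝ, 0 < ε → ∃ τ₀ > 0, ∀ τ : ℝ, 0 < τ → τ < τ₀ → ∃ Φ : E ≃ E, IsHolAut Φ ∧
    ∀ z, ‖z‖ ≤ R → ‖Φ z - z - (τ : ℂ) • V z‖ ≤ ε * τ

theorem FlowApprox.of_approx {V : E → E} (h : ∀ R ε : ℝ, 0 < ε → ∃ W, FlowApprox W ∧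
    ∀ z, ‖z‖ ≤ R → ‖V z - W z‖ ≤ ε) : FlowApprox V := by
  intro R ε hε
  obtain ⟨W, hW, hVW⟩ := h R (ε / 2) (by positivity)
  obtain ⟨τ₀, hτ₀, h⟩ := hW R (ε / 2) (by positivity)
  refine ⟨τ₀, hτ₀, fun τ hτ hτ' => ?_⟩
  obtain ⟨Φ, hΦ, h⟩ := h τ hτ hτ'
  refine ⟨Φ, hΦ, fun z hz => ?_⟩
  have : Φ z - z - (τ : ℂ) • V z = (Φ z - z - (τ : ℂ) • W z) - (τ : ℂ) • (V z - W z) := by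
    rw [smul_sub]; abel
  rw [this]
  have h2 : ‖(τ : ℂ) • (V z - W z)‖ ≤ τ * (ε / 2) := by
    rw [norm_smul, Complex.norm_real, Real.norm_of_nonneg hτ.le]
    gcongr
    exact hVW z hz
  linarith [norm_sub_le (Φ z - z - (τ : ℂ) • W z) ((τ : ℂ) • (V z - W z)), h z hz]

theorem FlowApprox.add [FiniteDimensional ℂ E] {V W : E → E} (hV : FlowApprox V)
    (hW : FlowApprox W) (hVc : Continuous V) (hWc : Continuous W) :
    FlowApprox (fun z => V z + W z) := by
  intro R ε hε
  have : ProperSpace E := FiniteDimensional.proper ℂ E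
  obtain ⟨M, hM, hWM⟩ := exists_bound_of_continuous hWc R
  have huc : UniformContinuousOn V (closedBall 0 (R + 1)) :=
    (isCompact_closedBall _ _).uniformContinuousOn_of_continuous hVc.continuousOn
  rw [Metric.uniformContinuousOn_iff] at huc
  obtain ⟨δ, hδ, huc⟩ := huc (ε / 3) (by positivity)
  obtain ⟨τ₁, hτ₁, h1⟩ := hV (R + 1) (ε / 3) (by positivity)
  obtain ⟨τ₂, hτ₂, h2⟩ := hW R (ε / 3) (by positivity)
  refine ⟨min (min τ₁ τ₂) (min δ 1 / (M + ε)), by positivity, fun τ hτ hτ' => ?_⟩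
  simp only [lt_min_iff] at hτ'
  obtain ⟨Φ, hΦ, h1⟩ := h1 τ hτ hτ'.1.1
  obtain ⟨Ψ, hΨ, h2⟩ := h2 τ hτ hτ'.1.2
  have hτδ : τ * (M + ε) < min δ 1 := (lt_div_iff₀ (by positivity)).1 hτ'.2
  rw [lt_min_iff] at hτδ
  refine ⟨Ψ.trans Φ, hΨ.trans hΦ, fun z hz => ?_⟩
  have h3 := h2 z hz
  have hnW : ‖(τ : ℂ) • W z‖ ≤ τ * M := by
    rw [norm_smul, Complex.norm_real, Real.norm_of_nonneg hτ.le]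
    gcongr
    exact hWM z hz
  have h4 : ‖Ψ z - z‖ ≤ τ * (M + ε) := by
    have : Ψ z - z = (Ψ z - z - (τ : ℂ) • W z) + (τ : ℂ) • W z := by abel
    rw [this]
    have := norm_add_le (Ψ z - z - (τ : ℂ) • W z) ((τ : ℂ) • W z)
    nlinarith
  have h5 : ‖Ψ z‖ ≤ R + 1 := by
    have := norm_add_le (Ψ z - z) z
    rw [sub_add_cancel] at this
    linarith
  have h6 := h1 _ h5
  have h7 : ‖V (Ψ z) - V z‖ ≤ ε / 3 := by
    rw [← dist_eq_norm]
    refine (huc _ (by simpa using h5) _ (by simp; linarith) ?_).le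
    rw [dist_eq_norm]
    linarith
  have h8 : ‖(τ : ℂ) • (V (Ψ z) - V z)‖ ≤ τ * (ε / 3) := by
    rw [norm_smul, Complex.norm_real, Real.norm_of_nonneg hτ.le]
    gcongr
  have : (Ψ.trans Φ) z - z - (τ : ℂ) • (V z + W z) =
      (Φ (Ψ z) - Ψ z - (τ : ℂ) • V (Ψ z)) + (Ψ z - z - (τ : ℂ) • W z) +
        (τ : ℂ) • (V (Ψ z) - V z) := by
    simp only [Equiv.trans_apply, smul_sub, smul_add]; abel
  rw [this]
  refine (norm_add₃_le).trans ?_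
  linarith

theorem flowApprox_shear [FiniteDimensional ℂ E] (ℓ : E →L[ℂ] ℂ) {v : E} (hv : ℓ v = 0) :
    FlowApprox (fun z => Complex.exp (ℓ z) • v) := by
  intro R ε hε
  refine ⟨1, one_pos, fun τ hτ _ => ⟨shear ℓ (fun t => ((τ : ℂ) * Complex.exp t) • v)
    (fun t => by simp [hv]), isHolAut_shear _ _ _ (by fun_prop), fun z hz => ?_⟩⟩
  simp only [shear_apply, smul_smul, add_sub_cancel_left, sub_self, norm_zero]
  positivity

theorem flowApprox_overshear [FiniteDimensional ℂ E] (ℓ m : E →L[ℂ] ℂ) {v : E} (hv : ℓ v = 0)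
    (hm : m v = 1) (c : ℂ) :
    FlowApprox (fun z => (c * Complex.exp (ℓ z) * m z) • v) := by
  intro R ε hε
  obtain ⟨M, hM, hcM⟩ := exists_bound_of_continuous
    (show Continuous fun z => c * Complex.exp (ℓ z) by fun_prop) R
  obtain ⟨K, hK, hmK⟩ := exists_bound_of_continuous (show Continuous fun z => m z • v by fun_prop) R
  refine ⟨min (1 / M) (ε / (M ^ 2 * K)), by positivity, fun τ hτ hτ' => ?_⟩
  rw [lt_min_iff, lt_div_iff₀ hM, lt_div_iff₀ (by positivity)] at hτ'
  refine ⟨overshear ℓ (m.smulRight v) (fun z => by simp [hm]) (fun z => by simp [hv])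
    (fun t => (τ : ℂ) * (c * Complex.exp t)), isHolAut_overshear _ _ _ _ (by fun_prop),
    fun z hz => ?_⟩
  set w := (τ : ℂ) * (c * Complex.exp (ℓ z)) with hw
  have hwn : ‖w‖ ≤ τ * M := by
    rw [hw, norm_mul, Complex.norm_real, Real.norm_of_nonneg hτ.le]
    gcongr
    exact hcM z hz
  have h1 := Complex.norm_exp_sub_one_sub_id_le (x := w) (by linarith)
  have : z + (Complex.exp w - 1) • (m z • v) - z -
      (τ : ℂ) • (c * Complex.exp (ℓ z) * m z) • v = (Complex.exp w - 1 - w) • (m z • v) := by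
    rw [hw]
    module
  change ‖z + (Complex.exp w - 1) • (m z • v) - z - _‖ ≤ _
  rw [this, norm_smul]
  calc _ ≤ ‖w‖ ^ 2 * K := mul_le_mul h1 (hmK z hz) (norm_nonneg _) (by positivity)
    _ ≤ (τ * M) ^ 2 * K := by gcongr
    _ = (τ * (M ^ 2 * K)) * τ := by ring
    _ ≤ ε * τ := by gcongr; exact hτ'.2.le

theorem flowApprox_exp_smul [FiniteDimensional ℂ E] (hE : 2 ≤ Module.finrank ℂ E)
    (ℓ : E →L[ℂ] ℂ) (e : E) : FlowApprox (fun z => Complex.exp (ℓ z) • e) := by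
  by_cases hs : ℓ e = 0
  · exact flowApprox_shear ℓ hs
  obtain ⟨v, hv, hv0⟩ : ∃ v, ℓ v = 0 ∧ v ≠ 0 := by
    by_contra! h
    have hinj : Function.Injective (ℓ : E →ₗ[ℂ] ℂ) := by
      rw [← LinearMap.ker_eq_bot, LinearMap.ker_eq_bot']
      exact fun z hz => h z hz
    have := LinearMap.finrank_le_finrank_of_injective hinj
    simp at this
    omega
  obtain ⟨m, hm, hme⟩ : ∃ m : E →L[ℂ] ℂ, m v = 1 ∧ m e = 0 := by
    obtain ⟨m₀, hm₀⟩ := SeparatingDual.exists_eq_one (R := ℂ) hv0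
    exact ⟨m₀ - (m₀ e / ℓ e) • ℓ, by simp [hv, hm₀], by simp [hs]⟩
  set s := ℓ e with hsdef
  refine .of_approx fun R ε hε => ?_
  obtain ⟨M, hM, hMb⟩ := exists_bound_of_continuous (show Continuous fun z => Complex.exp (ℓ z) by
    fun_prop) R
  obtain ⟨K, hK, hKb⟩ := exists_bound_of_continuous m.continuous R
  set B := M * (2 * K * ‖e‖ + K ^ 2 * ‖s • v‖) + 1 with hB
  have hB0 : 0 < B := by positivity
  set c : ℝ := min (1 / K) (ε / B) with hc
  have hc0 : 0 < c := by positivity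
  have hcK : c * K ≤ 1 := (le_div_iff₀ hK).1 (min_le_left _ _)
  have hcB : c * B ≤ ε := (le_div_iff₀ hB0).1 (min_le_right _ _)
  have hcc : (c : ℂ) ≠ 0 := by exact_mod_cast hc0.ne'
  refine ⟨fun z => Complex.exp ((ℓ + (c : ℂ) • m) z) • (e - (s / c) • v) +
    (Complex.exp (ℓ z) • ((s / c) • v) + (s * Complex.exp (ℓ z) * m z) • v), ?_, ?_⟩
  · refine (flowApprox_shear _ ?_).add ((flowApprox_shear _ ?_).add
      (flowApprox_overshear ℓ m hv hm s) ?_ ?_) ?_ ?_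
    · simp [hme, hv, hm, ← hsdef]
      field_simp
      simp
    · simp [hv]
    all_goals fun_prop
  · intro z hz
    set w := (c : ℂ) * m z with hw
    have hwn : ‖w‖ ≤ c * K := by
      rw [hw, norm_mul, Complex.norm_real, Real.norm_of_nonneg hc0.le]
      gcongr
      exact hKb z hz
    have h1 := Complex.norm_exp_sub_one_sub_id_le (x := w) (by linarith)
    have h2 := Complex.norm_exp_sub_one_le (x := w) (by linarith)
    have : Complex.exp (ℓ z) • e - (Complex.exp ((ℓ + (c : ℂ) • m) z) • (e - (s / c) • v) +
        (Complex.exp (ℓ z) • ((s / c) • v) + (s * Complex.exp (ℓ z) * m z) • v)) =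
        Complex.exp (ℓ z) • (((c : ℂ)⁻¹ * (Complex.exp w - 1 - w)) • (s • v) -
          (Complex.exp w - 1) • e) := by
      have h3 : (ℓ + (c : ℂ) • m) z = ℓ z + w := by simp [hw]
      have h4 : m z = (c : ℂ)⁻¹ * w := by rw [hw]; field_simp
      rw [h3, Complex.exp_add, h4]
      simp only [smul_sub, smul_smul]
      match_scalars
      · ring
      · field_simp; ring
    rw [this, norm_smul]
    have h5 : ‖((c : ℂ)⁻¹ * (Complex.exp w - 1 - w)) • (s • v)‖ ≤ c * K ^ 2 * ‖s • v‖ := by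
      rw [norm_smul, norm_mul, norm_inv, Complex.norm_real, Real.norm_of_nonneg hc0.le]
      refine mul_le_mul_of_nonneg_right ?_ (norm_nonneg _)
      calc c⁻¹ * ‖Complex.exp w - 1 - w‖ ≤ c⁻¹ * (c * K) ^ 2 := by
            gcongr
            exact h1.trans (by gcongr)
        _ = c * K ^ 2 := by field_simp
    have h6 : ‖(Complex.exp w - 1) • e‖ ≤ c * (2 * K) * ‖e‖ := by
      rw [norm_smul]
      gcongr
      linarith
    calc _ ≤ M * (c * K ^ 2 * ‖s • v‖ + c * (2 * K) * ‖e‖) :=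
          mul_le_mul (hMb z hz) ((norm_sub_le _ _).trans (add_le_add h5 h6)) (norm_nonneg _) hM.le
      _ = c * (B - 1) := by rw [hB]; ring
      _ ≤ c * B := by gcongr; linarith
      _ ≤ ε := hcB

theorem ExpApprox.flowApprox_smul [FiniteDimensional ℂ E] (hE : 2 ≤ Module.finrank ℂ E)
    {f : E → ℂ} (hf : ExpApprox f) (e : E) : FlowApprox (fun z => f z • e) := by
  have key : ∀ P ∈ Submodule.span ℂ {f : E → ℂ | ∃ k : E →L[ℂ] ℂ, f = fun z => Complex.exp (k z)},
      Continuous P ∧ ∀ e : E, FlowApprox (fun z => P z • e) := by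
    intro P hP
    induction hP using Submodule.span_induction with
    | mem x hx =>
      obtain ⟨k, rfl⟩ := hx
      exact ⟨by fun_prop, flowApprox_exp_smul hE k⟩
    | zero =>
      refine ⟨continuous_zero, fun e => ?_⟩
      simpa using flowApprox_exp_smul hE (0 : E →L[ℂ] ℂ) 0
    | add x y _ _ hx hy =>
      refine ⟨hx.1.add hy.1, fun e => ?_⟩
      simpa [add_smul] using (hx.2 e).add (hy.2 e) (hx.1.smul continuous_const)
        (hy.1.smul continuous_const)
    | smul a x _ hx =>
      refine ⟨hx.1.const_smul a, fun e => ?_⟩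
      have := hx.2 (a • e)
      simpa [smul_smul, mul_comm] using this
  refine .of_approx fun R ε hε => ?_
  obtain ⟨P, hP, hfP⟩ := hf R (ε / (‖e‖ + 1)) (by positivity)
  refine ⟨_, (key P (by rw [← expAlgebra_eq_span]; exact hP)).2 e, fun z hz => ?_⟩
  rw [← sub_smul, norm_smul]
  calc _ ≤ ε / (‖e‖ + 1) * (‖e‖ + 1) :=
        mul_le_mul (hfP z hz) (by linarith) (norm_nonneg _) (by positivity)
    _ = ε := by field_simp

theorem IsHolAut.exists_iterate [FiniteDimensional ℂ E] {Φ : E ≃ E} (hΦ : IsHolAut Φ) (N : ℕ) :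
    ∃ Ψ : E ≃ E, IsHolAut Ψ ∧ ∀ z, Ψ z = Φ^[N] z := by
  induction N with
  | zero => exact ⟨Equiv.refl E, .refl, fun z => rfl⟩
  | succ N ih =>
    obtain ⟨Ψ, hΨ, h⟩ := ih
    refine ⟨Ψ.trans Φ, hΨ.trans hΦ, fun z => ?_⟩
    rw [Function.iterate_succ_apply', Equiv.trans_apply, h]

end FlowApproximation

/-- The Cauchy-Riemann operator, without its factor `1 / 2`. -/
def dbar (u : ℂ → ℂ) (t : ℂ) : ℂ := fderiv ℝ u t 1 + Complex.I * fderiv ℝ u t Complex.I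

theorem two_mul_dbar_eq (u : ℂ → ℂ) (t e : ℂ) :
    fderiv ℝ u t e + Complex.I * fderiv ℝ u t (Complex.I * e) = (starRingEnd ℂ e) * dbar u t := by
  have h1 : fderiv ℝ u t e = e.re * fderiv ℝ u t 1 + e.im * fderiv ℝ u t Complex.I := by
    have : e = e.re • (1 : ℂ) + e.im • Complex.I := by
      simp [Complex.re_add_im]
    conv_lhs => rw [this]
    rw [map_add, map_smul, map_smul]; simp
  have h2 : fderiv ℝ u t (Complex.I * e) = -e.im * fderiv ℝ u t 1 + e.re * fderiv ℝ u t Complex.I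
    := by
    have : Complex.I * e = (-e.im) • (1 : ℂ) + e.re • Complex.I := by
      apply Complex.ext <;> simp
    rw [this, map_add, map_smul, map_smul]; simp
  have h3 : starRingEnd ℂ e = e.re - e.im * Complex.I := by
    apply Complex.ext <;> simp
  rw [h1, h2, h3, dbar]
  linear_combination (e.im * fderiv ℝ u t Complex.I) * Complex.I_sq

open MeasureTheory in
theorem integral_inv_mul_dbar {u : ℂ → ℂ} (hu : ContDiff ℝ 1 u) (hc : HasCompactSupport u) (z : ℂ) :
    ∫ t, (t - z)⁻¹ * dbar u t = -(2 * Real.pi) * u z := by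
  have hcd : Continuous (fderiv ℝ u) := hu.continuous_fderiv one_ne_zero
  obtain ⟨R, hR⟩ := hc.isCompact.isBounded.subset_ball z
  have hRd : ∀ t, R ≤ ‖t - z‖ → fderiv ℝ u t = 0 := by
    intro t ht
    by_contra h
    have := hR (support_fderiv_subset ℝ h)
    rw [mem_ball, dist_eq_norm] at this
    linarith
  let p : ℝ × ℝ → ℂ := fun x => z + x.1 * Complex.exp (x.2 * Complex.I)
  have hp : Continuous p := by fun_prop
  let A : ℝ × ℝ → ℂ := fun x => fderiv ℝ u (p x) (Complex.exp (x.2 * Complex.I))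
  let B : ℝ × ℝ → ℂ := fun x => Complex.I * fderiv ℝ u (p x) (Complex.I * Complex.exp
    (x.2 * Complex.I))
  have hA : Continuous A := (hcd.comp hp).clm_apply (by fun_prop)
  have hB : Continuous B := continuous_const.mul ((hcd.comp hp).clm_apply (by fun_prop))
  have hnorm : ∀ x : ℝ × ℝ, ‖p x - z‖ = |x.1| := by
    intro x
    simp [p, Complex.norm_exp_ofReal_mul_I]
  have key : ∀ G : ℝ × ℝ → ℂ, Continuous G → (∀ x : ℝ × ℝ, R ≤ |x.1| → G x = 0) →
      IntegrableOn G (Ioi 0 ×ˢ Ioo (-Real.pi) Real.pi) := by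
    intro G hG h0
    have h1 : IntegrableOn G (Icc 0 R ×ˢ Icc (-Real.pi) Real.pi) :=
      hG.continuousOn.integrableOn_compact (isCompact_Icc.prod isCompact_Icc)
    refine h1.of_forall_sdiff_eq_zero (measurableSet_Ioi.prod measurableSet_Ioo) ?_
    rintro ⟨r, θ⟩ ⟨⟨hr, hθ⟩, hx⟩
    apply h0
    simp only [mem_Ioi] at hr
    simp only [mem_prod, mem_Icc, not_and, not_le] at hx
    by_contra hlt
    push Not at hlt
    rw [abs_of_pos hr] at hlt
    have := hx ⟨hr.le, hlt.le⟩ hθ.1.le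
    exact absurd hθ.2 (by simpa using this.le)
  have hiA := key A hA (fun x hx => by simp [A, hRd (p x) (by rwa [hnorm])])
  have hiB := key B hB (fun x hx => by simp [B, hRd (p x) (by rwa [hnorm])])
  have e1 : ∫ t, (t - z)⁻¹ * dbar u t = ∫ t, t⁻¹ * dbar u (z + t) := by
    rw [← integral_add_left_eq_self (fun t => (t - z)⁻¹ * dbar u t) z]
    simp
  have e2 : ∫ t, t⁻¹ * dbar u (z + t) = ∫ x in Ioi 0 ×ˢ Ioo (-Real.pi) Real.pi, (A x + B x) := by
    rw [← Complex.integral_comp_polarCoord_symm]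
    refine setIntegral_congr_fun (measurableSet_Ioi.prod measurableSet_Ioo) ?_
    rintro ⟨r, θ⟩ ⟨hr, hθ⟩
    have hr' : (r : ℂ) ≠ 0 := by exact_mod_cast (ne_of_gt hr)
    have hee : (Complex.cos θ + Complex.sin θ * Complex.I) = Complex.exp (θ * Complex.I) :=
      (Complex.exp_mul_I θ).symm
    have hconj : starRingEnd ℂ (Complex.exp (θ * Complex.I)) = (Complex.exp (θ * Complex.I))⁻¹ := by
      rw [← Complex.exp_conj, ← Complex.exp_neg]; simp
    have := two_mul_dbar_eq u (p (r, θ)) (Complex.exp (θ * Complex.I))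
    simp only [A, B]
    rw [this, hconj, Complex.polarCoord_symm_apply]
    simp only [p, Complex.ofReal_cos, Complex.ofReal_sin, hee, Complex.real_smul]
    field_simp
  rw [e1, e2, integral_add hiA hiB]
  have e3 : ∫ x in Ioi 0 ×ˢ Ioo (-Real.pi) Real.pi, A x = -(2 * Real.pi) * u z := by
    rw [Measure.volume_eq_prod, ← Measure.prod_restrict, ← integral_prod_swap,
      Measure.prod_restrict,
      setIntegral_prod]
    · have : ∀ θ : ℝ, ∫ r in Ioi (0 : ℝ), A (Prod.swap (θ, r)) = - u z := by
        intro θ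
        have hd : ∀ r ∈ Ici (0 : ℝ), HasDerivAt (fun r : ℝ => u (p (r, θ))) (A (r, θ)) r := by
          intro r _
          have h1 : HasDerivAt (fun r : ℝ => p (r, θ)) (Complex.exp (θ * Complex.I)) r := by
            simpa [p] using ((Complex.ofRealCLM.hasDerivAt (x := r)).mul_const
              (Complex.exp (θ * Complex.I))).const_add z
          exact ((hu.differentiable one_ne_zero (p (r, θ))).hasFDerivAt).comp_hasDerivAt r h1
        have hi : IntegrableOn (fun r => A (r, θ)) (Ioi 0) := by
          have h1 : IntegrableOn (fun r => A (r, θ)) (Icc 0 R) :=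
            (hA.comp (by fun_prop)).continuousOn.integrableOn_compact isCompact_Icc
          refine h1.of_forall_sdiff_eq_zero measurableSet_Ioi ?_
          rintro r ⟨hr, hx⟩
          simp only [mem_Ioi] at hr
          simp only [mem_Icc, not_and, not_le] at hx
          simp only [A]
          rw [hRd _ (by rw [hnorm]; simpa [abs_of_pos hr] using (hx hr.le).le)]; simp
        have ht : Filter.Tendsto (fun r : ℝ => u (p (r, θ))) Filter.atTop (nhds 0) := by
          refine tendsto_const_nhds.congr' ?_
          filter_upwards [Filter.eventually_ge_atTop (max R 0)] with r hr
          by_contra h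
          have h2 := hR (subset_tsupport u (Function.mem_support.2 (Ne.symm h)))
          rw [mem_ball, dist_eq_norm, hnorm] at h2
          simp only at h2
          rw [abs_of_nonneg (le_of_max_le_right hr)] at h2
          linarith [le_of_max_le_left hr]
        have := integral_Ioi_of_hasDerivAt_of_tendsto' hd hi ht
        simpa [p] using this
      simp only [this]
      rw [setIntegral_const]
      simp only [Measure.real, Real.volume_Ioo]
      rw [ENNReal.toReal_ofReal (by linarith [Real.pi_pos])]
      simp only [Complex.real_smul]; push_cast; ring
    · have := (hiA.swap)
      simpa [Measure.volume_eq_prod, Function.comp_def] using this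
  have e4 : ∫ x in Ioi 0 ×ˢ Ioo (-Real.pi) Real.pi, B x = 0 := by
    rw [Measure.volume_eq_prod, setIntegral_prod _ hiB]
    refine (setIntegral_congr_fun measurableSet_Ioi (g := fun _ => (0 : ℂ)) ?_).trans (by simp)
    intro r hr
    simp only [mem_Ioi] at hr
    have hr' : (r : ℂ) ≠ 0 := by exact_mod_cast (ne_of_gt hr)
    have hd : ∀ θ : ℝ, HasDerivAt (fun θ : ℝ => u (p (r, θ))) ((-Complex.I * r) * B (r, θ)) θ := by
      intro θ
      have h1 : HasDerivAt (fun θ : ℝ => p (r, θ)) (r • (Complex.I * Complex.exp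
        (θ * Complex.I))) θ := by
        have h0 : HasDerivAt (fun θ : ℝ => (θ : ℂ) * Complex.I) Complex.I θ := by
          simpa using (Complex.ofRealCLM.hasDerivAt (x := θ)).mul_const Complex.I
        have := ((h0.cexp).const_mul (r : ℂ)).const_add z
        refine this.congr_deriv ?_
        simp only [Complex.real_smul]; ring
      have := ((hu.differentiable one_ne_zero (p (r, θ))).hasFDerivAt).comp_hasDerivAt θ h1
      refine this.congr_deriv ?_
      rw [map_smul]
      simp only [B, Complex.real_smul]
      linear_combination (r * (fderiv ℝ u (p (r, θ))) (Complex.I * Complex.exp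
        (θ * Complex.I))) * Complex.I_sq
    have hi : IntervalIntegrable (fun θ => (-Complex.I * r) * B (r, θ)) volume (-Real.pi) Real.pi :=
      (continuous_const.mul (hB.comp (by fun_prop))).intervalIntegrable _ _
    have := intervalIntegral.integral_eq_sub_of_hasDerivAt (fun θ _ => hd θ) hi
    have h5 : p (r, Real.pi) = p (r, -Real.pi) := by
      simp [p, Complex.exp_neg, Complex.exp_pi_mul_I]
    rw [h5, sub_self, intervalIntegral.integral_const_mul,
      intervalIntegral.integral_of_le (by linarith [Real.pi_pos]),
        integral_Ioc_eq_integral_Ioo] at this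
    simpa [hr'] using this
  rw [e3, e4, add_zero]

theorem dbar_eq_zero_of_differentiableAt {f : ℂ → ℂ} {z : ℂ} (hf : DifferentiableAt ℂ f z) :
    dbar f z = 0 := by
  have h : fderiv ℝ f z = (fderiv ℂ f z).restrictScalars ℝ :=
    (hf.hasFDerivAt.restrictScalars ℝ).fderiv
  have h2 : fderiv ℂ f z Complex.I = Complex.I * fderiv ℂ f z 1 := by
    rw [← smul_eq_mul, ← map_smul]; simp
  rw [dbar, h]
  simp only [ContinuousLinearMap.coe_restrictScalars']
  rw [h2]
  linear_combination (fderiv ℂ f z 1) * Complex.I_sq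

open MeasureTheory in
theorem runge {K U : Set ℂ} (hK : IsCompact K) (hU : IsOpen U) {f : ℂ → ℂ}
    (hf : DifferentiableOn ℂ f U)
    (hull : ∀ S, IsCompact S → K ⊆ S → frontier S ⊆ K → S ⊆ U) {ε : ℝ} (hε : 0 < ε) :
    ∃ p : Polynomial ℂ, ∀ z ∈ K, ‖f z - p.eval z‖ ≤ ε := by
  have hKc : CompactSpace K := isCompact_iff_compactSpace.1 hK
  let X : C(K, ℂ) := ⟨fun x => x, by fun_prop⟩
  have hclosed := Subalgebra.isClosed_topologicalClosure (polynomialFunctions K)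
  let B : Subalgebra ℂ C(K, ℂ) := (polynomialFunctions K).topologicalClosure
  have hBcl : IsClosed (B : Set C(K, ℂ)) := hclosed
  have hBc : CompleteSpace B := hBcl.completeSpace_coe
  have hXB : X ∈ B := by
    apply (polynomialFunctions K).le_topologicalClosure
    refine ⟨Polynomial.X, trivial, ?_⟩
    ext x; simp [X]
  let XB : B := ⟨X, hXB⟩
  let S : Set ℂ := spectrum ℂ XB
  have hS : IsCompact S := spectrum.isCompact XB
  have hsX : spectrum ℂ X = K := by
    rw [ContinuousMap.spectrum_eq_range]; simp [X]
  have hfr : frontier S ⊆ K := by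
    have := Subalgebra.frontier_spectrum B XB
    exact this.trans hsX.le
  have hKS : K ⊆ S := by
    have := spectrum.subset_subalgebra XB
    rw [← hsX]; exact this
  have hSU : S ⊆ U := hull S hS hKS hfr
  obtain ⟨L, hL, hSL, hLU⟩ := exists_compact_between hS hU hSU
  obtain ⟨χ, hχ1, hχ0, -⟩ := exists_contMDiffMap_one_nhds_of_subset_interior (n := 1)
    (modelWithCornersSelf ℝ ℂ) hS.isClosed hSL
  have hχd : ContDiff ℝ 1 (χ : ℂ → ℝ) := χ.contMDiff.contDiff
  have hχt : tsupport (χ : ℂ → ℝ) ⊆ L := by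
    apply closure_minimal _ hL.isClosed
    intro x hx; by_contra h; exact hx (hχ0 x h)
  let u : ℂ → ℂ := fun t => (χ t : ℂ) * f t
  have hut : tsupport u ⊆ L := by
    refine subset_trans (closure_mono ?_) hχt
    intro x hx h; apply hx; simp [u, h]
  have hu : ContDiff ℝ 1 u := by
    rw [contDiff_iff_contDiffAt]
    intro x
    by_cases hx : x ∈ U
    · have h1 : ContDiffAt ℂ 1 f x := (hf.contDiffOn hU).contDiffAt (hU.mem_nhds hx)
      exact (Complex.ofRealCLM.contDiff.contDiffAt.comp x hχd.contDiffAt).mul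
        (h1.restrict_scalars ℝ)
    · have h1 : x ∉ tsupport u := fun h => hx (hLU (hut h))
      have h2 := notMem_tsupport_iff_eventuallyEq.1 h1
      exact contDiffAt_const.congr_of_eventuallyEq h2
  have huc : HasCompactSupport u := HasCompactSupport.of_support_subset_isCompact hL
    ((subset_tsupport u).trans hut)
  have hcd : Continuous (fderiv ℝ u) := hu.continuous_fderiv one_ne_zero
  have hdc : Continuous (dbar u) := by unfold dbar; fun_prop
  let C := tsupport (dbar u)
  have hCL : C ⊆ L := by
    refine closure_minimal ?_ hL.isClosed
    intro x hx
    by_contra h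
    have : fderiv ℝ u x = 0 := by
      by_contra h'; exact h (hut (support_fderiv_subset ℝ h'))
    apply hx; simp [dbar, this]
  have hC : IsCompact C := hL.of_isClosed_subset (isClosed_tsupport _) hCL
  have hCS : ∀ t ∈ C, t ∈ resolventSet ℂ XB := by
    intro t ht
    by_contra h
    have htS : t ∈ S := h
    have h1 : ∀ᶠ x in nhds t, χ x = 1 := hχ1.filter_mono (nhds_le_nhdsSet htS)
    have h2 : dbar u =ᶠ[nhds t] 0 := by
      filter_upwards [h1.eventually_nhds, hU.mem_nhds (hSU htS)] with x hx hxU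
      have h3 : u =ᶠ[nhds x] f := by
        filter_upwards [hx] with y hy; simp [u, hy]
      have h4 : dbar u x = dbar f x := by
        unfold dbar; rw [h3.fderiv_eq]
      rw [h4]
      exact dbar_eq_zero_of_differentiableAt (hf.differentiableAt (hU.mem_nhds hxU))
    exact (notMem_tsupport_iff_eventuallyEq.2 h2) ht
  let G : ℂ → B := fun t => dbar u t • resolvent XB t
  have hG : Integrable G := by
    refine (integrableOn_iff_integrable_of_support_subset (μ := volume) (f := G) (s := C) ?_).1 ?_
    rotate_left
    · refine ContinuousOn.integrableOn_compact hC ?_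
      refine hdc.continuousOn.smul ?_
      intro t ht
      exact (spectrum.hasDerivAt_resolvent_const_left (hCS t ht)).continuousAt.continuousWithinAt
    · intro t ht
      apply subset_tsupport
      intro h; apply ht; simp [G, h]
  let P : B := (-(1 / (2 * Real.pi) : ℂ)) • ∫ t, G t
  have hP : ∀ z : K, (P : C(K, ℂ)) z = f z := by
    intro z
    let Lz : B →L[ℂ] ℂ := (ContinuousMap.evalCLM ℂ z).comp (B.toSubmodule.subtypeL)
    have h1 : Lz (∫ t, G t) = ∫ t, Lz (G t) := (Lz.integral_comp_comm hG).symm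
    have h2 : ∀ t, Lz (G t) = (t - z)⁻¹ * dbar u t := by
      intro t
      by_cases ht : t ∈ C
      · have h3 := hCS t ht
        have h4 : (algebraMap ℂ B t - XB) * resolvent XB t = 1 := by
          rw [resolvent]; exact Ring.mul_inverse_cancel _ h3
        have h5 := congrArg (fun b : B => (b : C(K, ℂ)) z) h4
        have h6 : (t - (z : ℂ)) * ((resolvent XB t : B) : C(K, ℂ)) z = 1 := h5
        have h7 : Lz (G t) = dbar u t * ((resolvent XB t : B) : C(K, ℂ)) z := rfl
        rw [h7, mul_comm, eq_inv_of_mul_eq_one_right h6]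
      · have : dbar u t = 0 := image_eq_zero_of_notMem_tsupport ht
        simp [G, this]
    have h3 : (P : C(K, ℂ)) z = (-(1 / (2 * Real.pi) : ℂ)) * Lz (∫ t, G t) := rfl
    rw [h3, h1]
    simp only [h2]
    rw [integral_inv_mul_dbar hu huc]
    have h4 : χ (z : ℂ) = 1 := (hχ1.self_of_nhdsSet) z (hKS z.2)
    simp only [u, h4]
    have := Real.pi_ne_zero
    push_cast
    field_simp
  have hmem : (P : C(K, ℂ)) ∈ closure (polynomialFunctions K : Set C(K, ℂ)) := P.2
  obtain ⟨q, ⟨p, -, hp⟩, hq⟩ := Metric.mem_closure_iff.1 hmem ε hε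
  refine ⟨p, fun z hz => ?_⟩
  have h1 := ContinuousMap.norm_coe_le_norm ((P : C(K, ℂ)) - q) ⟨z, hz⟩
  rw [dist_eq_norm] at hq
  have h2 : ((P : C(K, ℂ)) - q) ⟨z, hz⟩ = f z - p.eval z := by
    rw [ContinuousMap.sub_apply, hP]
    congr 1
    rw [← hp]; simp
  rw [h2] at h1
  linarith

theorem inter_frontier_nonempty_of_isPreconnected {α : Type*} [TopologicalSpace α] {C S : Set α}
    (hC : IsPreconnected C) (h₁ : (C ∩ S).Nonempty) (h₂ : (C ∩ Sᶜ).Nonempty) :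
    (C ∩ frontier S).Nonempty := by
  by_contra h
  rw [not_nonempty_iff_eq_empty] at h
  have hsub : C ⊆ interior S ∪ interior Sᶜ := by
    intro x hx
    by_contra hx'
    rw [interior_compl, mem_union, not_or, mem_compl_iff, not_not] at hx'
    have : x ∈ C ∩ frontier S := ⟨hx, hx'.2, hx'.1⟩
    rw [h] at this; exact this
  obtain ⟨x, hx, h1, h2⟩ := hC _ _ isOpen_interior isOpen_interior hsub
    (by
      obtain ⟨x, hx, hxS⟩ := h₁
      refine ⟨x, hx, (hsub hx).resolve_right fun h' => interior_subset h' hxS⟩)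
    (by
      obtain ⟨x, hx, hxS⟩ := h₂
      refine ⟨x, hx, (hsub hx).resolve_left fun h' => hxS (interior_subset h')⟩)
  exact interior_subset h2 (interior_subset h1)

/-- A compact set whose frontier lies in `K` cannot meet a ray avoiding `K`. -/
theorem notMem_of_ray {K S : Set ℂ} (hS : IsCompact S) (hfr : frontier S ⊆ K) {t v : ℂ} (hv : v ≠ 0)
    (h : ∀ s : ℝ, 0 ≤ s → t + s * v ∉ K) : t ∉ S := by
  intro ht
  have hc : IsPreconnected ((fun s : ℝ => t + s * v) '' Ici 0) :=
    isPreconnected_Ici.image _ (by fun_prop)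
  obtain ⟨R, hR⟩ := hS.isBounded.subset_ball t
  have hRp : 0 < R := by simpa using hR ht
  have hne : ((fun s : ℝ => t + s * v) '' Ici 0 ∩ Sᶜ).Nonempty := by
    refine ⟨_, ⟨R / ‖v‖, by simp; positivity, rfl⟩, fun h' => ?_⟩
    have := hR h'
    have hv' := norm_pos_iff.2 hv
    simp [abs_of_pos hRp, hv'.ne'] at this
  obtain ⟨x, ⟨s, hs, rfl⟩, hx⟩ := inter_frontier_nonempty_of_isPreconnected
    hc ⟨t, ⟨0, by simp, by simp⟩, ht⟩ hne
  exact h s hs (hfr hx)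

/-- A polynomial that is small on a truncated disc and has very negative real part on a vertical
segment to its right. -/
theorem exists_polynomial_small_left {Q c c' s M ε : ℝ} (hc : c' < c) (hε : 0 < ε) :
    ∃ g : Polynomial ℂ, (∀ x : ℂ, ‖x‖ ≤ Q → x.re ≤ c' → ‖g.eval x‖ ≤ ε) ∧
      ∀ x : ℂ, x.re = c → |x.im| ≤ s → (g.eval x).re ≤ M := by
  let A : Set ℂ := closedBall 0 Q ∩ {x | x.re ≤ c'}
  let I : Set ℂ := {x | x.re = c ∧ |x.im| ≤ s}
  have hA : IsCompact A := (isCompact_closedBall 0 Q).inter_right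
    (isClosed_le Complex.continuous_re continuous_const)
  have hI : IsCompact I := by
    refine Metric.isCompact_of_isClosed_isBounded ?_ ?_
    · exact (isClosed_eq Complex.continuous_re continuous_const).inter
        (isClosed_le Complex.continuous_im.abs continuous_const)
    · refine (isBounded_closedBall (x := (0 : ℂ)) (r := |c| + s)).subset ?_
      rintro x ⟨h1, h2⟩
      simp only [mem_closedBall, dist_zero_right]
      have := Complex.norm_le_abs_re_add_abs_im x
      rw [h1] at this; linarith
  let m := (c + c') / 2
  have hm1 : c' < m := by simp only [m]; linarith
  have hm2 : m < c := by simp only [m]; linarith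
  let f : ℂ → ℂ := fun x => if x.re < m then 0 else ((M - 1 : ℝ) : ℂ)
  let U : Set ℂ := {x | x.re ≠ m}
  have hU : IsOpen U := isOpen_ne_fun Complex.continuous_re continuous_const
  have hf : DifferentiableOn ℂ f U := by
    intro x hx
    apply DifferentiableAt.differentiableWithinAt
    rcases lt_or_gt_of_ne hx with h | h
    · refine (differentiableAt_const (0 : ℂ)).congr_of_eventuallyEq ?_
      filter_upwards [(isOpen_lt Complex.continuous_re continuous_const).mem_nhds h] with y hy
      have hy' : y.re < m := hy
      simp [f, hy']
    · refine (differentiableAt_const ((M - 1 : ℝ) : ℂ)).congr_of_eventuallyEq ?_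
      filter_upwards [(isOpen_lt continuous_const Complex.continuous_re).mem_nhds h] with y hy
      have hy' : m < y.re := hy
      simp [f, not_lt.2 hy'.le]
  have hAU : A ∪ I ⊆ U := by
    rintro x (hx | hx)
    · exact (lt_of_le_of_lt hx.2 hm1).ne
    · have h1 : x.re = c := hx.1
      exact (h1.symm ▸ hm2).ne'
  obtain ⟨g, hg⟩ := runge (hA.union hI) hU hf (ε := min ε 1) (by
    intro S hS _ hfr
    refine subset_trans ?_ hAU
    intro t htS
    by_contra ht
    rw [mem_union, not_or] at ht
    let σ : ℝ := if 0 ≤ t.im then 1 else -1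
    have hσ : σ ≠ 0 := by simp only [σ]; split_ifs <;> norm_num
    have habs : ∀ r : ℝ, 0 ≤ r → |t.im + r * σ| = |t.im| + r := by
      intro r hr
      simp only [σ]; split_ifs with h
      · rw [abs_of_nonneg h, abs_of_nonneg (by linarith)]; ring
      · push Not at h
        rw [abs_of_neg h, abs_of_neg (by linarith)]; ring
    refine notMem_of_ray hS hfr (v := σ * Complex.I) (by simp [hσ]) ?_ htS
    intro r hr hmem
    have hre : (t + r * (σ * Complex.I)).re = t.re := by simp
    have him : (t + r * (σ * Complex.I)).im = t.im + r * σ := by simp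
    rcases hmem with h | h
    · apply ht.1
      refine ⟨?_, by simpa [hre] using h.2⟩
      have h1 : ‖t + r * (σ * Complex.I)‖ ≤ Q := by simpa using h.1
      simp only [mem_closedBall, dist_zero_right]
      refine le_trans ?_ h1
      rw [Complex.norm_eq_sqrt_sq_add_sq, Complex.norm_eq_sqrt_sq_add_sq, hre, him]
      apply Real.sqrt_le_sqrt
      have := habs r hr
      rw [← sq_abs t.im, ← sq_abs (t.im + r * σ), this]
      nlinarith [abs_nonneg t.im]
    · apply ht.2
      obtain ⟨h1, h2⟩ := h
      rw [hre] at h1; rw [him, habs r hr] at h2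
      exact ⟨h1, by linarith⟩) (lt_min hε one_pos)
  refine ⟨g, fun x hx hx' => ?_, fun x hx hx' => ?_⟩
  · have := hg x (Or.inl ⟨by simpa using hx, hx'⟩)
    have hfx : f x = 0 := by simp [f, lt_of_le_of_lt hx' hm1]
    rw [hfx, zero_sub, norm_neg] at this
    exact this.trans (min_le_left _ _)
  · have := hg x (Or.inr ⟨hx, hx'⟩)
    have hfx : f x = ((M - 1 : ℝ) : ℂ) := by
      simp only [f]; rw [if_neg]; rw [hx]; exact not_lt.2 hm2.le
    have h1 := (Complex.abs_re_le_norm _).trans (this.trans (min_le_right _ _))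
    rw [hfx, Complex.sub_re, Complex.ofReal_re] at h1
    linarith [(abs_le.1 h1).1]

section Walls

/-- A wall: a closed ball in a real affine hyperplane, with unit normal `normal`. -/
structure Wall (E : Type*) [NormedAddCommGroup E] [InnerProductSpace ℂ E] where
  normal : E
  level : ℝ
  size : ℝ
  norm_normal : ‖normal‖ = 1

variable {E : Type*} [NormedAddCommGroup E] [InnerProductSpace ℂ E]

/-- The points of a wall. -/
def Wall.carrier (w : Wall E) : Set E := {z | (inner ℂ w.normal z).re = w.level ∧ ‖z‖ ≤ w.size}

/-- The open half space below a wall. -/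
def Wall.below (w : Wall E) : Set E := {z | (inner ℂ w.normal z).re < w.level}

theorem Wall.isOpen_below (w : Wall E) : IsOpen w.below :=
  isOpen_lt (Complex.continuous_re.comp (innerSL ℂ w.normal).continuous) continuous_const

theorem IsHolAut.isClosed_range_comp {Φ : E ≃ E} (hΦ : IsHolAut Φ) {f : ℂ → E}
    (hcl : IsClosed (range f)) : IsClosed (range fun ζ => Φ (f ζ)) := by
  have h : range (fun ζ => Φ (f ζ)) = Φ.symm ⁻¹' range f := by
    ext x; constructor
    · rintro ⟨ζ, rfl⟩; exact ⟨ζ, by simp⟩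
    · rintro ⟨ζ, hζ⟩; exact ⟨ζ, by simp [hζ]⟩
  rw [h]
  exact hcl.preimage hΦ.contDiff_symm.continuous

variable [FiniteDimensional ℂ E]

theorem exists_isHolAut_avoid_wall (hE : 2 ≤ Module.finrank ℂ E) {f : ℂ → E} (hf : ContDiff ℂ 1 f)
    (hcl : IsClosed (range f)) {p : E} (hp : ‖p‖ = 1) {c c' : ℝ} (s : ℝ) (hc : c' < c) (Q : ℝ)
    {ε : ℝ} (hε : 0 < ε) :
    ∃ Φ : E ≃ E, IsHolAut Φ ∧ (∀ z, ‖z‖ ≤ Q → (inner ℂ p z).re ≤ c' →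
      ‖Φ z - z‖ ≤ ε ∧ ‖Φ.symm z - z‖ ≤ ε) ∧
      ∀ ζ, (inner ℂ p (Φ (f ζ))).re = c → ¬ ‖Φ (f ζ)‖ ≤ s := by
  let ℓ : E →L[ℂ] ℂ := innerSL ℂ p
  have hℓ : ∀ z, ℓ z = inner ℂ p z := fun z => rfl
  have hℓp : ℓ p = 1 := by rw [hℓ, inner_self_eq_norm_sq_to_K, hp]; simp
  have hℓn : ∀ z, ‖ℓ z‖ ≤ ‖z‖ := fun z => by
    have := norm_inner_le_norm (𝕜 := ℂ) p z
    rw [hp, one_mul] at this; exact this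
  let A : E →L[ℂ] E := ContinuousLinearMap.id ℂ E - ℓ.smulRight p
  have hAz : ∀ z, A z = z - ℓ z • p := fun z => rfl
  have hℓA : ∀ z, ℓ (A z) = 0 := by intro z; simp [hAz, hℓp]
  have hAA : ∀ z, A (A z) = A z := by intro z; rw [hAz (A z), hℓA]; simp
  have hAn : ∀ z, ‖A z‖ ≤ 2 * ‖z‖ := fun z => by
    rw [hAz]
    have := norm_sub_le z (ℓ z • p)
    rw [norm_smul, hp, mul_one] at this
    linarith [hℓn z]
  -- a small translation moving the curve off the line
  let G : ℂ × ℝ → E := fun x => (c + x.2 * Complex.I : ℂ) • p - f x.1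
  have hG : ContDiff ℝ 1 G := by
    have h1 : ContDiff ℝ 1 f := hf.restrict_scalars ℝ
    have h2 : ContDiff ℝ 1 (fun x : ℂ × ℝ => (c + x.2 * Complex.I : ℂ)) :=
      contDiff_const.add ((Complex.ofRealCLM.contDiff.comp contDiff_snd).mul contDiff_const)
    exact (h2.smul contDiff_const).sub (h1.comp contDiff_fst)
  have hdense : Dense (range G)ᶜ := by
    have : FiniteDimensional ℝ E := FiniteDimensional.complexToReal E
    apply hG.dense_compl_range_of_finrank_lt_finrank
    rw [Module.finrank_prod, Complex.finrank_real_complex, Module.finrank_self,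
      finrank_real_of_complex]
    omega
  let η := min (ε / 2) (min ((c - c') / 2) 1)
  have hη : 0 < η := lt_min (by linarith) (lt_min (by linarith) one_pos)
  obtain ⟨τ, hτ, hτG⟩ := hdense.exists_dist_lt 0 hη
  rw [dist_zero_left] at hτG
  have hτ1 : ‖τ‖ ≤ ε / 2 := hτG.le.trans (min_le_left _ _)
  have hτ2 : ‖τ‖ ≤ (c - c') / 2 := hτG.le.trans ((min_le_right _ _).trans (min_le_left _ _))
  have hτ3 : ‖τ‖ ≤ 1 := hτG.le.trans ((min_le_right _ _).trans (min_le_right _ _))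
  -- distance to the segment
  let I : Set ℂ := {x | x.re = c ∧ |x.im| ≤ s}
  have hI : IsCompact I := by
    refine Metric.isCompact_of_isClosed_isBounded ?_ ?_
    · exact (isClosed_eq Complex.continuous_re continuous_const).inter
        (isClosed_le Complex.continuous_im.abs continuous_const)
    · refine (isBounded_closedBall (x := (0 : ℂ)) (r := |c| + s)).subset ?_
      rintro x ⟨h1, h2⟩
      simp only [mem_closedBall, dist_zero_right]
      have := Complex.norm_le_abs_re_add_abs_im x
      rw [h1] at this; linarith
  let J : Set E := (fun x : ℂ => x • p - τ) '' I
  have hJ : IsCompact J := hI.image (by fun_prop)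
  have hdisj : Disjoint J (range f) := by
    rw [Set.disjoint_left]
    rintro _ ⟨x, ⟨hx, -⟩, rfl⟩ ⟨ζ, hζ⟩
    apply hτ
    refine ⟨(ζ, x.im), ?_⟩
    have : (c + x.im * Complex.I : ℂ) = x := by rw [← hx, Complex.re_add_im]
    simp only [G, this, hζ]
    abel
  obtain ⟨d, hd, hdJ⟩ := hJ.exists_thickening_subset_open hcl.isOpen_compl
    (disjoint_left.1 hdisj)
  have hd' : ∀ x ∈ I, ∀ ζ, d ≤ ‖f ζ + τ - x • p‖ := by
    intro x hx ζ
    by_contra hlt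
    push Not at hlt
    have : f ζ ∈ thickening d J := by
      rw [mem_thickening_iff]
      refine ⟨_, ⟨x, hx, rfl⟩, ?_⟩
      rw [dist_eq_norm]
      rwa [sub_sub_eq_add_sub]
    exact hdJ this ⟨ζ, rfl⟩
  let y := d / (4 * (|s| + 1))
  have hy : 0 < y := by positivity
  let Q' := |Q| + 1
  have hQ' : 0 < Q' := by positivity
  let ε' := min 1 (ε / (8 * Q'))
  have hε' : 0 < ε' := lt_min one_pos (by positivity)
  obtain ⟨g, hg1, hg2⟩ := exists_polynomial_small_left (Q := Q') (c := c) (c' := (c + c') / 2)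
    (s := s) (M := Real.log y) (ε := ε') (by linarith) hε'
  let u : ℂ → ℂ := fun x => - g.eval x
  have hu : Differentiable ℂ u := g.differentiable.neg
  let Θ := overshear ℓ A hAA hℓA u
  have hΘ : ∀ z, Θ z = z + (Complex.exp (u (ℓ z)) - 1) • A z := fun z => rfl
  have hΘs : ∀ z, Θ.symm z = z + (Complex.exp (- u (ℓ z)) - 1) • A z := fun z => rfl
  have hexp : ∀ (w : ℂ) (z : E), ‖w‖ ≤ ε' → ‖z‖ ≤ Q' → ‖(Complex.exp w - 1) • A z‖ ≤ ε / 2 := by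
    intro w z hw hz
    have h1 : ‖Complex.exp w - 1‖ ≤ 2 * ‖w‖ :=
      Complex.norm_exp_sub_one_le (hw.trans (min_le_left _ _))
    rw [norm_smul]
    calc ‖Complex.exp w - 1‖ * ‖A z‖ ≤ (2 * (ε / (8 * Q'))) * (2 * Q') := by
          gcongr
          · exact h1.trans (by linarith [hw.trans (min_le_right _ _)])
          · exact (hAn z).trans (by linarith)
      _ = ε / 2 := by field_simp; norm_num
  refine ⟨(Equiv.addRight τ).trans Θ, (isHolAut_addRight τ).trans
    (isHolAut_overshear ℓ A hAA hℓA hu), ?_, ?_⟩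
  · intro z hz hzc
    have hzQ : ‖z‖ ≤ |Q| := hz.trans (le_abs_self Q)
    constructor
    · have h1 : ‖z + τ‖ ≤ Q' := (norm_add_le _ _).trans (by simp only [Q']; linarith)
      have h2 : (ℓ (z + τ)).re ≤ (c + c') / 2 := by
        rw [map_add, Complex.add_re]
        have := (Complex.abs_re_le_norm (ℓ τ)).trans (hℓn τ)
        have h3 := le_abs_self (ℓ τ).re
        rw [hℓ z]; linarith
      have h3 := hexp (u (ℓ (z + τ))) (z + τ) (by
        simp only [u, norm_neg]; exact hg1 _ ((hℓn _).trans h1) h2) h1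
      have h4 : ((Equiv.addRight τ).trans Θ) z - z =
        τ + (Complex.exp (u (ℓ (z + τ))) - 1) • A (z + τ) := by
        simp only [Equiv.trans_apply, Equiv.coe_addRight, hΘ]; abel
      rw [h4]
      exact (norm_add_le _ _).trans (by linarith)
    · have h1 : ‖z‖ ≤ Q' := by simp only [Q']; linarith
      have h2 : (ℓ z).re ≤ (c + c') / 2 := by rw [hℓ z]; linarith
      have h3 := hexp (- u (ℓ z)) z (by
        simp only [u, neg_neg]; exact hg1 _ ((hℓn _).trans h1) h2) h1
      have h4 : ((Equiv.addRight τ).trans Θ).symm z - z =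
        -τ + (Complex.exp (- u (ℓ z)) - 1) • A z := by
        simp only [Equiv.symm_trans_apply, Equiv.addRight_symm, Equiv.coe_addRight, hΘs]; abel
      rw [h4]
      refine (norm_add_le _ _).trans ?_
      rw [norm_neg]; linarith
  · intro ζ hre hs
    let w := Θ (f ζ + τ)
    have hw : ((Equiv.addRight τ).trans Θ) (f ζ) = w := rfl
    rw [hw] at hre hs
    have h1 : Θ.symm w = f ζ + τ := Equiv.symm_apply_apply _ _
    have hwI : ℓ w ∈ I := ⟨hre, (Complex.abs_im_le_norm _).trans ((hℓn w).trans hs)⟩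
    have h2 := hd' _ hwI ζ
    have h3 : f ζ + τ - ℓ w • p = Complex.exp (- u (ℓ w)) • A w := by
      rw [← h1, hΘs, sub_smul, one_smul, hAz]; abel
    rw [h3, norm_smul, Complex.norm_exp] at h2
    have h4 : Real.exp (- u (ℓ w)).re ≤ y := by
      rw [← Real.exp_log hy]
      simp only [u, neg_neg]
      exact Real.exp_le_exp.2 (hg2 _ hwI.1 hwI.2)
    have h5 : ‖A w‖ ≤ 2 * (|s| + 1) := (hAn w).trans (by linarith [le_abs_self s])
    have h6 : Real.exp (- u (ℓ w)).re * ‖A w‖ ≤ y * (2 * (|s| + 1)) := by gcongr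
    have h7 : y * (2 * (|s| + 1)) = d / 2 := by simp only [y]; field_simp; norm_num
    linarith

theorem Wall.isCompact_carrier (w : Wall E) : IsCompact w.carrier := by
  have : ProperSpace E := FiniteDimensional.proper ℂ E
  refine Metric.isCompact_of_isClosed_isBounded ?_ ?_
  · exact (isClosed_eq (Complex.continuous_re.comp (innerSL ℂ w.normal).continuous)
      continuous_const).inter (isClosed_le continuous_norm continuous_const)
  · refine (isBounded_closedBall (x := (0 : E)) (r := w.size)).subset ?_
    rintro x ⟨-, h⟩
    simpa using h

theorem exists_isHolAut_avoid_walls (hE : 2 ≤ Module.finrank ℂ E) (L : List (Wall E))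
    (hL : L.Pairwise fun w w' => w.carrier ⊆ w'.below) {f : ℂ → E} (hf : ContDiff ℂ 1 f)
    (hcl : IsClosed (range f)) {K : Set E} (hK : IsCompact K) (hKL : ∀ w ∈ L, K ⊆ w.below)
    {ε : ℝ} (hε : 0 < ε) :
    ∃ Φ : E ≃ E, IsHolAut Φ ∧ (∀ z ∈ K, ‖Φ z - z‖ ≤ ε ∧ ‖Φ.symm z - z‖ ≤ ε) ∧
      ∀ w ∈ L, ∀ ζ, Φ (f ζ) ∉ w.carrier := by
  have : ProperSpace E := FiniteDimensional.proper ℂ E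
  induction L generalizing f K ε with
  | nil => exact ⟨Equiv.refl E, .refl, by simp [hε.le], by simp⟩
  | cons w L ih =>
    rw [List.pairwise_cons] at hL
    have hopen : IsOpen (⋂ v ∈ {v | v ∈ w :: L}, Wall.below v) :=
      (List.finite_toSet (w :: L)).isOpen_biInter fun v _ => v.isOpen_below
    obtain ⟨δ, hδ, hδK⟩ := hK.exists_cthickening_subset_open hopen
      (subset_iInter₂ fun v hv => hKL v hv)
    have hK1 : IsCompact (cthickening δ K) := hK.cthickening
    have hK1L : ∀ v ∈ w :: L, cthickening δ K ⊆ v.below := fun v hv =>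
      hδK.trans (biInter_subset_of_mem hv)
    obtain ⟨c', hc', hKc'⟩ : ∃ c' < w.level, ∀ z ∈ cthickening δ K,
        (inner ℂ w.normal z).re ≤ c' := by
      rcases (cthickening δ K).eq_empty_or_nonempty with h | h
      · exact ⟨w.level - 1, by linarith, by simp [h]⟩
      · obtain ⟨x, hx, hmax⟩ := hK1.exists_isMaxOn h (f := fun z => (inner ℂ w.normal z).re)
          (Complex.continuous_re.comp (innerSL ℂ w.normal).continuous).continuousOn
        exact ⟨_, hK1L w (by simp) hx, fun z hz => hmax hz⟩
    obtain ⟨Q, hQ⟩ := hK1.isBounded.exists_norm_le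
    have hε1 : 0 < min (ε / 2) δ := lt_min (by linarith) hδ
    obtain ⟨Φ₁, hΦ₁, hcl₁, hav₁⟩ := exists_isHolAut_avoid_wall hE hf hcl w.norm_normal w.size hc' Q
      hε1
    have hcl1 := hΦ₁.isClosed_range_comp hcl
    obtain ⟨d, hd, hdw⟩ := w.isCompact_carrier.exists_cthickening_subset_open hcl1.isOpen_compl (by
      rintro z hz ⟨ζ, rfl⟩
      exact hav₁ ζ hz.1 hz.2)
    obtain ⟨Φ₂, hΦ₂, hcl₂, hav₂⟩ := ih hL.2 (hΦ₁.contDiff.comp hf) hcl1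
      (hK1.union w.isCompact_carrier)
      (fun v hv => union_subset (hK1L v (List.mem_cons_of_mem _ hv)) (hL.1 v hv))
      (ε := min (min (ε / 2) δ) d) (lt_min hε1 hd)
    have hKK : K ⊆ cthickening δ K := self_subset_cthickening K
    have hthick : ∀ z ∈ K, ∀ y, ‖y - z‖ ≤ δ → y ∈ cthickening δ K := by
      intro z hz y hy
      exact mem_cthickening_of_dist_le y z δ K hz (by rwa [dist_eq_norm])
    refine ⟨Φ₁.trans Φ₂, hΦ₁.trans hΦ₂, ?_, ?_⟩
    · intro z hz
      constructor
      · have h1 := (hcl₁ z (hQ z (hKK hz)) (hKc' z (hKK hz))).1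
        have h2 := (hcl₂ (Φ₁ z) (Or.inl (hthick z hz _ (h1.trans (min_le_right _ _))))).1
        have h3 := h1.trans (min_le_left _ _)
        have h4 := (h2.trans (min_le_left _ _)).trans (min_le_left _ _)
        have h5 : (Φ₁.trans Φ₂) z - z = (Φ₂ (Φ₁ z) - Φ₁ z) + (Φ₁ z - z) := by simp
        rw [h5]
        exact (norm_add_le _ _).trans (by linarith)
      · have h2 := (hcl₂ z (Or.inl (hKK hz))).2
        have hm := hthick z hz _ ((h2.trans (min_le_left _ _)).trans (min_le_right _ _))
        have h1 := (hcl₁ (Φ₂.symm z) (hQ _ hm) (hKc' _ hm)).2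
        have h3 := h1.trans (min_le_left _ _)
        have h4 := (h2.trans (min_le_left _ _)).trans (min_le_left _ _)
        have h5 : (Φ₁.trans Φ₂).symm z - z =
          (Φ₁.symm (Φ₂.symm z) - Φ₂.symm z) + (Φ₂.symm z - z) := by simp
        rw [h5]
        exact (norm_add_le _ _).trans (by linarith)
    · intro v hv ζ hmem
      rw [List.mem_cons] at hv
      rcases hv with rfl | hv
      · have h2 := (hcl₂ _ (Or.inr hmem)).2
        apply hdw (mem_cthickening_of_dist_le (Φ₁ (f ζ)) _ d _ hmem ?_) ⟨ζ, rfl⟩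
        rw [dist_eq_norm]
        simpa using h2.trans (min_le_right _ _)
      · exact hav₂ v hv ζ hmem

/-- Unit spheres have `δ`-nets which are unions of a bounded number of `A * δ`-separated sets. -/
theorem exists_separated_nets (E : Type*) [NormedAddCommGroup E] [NormedSpace ℝ E]
    [FiniteDimensional ℝ E] (A : ℝ) :
    ∃ m : ℕ, ∀ δ : ℝ, 0 < δ → ∃ P : ℕ → Finset E, (∀ k, ∀ p ∈ P k, ‖p‖ = 1) ∧
      (∀ k, ∀ p ∈ P k, ∀ q ∈ P k, p ≠ q → A * δ < ‖p - q‖) ∧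
      ∀ u : E, ‖u‖ = 1 → ∃ k < m, ∃ p ∈ P k, ‖u - p‖ ≤ δ := by
  classical
  let d := Module.finrank ℝ E
  let L : E ≃L[ℝ] (Fin d → ℝ) := (Module.finBasis ℝ E).equivFunL
  obtain ⟨C₁, hC₁, hL₁⟩ : ∃ C : ℝ, 0 < C ∧ ∀ x, ‖L x‖ ≤ C * ‖x‖ :=
    (L : E →L[ℝ] (Fin d → ℝ)).bound
  obtain ⟨C₂, hC₂, hL₂⟩ : ∃ C : ℝ, 0 < C ∧ ∀ x, ‖L.symm x‖ ≤ C * ‖x‖ :=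
    (L.symm : (Fin d → ℝ) →L[ℝ] E).bound
  obtain ⟨M, hM⟩ := exists_nat_gt (A * C₂ * C₁ + 1)
  have hM1 : A * C₂ * C₁ < ((M + 1 : ℕ) : ℝ) - 1 := by push_cast; linarith
  let e := Fintype.equivFin (Fin d → ZMod (M + 1))
  refine ⟨Fintype.card (Fin d → ZMod (M + 1)), fun δ hδ => ?_⟩
  let a := δ / C₂
  have ha : 0 < a := by positivity
  let κ : E → (Fin d → ℤ) := fun u i => ⌊L u i / a⌋
  have hfin : (κ '' {u | ‖u‖ = 1}).Finite := by
    refine (Set.finite_Icc (fun _ : Fin d => ⌊-C₁ / a⌋) (fun _ => ⌊C₁ / a⌋)).subset ?_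
    rintro _ ⟨u, hu, rfl⟩
    have hu' : ‖u‖ = 1 := hu
    have h1 : ∀ i, |L u i| ≤ C₁ := fun i => by
      have := (norm_le_pi_norm (L u) i).trans (hL₁ u)
      rwa [hu', mul_one, Real.norm_eq_abs] at this
    constructor <;> intro i <;> apply Int.floor_mono <;> gcongr
    · exact (abs_le.1 (h1 i)).1
    · exact (abs_le.1 (h1 i)).2
  have hrep : ∀ k : Fin d → ℤ, ∃ p : E, k ∈ κ '' {u | ‖u‖ = 1} → ‖p‖ = 1 ∧ κ p = k := by
    intro k
    by_cases h : k ∈ κ '' {u | ‖u‖ = 1}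
    · obtain ⟨p, hp, hpk⟩ := h
      exact ⟨p, fun _ => ⟨hp, hpk⟩⟩
    · exact ⟨0, fun h' => absurd h' h⟩
  choose rep hrep using hrep
  let col : (Fin d → ℤ) → ℕ := fun k => (e fun i => (k i : ZMod (M + 1))).val
  have hfl : ∀ u i, (κ u i : ℝ) * a ≤ L u i ∧ L u i < (κ u i + 1) * a := fun u i => by
    have h1 := Int.floor_le (L u i / a)
    have h2 := Int.lt_floor_add_one (L u i / a)
    exact ⟨(le_div_iff₀ ha).1 h1, (div_lt_iff₀ ha).1 h2⟩
  refine ⟨fun j => (hfin.toFinset.filter fun k => col k = j).image rep, ?_, ?_, ?_⟩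
  · intro j p hp
    simp only [Finset.mem_image, Finset.mem_filter, Set.Finite.mem_toFinset] at hp
    obtain ⟨k, ⟨hk, -⟩, rfl⟩ := hp
    exact (hrep k hk).1
  · intro j p hp q hq hpq
    simp only [Finset.mem_image, Finset.mem_filter, Set.Finite.mem_toFinset] at hp hq
    obtain ⟨k, ⟨hk, hkj⟩, rfl⟩ := hp
    obtain ⟨l, ⟨hl, hlj⟩, rfl⟩ := hq
    have hkl : k ≠ l := fun h => hpq (by rw [h])
    obtain ⟨i, hi⟩ := Function.ne_iff.1 hkl
    have hcol : (k i : ZMod (M + 1)) = l i := by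
      have := e.injective (Fin.val_injective (hkj.trans hlj.symm))
      exact congrFun this i
    have hdvd := (ZMod.intCast_eq_intCast_iff_dvd_sub _ _ _).1 hcol
    have hge : ((M + 1 : ℕ) : ℤ) ≤ |l i - k i| :=
      Int.le_of_dvd (abs_pos.2 (sub_ne_zero.2 (Ne.symm hi))) ((dvd_abs _ _).2 hdvd)
    have hge' : ((M + 1 : ℕ) : ℝ) ≤ |(l i : ℝ) - k i| := by exact_mod_cast hge
    have h1 := hfl (rep k) i
    have h2 := hfl (rep l) i
    rw [(hrep k hk).2] at h1
    rw [(hrep l hl).2] at h2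
    have h3 : (((M + 1 : ℕ) : ℝ) - 1) * a < |L (rep k) i - L (rep l) i| := by
      rcases le_abs.1 hge' with h | h
      · rw [abs_sub_comm]
        refine lt_of_lt_of_le ?_ (le_abs_self _)
        nlinarith
      · refine lt_of_lt_of_le ?_ (le_abs_self _)
        nlinarith
    have h4 : |L (rep k) i - L (rep l) i| ≤ C₁ * ‖rep k - rep l‖ := by
      have := (norm_le_pi_norm (L (rep k - rep l)) i).trans (hL₁ _)
      simpa using this
    have h5 : A * C₂ * C₁ * a < C₁ * ‖rep k - rep l‖ :=
      (mul_lt_mul_of_pos_right hM1 ha).trans (h3.trans_le h4)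
    have h6 : A * C₂ * C₁ * a = C₁ * (A * δ) := by simp only [a]; field_simp
    rw [h6] at h5
    exact lt_of_mul_lt_mul_left h5 hC₁.le
  · intro u hu
    have hk : κ u ∈ κ '' {u | ‖u‖ = 1} := ⟨u, hu, rfl⟩
    refine ⟨col (κ u), (e _).2, rep (κ u), ?_, ?_⟩
    · simp only [Finset.mem_image, Finset.mem_filter, Set.Finite.mem_toFinset]
      exact ⟨κ u, ⟨hk, rfl⟩, rfl⟩
    · have h1 : ‖L (u - rep (κ u))‖ ≤ a := by
        rw [pi_norm_le_iff_of_nonneg ha.le]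
        intro i
        have h1 := hfl u i
        have h2 := hfl (rep (κ u)) i
        rw [(hrep _ hk).2] at h2
        rw [map_sub, Pi.sub_apply, Real.norm_eq_abs, abs_le]
        constructor <;> nlinarith
      have h2 := hL₂ (L (u - rep (κ u)))
      rw [L.symm_apply_apply] at h2
      refine h2.trans ((mul_le_mul_of_nonneg_left h1 hC₂.le).trans_eq ?_)
      simp only [a]; field_simp

end Walls

section Labyrinth

variable {E : Type*} [NormedAddCommGroup E] [InnerProductSpace ℂ E]

theorem norm_sub_smul_sq {p z : E} (hp : ‖p‖ = 1) (y : ℝ) :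
    ‖z - (y : ℂ) • p‖ ^ 2 = ‖z‖ ^ 2 - 2 * y * (inner ℂ p z).re + y ^ 2 := by
  have h : (inner ℂ z p).re = (inner ℂ p z).re := inner_re_symm (𝕜 := ℂ) z p
  rw [@norm_sub_sq ℂ, inner_smul_right, norm_smul, hp]
  simp [h]
  ring

theorem re_inner_le_norm_of_norm_eq_one {p : E} (hp : ‖p‖ = 1) (z : E) :
    (inner ℂ p z).re ≤ ‖z‖ := by
  have := re_inner_le_norm (𝕜 := ℂ) p z
  rwa [hp, one_mul] at this

/-- The list `L` of walls between the spheres of radii `ρ` and `r` forces crossing paths that avoid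
it to have length at least `l`. -/
structure Labyrinth (ρ r l : ℝ) (L : List (Wall E)) : Prop where
  pairwise : L.Pairwise fun w w' => w.carrier ⊆ w'.below
  lt_level : ∀ w ∈ L, ρ < w.level
  size_lt : ∀ w ∈ L, w.size < r
  le_eVariationOn : ∀ (γ : ℝ → E) (a b : ℝ), a ≤ b → ContinuousOn γ (Icc a b) → ‖γ a‖ ≤ ρ →
    r ≤ ‖γ b‖ → (∀ t ∈ Icc a b, ∀ w ∈ L, γ t ∉ w.carrier) →
    ENNReal.ofReal l ≤ eVariationOn γ (Icc a b)

theorem Labyrinth.append {ρ r₁ r₂ l₁ l₂ : ℝ} {L₁ L₂ : List (Wall E)} (h₁ : Labyrinth ρ r₁ l₁ L₁)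
    (h₂ : Labyrinth r₁ r₂ l₂ L₂) (hρ : ρ ≤ r₁) (hr : r₁ ≤ r₂) (hl₁ : 0 ≤ l₁) (hl₂ : 0 ≤ l₂) :
    Labyrinth ρ r₂ (l₁ + l₂) (L₁ ++ L₂) where
  pairwise := by
    rw [List.pairwise_append]
    refine ⟨h₁.pairwise, h₂.pairwise, fun w hw w' hw' z hz => ?_⟩
    have := re_inner_le_norm_of_norm_eq_one w'.norm_normal z
    exact lt_of_le_of_lt (this.trans hz.2) ((h₁.size_lt w hw).trans (h₂.lt_level w' hw'))
  lt_level w hw := by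
    rcases List.mem_append.1 hw with h | h
    · exact h₁.lt_level w h
    · exact hρ.trans_lt (h₂.lt_level w h)
  size_lt w hw := by
    rcases List.mem_append.1 hw with h | h
    · exact (h₁.size_lt w h).trans_le hr
    · exact h₂.size_lt w h
  le_eVariationOn γ a b hab hγ ha hb hav := by
    obtain ⟨t, ht, htr⟩ := intermediate_value_Icc hab hγ.norm ⟨ha.trans hρ, hr.trans hb⟩
    have htr' : ‖γ t‖ = r₁ := htr
    have e1 := h₁.le_eVariationOn γ a t ht.1 (hγ.mono (Icc_subset_Icc_right ht.2)) ha htr'.ge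
      fun s hs w hw => hav s (Icc_subset_Icc_right ht.2 hs) w (List.mem_append_left _ hw)
    have e2 := h₂.le_eVariationOn γ t b ht.2 (hγ.mono (Icc_subset_Icc_left ht.1)) htr'.le hb
      fun s hs w hw => hav s (Icc_subset_Icc_left ht.1 hs) w (List.mem_append_right _ hw)
    have e3 := eVariationOn.Icc_add_Icc γ (s := univ) ht.1 ht.2 (mem_univ _)
    simp only [univ_inter] at e3
    rw [← e3, ENNReal.ofReal_add hl₁ hl₂]
    exact add_le_add e1 e2

/-- One round of walls: `m` layers of walls at distance `O(σ ^ 2)`, gaining length `σ`. -/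
theorem exists_labyrinth_round [FiniteDimensional ℂ E] {ρ r : ℝ} (hρ : 0 < ρ) (hρr : ρ < r) :
    ∃ m : ℕ, ∀ (σ c : ℝ), 0 < σ → ρ ≤ c → c + (m + 1) * (3 * σ ^ 2 / ρ) ≤ r →
      ∃ L : List (Wall E), Labyrinth c (c + (m + 1) * (3 * σ ^ 2 / ρ)) σ L := by
  have : FiniteDimensional ℝ E := FiniteDimensional.complexToReal E
  have hr : 0 < r := hρ.trans hρr
  obtain ⟨m, hm⟩ := exists_separated_nets E (4 * r / ρ)
  refine ⟨m, fun σ c hσ hc hcr => ?_⟩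
  obtain ⟨P, hP1, hPsep, hPnet⟩ := hm (σ / r) (by positivity)
  have hsep : ∀ k, ∀ p ∈ P k, ∀ q ∈ P k, p ≠ q → 4 * σ / ρ < ‖p - q‖ := by
    intro k p hp q hq hpq
    have := hPsep k p hp q hq hpq
    rwa [show 4 * r / ρ * (σ / r) = 4 * σ / ρ by field_simp] at this
  set h := 3 * σ ^ 2 / ρ with hh
  have hhp : 0 < h := by positivity
  have hhρ : h * ρ = 3 * σ ^ 2 := by rw [hh]; field_simp
  let lev : ℕ → ℝ := fun k => c + (k + 1) * h
  let sz : ℕ → ℝ := fun k => √(lev k ^ 2 + 4 * σ ^ 2)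
  have hlev : ∀ k, c < lev k := fun k => by
    simp only [lev]
    have : 0 < ((k : ℝ) + 1) * h := by positivity
    linarith
  have hsq : ∀ k, sz k ^ 2 = lev k ^ 2 + 4 * σ ^ 2 := fun k => Real.sq_sqrt (by positivity)
  have hsz : ∀ k, sz k < lev k + h := fun k => by
    have h1 := hlev k
    refine Real.sqrt_lt' (by linarith) |>.2 ?_
    nlinarith [mul_lt_mul_of_pos_left (hc.trans_lt h1) hhp, sq_nonneg h, sq_pos_of_pos hσ]
  let mk : ℕ → {p : E // ‖p‖ = 1} → Wall E := fun k p => ⟨p, lev k, sz k, p.2⟩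
  let L : List (Wall E) := (List.range m).flatMap fun k =>
    ((P k).attach.toList).map fun p : {p // p ∈ P k} => mk k ⟨p.1, hP1 k p.1 p.2⟩
  have hmem : ∀ w, w ∈ L ↔ ∃ k < m, ∃ p, ∃ hp : p ∈ P k, w = mk k ⟨p, hP1 k p hp⟩ := by
    intro w
    simp only [L, List.mem_flatMap, List.mem_range, List.mem_map, Finset.mem_toList,
      Finset.mem_attach, true_and, Subtype.exists]
    constructor
    · rintro ⟨k, hk, p, hp, rfl⟩; exact ⟨k, hk, p, hp, rfl⟩
    · rintro ⟨k, hk, p, hp, rfl⟩; exact ⟨k, hk, p, hp, rfl⟩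
  have hlevm : ∀ k < m, lev k + h ≤ c + (m + 1) * h := fun k hk => by
    have : (k : ℝ) + 1 ≤ m := by exact_mod_cast hk
    simp only [lev]; nlinarith
  refine ⟨L, ?_, ?_, ?_, ?_⟩
  · rw [List.pairwise_flatMap]
    constructor
    · intro k hk
      rw [List.pairwise_map]
      refine ((P k).attach.nodup_toList).imp ?_
      rintro ⟨p, hp⟩ ⟨q, hq⟩ hpq z ⟨hz1, hz2⟩
      have hpq' : p ≠ q := fun h => hpq (Subtype.ext h)
      have hd := hsep k p hp q hq hpq'
      change (inner ℂ p z).re = lev k at hz1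
      change ‖z‖ ≤ sz k at hz2
      change (inner ℂ q z).re < lev k
      have e1 := norm_sub_smul_sq (hP1 k p hp) (lev k) (z := z)
      have e2 : ‖z‖ ^ 2 ≤ sz k ^ 2 := by gcongr
      rw [hz1] at e1; rw [hsq] at e2
      have e3 : ‖z - (lev k : ℂ) • p‖ ≤ 2 * σ := by
        apply le_of_sq_le_sq _ (by positivity)
        nlinarith
      have e4 : (inner ℂ (q - p) (z - (lev k : ℂ) • p)).re ≤ ‖p - q‖ * (2 * σ) := by
        refine (re_inner_le_norm (𝕜 := ℂ) _ _).trans ?_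
        rw [norm_sub_rev q p]; gcongr
      have e5 := norm_sub_smul_sq (hP1 k p hp) 1 (z := q)
      rw [hP1 k q hq] at e5
      have e6 : (inner ℂ q p).re = (inner ℂ p q).re := inner_re_symm (𝕜 := ℂ) q p
      have e7 : (inner ℂ p p).re = 1 := by
        rw [inner_self_eq_norm_sq_to_K, hP1 k p hp]; simp
      have e8 : (inner ℂ (q - p) (z - (lev k : ℂ) • p)).re =
          (inner ℂ q z).re - (inner ℂ p z).re - lev k * ((inner ℂ q p).re - (inner ℂ p p).re) := by
        rw [inner_sub_left, inner_sub_right, inner_sub_right, inner_smul_right, inner_smul_right]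
        simp; ring
      rw [e8, hz1, e6, e7] at e4
      simp only [Complex.ofReal_one, one_smul] at e5
      rw [norm_sub_rev] at e5
      have e9 : 4 * σ < ‖p - q‖ * lev k := by
        rw [div_lt_iff₀ hρ] at hd
        exact hd.trans (mul_lt_mul_of_pos_left (hc.trans_lt (hlev k))
          (norm_pos_iff.2 (sub_ne_zero.2 hpq')))
      have e10 : 0 < ‖p - q‖ := norm_pos_iff.2 (sub_ne_zero.2 hpq')
      have e11 : lev k * ((inner ℂ p q).re - 1) = - (‖p - q‖ * (‖p - q‖ * lev k)) / 2 := by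
        linear_combination (lev k / 2) * e5
      have e12 := mul_lt_mul_of_pos_left e9 e10
      rw [e11] at e4
      linarith
    · refine List.pairwise_lt_range.imp ?_
      intro j k hjk w hw w' hw' z hz
      simp only [List.mem_map] at hw hw'
      obtain ⟨p, -, rfl⟩ := hw
      obtain ⟨q, -, rfl⟩ := hw'
      have h1 : ‖z‖ ≤ sz j := hz.2
      have h2 := re_inner_le_norm_of_norm_eq_one (hP1 k q.1 q.2) z
      have h3 : lev j + h ≤ lev k := by
        have : (j : ℝ) + 1 ≤ k := by exact_mod_cast hjk
        simp only [lev]; nlinarith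
      change (inner ℂ (q : E) z).re < lev k
      linarith [hsz j]
  · intro w hw
    obtain ⟨k, -, p, hp, rfl⟩ := (hmem w).1 hw
    exact hlev k
  · intro w hw
    obtain ⟨k, hk, p, hp, rfl⟩ := (hmem w).1 hw
    exact (hsz k).trans_le (hlevm k hk)
  · intro γ a b hab hγ ha hb hav
    by_contra hlt
    push Not at hlt
    set R := c + (m + 1) * h with hR
    have hRc : c ≤ R := by
      have : 0 < ((m : ℝ) + 1) * h := by positivity
      linarith
    have hRp : 0 < R := by linarith
    obtain ⟨b', hb', hbR⟩ := intermediate_value_Icc hab hγ.norm ⟨ha.trans hRc, hb⟩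
    have hbR' : ‖γ b'‖ = R := hbR
    have hclose : ∀ t ∈ Icc a b, ‖γ t - γ b'‖ ≤ σ := by
      intro t ht
      have h1 := (eVariationOn.edist_le γ ht hb').trans hlt.le
      rw [edist_dist] at h1
      have := (ENNReal.ofReal_le_ofReal_iff hσ.le).1 h1
      rwa [dist_eq_norm] at this
    obtain ⟨k, hk, p, hp, hup⟩ := hPnet ((R⁻¹ : ℂ) • γ b') (by
      rw [norm_smul, hbR']; simp [abs_of_pos hRp, hRp.ne'])
    have hRbp : ‖γ b' - (R : ℂ) • p‖ ≤ σ := by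
      have e1 : γ b' - (R : ℂ) • p = (R : ℂ) • ((R⁻¹ : ℂ) • γ b' - p) := by
        rw [smul_sub, smul_smul, mul_inv_cancel₀ (by exact_mod_cast hRp.ne'), one_smul]
      rw [e1, norm_smul, Complex.norm_real, Real.norm_of_nonneg hRp.le]
      calc R * _ ≤ r * (σ / r) := by gcongr
        _ = σ := by field_simp
    have hbk : lev k ≤ (inner ℂ p (γ b')).re := by
      have e1 := norm_sub_smul_sq (hP1 k p hp) R (z := γ b')
      rw [hbR'] at e1
      have e2 : ‖γ b' - (R : ℂ) • p‖ ^ 2 ≤ σ ^ 2 := by gcongr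
      have e3 := hlevm k hk
      have e4 : σ ^ 2 ≤ 2 * R * h := by nlinarith
      have e5 : R * lev k ≤ R * (inner ℂ p (γ b')).re := by nlinarith
      exact le_of_mul_le_mul_left e5 hRp
    have hak : (inner ℂ p (γ a)).re ≤ lev k :=
      ((re_inner_le_norm_of_norm_eq_one (hP1 k p hp) _).trans ha).trans (hlev k).le
    have hcont : ContinuousOn (fun t => (inner ℂ p (γ t)).re) (Icc a b') :=
      (Complex.continuous_re.comp (innerSL ℂ p).continuous).comp_continuousOn
        (hγ.mono (Icc_subset_Icc_right hb'.2))
    obtain ⟨t, ht, htk⟩ := intermediate_value_Icc hb'.1 hcont ⟨hak, hbk⟩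
    have htk' : (inner ℂ p (γ t)).re = lev k := htk
    have htab : t ∈ Icc a b := Icc_subset_Icc_right hb'.2 ht
    apply hav t htab _ ((hmem _).2 ⟨k, hk, p, hp, rfl⟩)
    refine ⟨htk', ?_⟩
    change ‖γ t‖ ≤ sz k
    have e1 := norm_sub_smul_sq (hP1 k p hp) R (z := γ t)
    rw [htk'] at e1
    have e2 : ‖γ t - (R : ℂ) • p‖ ≤ 2 * σ := by
      have : γ t - (R : ℂ) • p = (γ t - γ b') + (γ b' - (R : ℂ) • p) := by abel
      rw [this]
      exact (norm_add_le _ _).trans (by linarith [hclose t htab])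
    have e3 : ‖γ t - (R : ℂ) • p‖ ^ 2 ≤ (2 * σ) ^ 2 := by gcongr
    apply Real.le_sqrt_of_sq_le
    nlinarith [sq_nonneg (lev k - R)]

theorem exists_labyrinth [FiniteDimensional ℂ E] {ρ r : ℝ} (hρ : 0 < ρ) (hρr : ρ < r) :
    ∃ L : List (Wall E), Labyrinth ρ r 1 L := by
  obtain ⟨m, hm⟩ := exists_labyrinth_round (E := E) hρ hρr
  obtain ⟨J, hJ⟩ := exists_nat_gt (3 * (m + 1) / (ρ * (r - ρ)))
  have hrρ : 0 < r - ρ := by linarith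
  have hJ0 : (0 : ℝ) < J := lt_of_le_of_lt (by positivity) hJ
  let T : ℝ := (m + 1) * (3 * (1 / J : ℝ) ^ 2 / ρ)
  have hT : 0 < T := by positivity
  have hJT : ρ + J * T ≤ r := by
    have h1 : J * T = 3 * (m + 1) / (ρ * J) := by simp only [T]; field_simp
    rw [div_lt_iff₀ (by positivity)] at hJ
    have : J * T ≤ r - ρ := by
      rw [h1, div_le_iff₀ (by positivity)]; nlinarith
    linarith
  have key : ∀ j : ℕ, j ≤ J → ∃ L : List (Wall E), Labyrinth ρ (ρ + j * T) (j * (1 / J : ℝ)) L := by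
    intro j
    induction j with
    | zero => exact fun _ => ⟨[], by simp, by simp, by simp, by simp⟩
    | succ j ih =>
      intro hj
      obtain ⟨L, hL⟩ := ih (by omega)
      have hj' : ((j : ℝ) + 1) ≤ J := by exact_mod_cast hj
      have hjT : 0 ≤ j * T := by positivity
      obtain ⟨L', hL'⟩ := hm (1 / J) (ρ + j * T) (by positivity) (by linarith) (by
        change ρ + j * T + T ≤ r
        nlinarith)
      refine ⟨L ++ L', ?_⟩
      have e1 : ρ + (j + 1 : ℕ) * T = ρ + j * T + T := by push_cast; ring
      have e2 : ((j + 1 : ℕ) : ℝ) * (1 / J : ℝ) = j * (1 / J : ℝ) + 1 / J := by push_cast; ring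
      rw [e1, e2]
      exact hL.append hL' (by linarith) (by linarith [hT.le]) (by positivity) (by positivity)
  obtain ⟨L, hL⟩ := key J le_rfl
  have hJ1 : (J : ℝ) * (1 / J) = 1 := by field_simp
  rw [hJ1] at hL
  exact ⟨L, hL.pairwise, hL.lt_level, fun w hw => (hL.size_lt w hw).trans_le hJT,
    fun γ a b hab hγ ha hb => hL.le_eVariationOn γ a b hab hγ ha (hJT.trans hb)⟩

end Labyrinth

section Correction

variable {E : Type*} [NormedAddCommGroup E] [NormedSpace ℂ E]

/-- Lagrange interpolation with vector values and a uniform bound. -/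
theorem exists_interpolation {ι : Type*} [DecidableEq ι] (T : Finset ι) {B m : ℝ} (hm : 0 < m) :
    ∃ M : ℝ, 0 < M ∧ ∀ (x : ι → ℂ) (k : ι → E) (κ : ℝ), 0 ≤ κ → (∀ i ∈ T, ‖x i‖ ≤ B) →
      (∀ i ∈ T, ∀ j ∈ T, i ≠ j → m ≤ ‖x i - x j‖) → (∀ i ∈ T, ‖k i‖ ≤ κ) →
      ∃ u : ℂ → E, Differentiable ℂ u ∧ (∀ i ∈ T, u (x i) = k i) ∧
        (∀ t, ‖t‖ ≤ B → ‖u t‖ ≤ M * κ) ∧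
        ∀ ℓ : E →L[ℂ] ℂ, (∀ i ∈ T, ℓ (k i) = 0) → ∀ t, ℓ (u t) = 0 := by
  set b := max 1 (2 * B / m) with hb
  have hb1 : 1 ≤ b := le_max_left _ _
  refine ⟨T.card * b ^ T.card + 1, by positivity, fun x k κ hκ hx hxm hk => ?_⟩
  refine ⟨fun t => ∑ j ∈ T, (∏ i ∈ T.erase j, (t - x i) / (x j - x i)) • k j, ?_, ?_, ?_, ?_⟩
  · fun_prop
  · intro i hi
    beta_reduce
    rw [Finset.sum_eq_single_of_mem i hi]
    · rw [Finset.prod_eq_one, one_smul]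
      intro j hj
      rw [Finset.mem_erase] at hj
      refine div_self ?_
      intro h0
      have := hxm i hi j hj.2 hj.1.symm
      rw [h0, norm_zero] at this
      linarith
    · intro j hj hji
      rw [Finset.prod_eq_zero (i := i) (Finset.mem_erase.2 ⟨hji.symm, hi⟩) (by simp), zero_smul]
  · intro t ht
    refine (norm_sum_le _ _).trans ?_
    have hterm : ∀ j ∈ T, ‖(∏ i ∈ T.erase j, (t - x i) / (x j - x i)) • k j‖ ≤ b ^ T.card * κ := by
      intro j hj
      rw [norm_smul, norm_prod]
      refine mul_le_mul ?_ (hk j hj) (norm_nonneg _) (by positivity)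
      calc ∏ i ∈ T.erase j, ‖(t - x i) / (x j - x i)‖ ≤ ∏ _i ∈ T.erase j, b := by
            refine Finset.prod_le_prod (fun _ _ => norm_nonneg _) fun i hi => ?_
            rw [Finset.mem_erase] at hi
            refine le_trans ?_ (le_max_right _ _)
            rw [norm_div]
            refine div_le_div₀ ?_ ?_ hm (hxm j hj i hi.2 hi.1.symm)
            · have := (norm_nonneg _).trans ht
              linarith
            · linarith [norm_sub_le t (x i), hx i hi.2]
        _ = b ^ (T.erase j).card := by simp
        _ ≤ b ^ T.card := pow_le_pow_right₀ hb1 (Finset.card_le_card (Finset.erase_subset _ _))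
    refine (Finset.sum_le_sum hterm).trans ?_
    rw [Finset.sum_const, nsmul_eq_mul, ← mul_assoc]
    gcongr
    linarith
  · intro ℓ hℓ t
    beta_reduce
    rw [map_sum]
    exact Finset.sum_eq_zero fun j hj => by rw [map_smul, hℓ j hj, smul_zero]

theorem exists_shear_interpolating [FiniteDimensional ℂ E] (ℓ : E →L[ℂ] ℂ) (T : Finset E)
    (hℓ : ∀ x ∈ T, ∀ y ∈ T, x ≠ y → ℓ (x - y) ≠ 0) (r : ℝ) {ε : ℝ} (hε : 0 < ε) :
    ∃ δ > 0, ∀ t' d : E → E, (∀ x ∈ T, ‖t' x - x‖ ≤ δ) → (∀ x ∈ T, ‖d x‖ ≤ δ) →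
      (∀ x ∈ T, ℓ (d x) = 0) →
      ∃ C : E ≃ E, IsHolAut C ∧ (∀ x ∈ T, C (t' x) = t' x + d x) ∧
        ∀ z, ‖z‖ ≤ r → ‖C z - z‖ ≤ ε ∧ ‖C.symm z - z‖ ≤ ε := by
  classical
  obtain ⟨m, hm, hmT⟩ : ∃ m > 0, ∀ x ∈ T, ∀ y ∈ T, x ≠ y → m ≤ ‖ℓ (x - y)‖ := by
    have : (insert 1 (T.offDiag.image fun p => ‖ℓ (p.1 - p.2)‖) : Finset ℝ).Nonempty := by simp
    refine ⟨_, (Finset.lt_min'_iff _ this).2 ?_, fun x hx y hy hxy => Finset.min'_le _ _ ?_⟩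
    · intro y hy
      simp only [Finset.mem_insert, Finset.mem_image, Finset.mem_offDiag] at hy
      rcases hy with rfl | ⟨p, hp, rfl⟩
      · exact one_pos
      · exact norm_pos_iff.2 (hℓ _ hp.1 _ hp.2.1 hp.2.2)
    · simp only [Finset.mem_insert, Finset.mem_image, Finset.mem_offDiag]
      exact Or.inr ⟨(x, y), ⟨hx, hy, hxy⟩, rfl⟩
  obtain ⟨R, hR⟩ := (T.image norm).exists_le
  have hR : ∀ x ∈ T, ‖x‖ ≤ R := fun x hx => hR _ (Finset.mem_image_of_mem _ hx)
  set B := ‖ℓ‖ * (max r R + 1) with hB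
  obtain ⟨M, hM, hinterp⟩ := exists_interpolation (E := E) T (B := B) (half_pos hm)
  set δ := min 1 (min (ε / M) (m / (4 * (‖ℓ‖ + 1)))) with hδ
  have hδ1 : δ ≤ 1 := min_le_left _ _
  have hδ2 : M * δ ≤ ε := by
    have : δ ≤ ε / M := (min_le_right _ _).trans (min_le_left _ _)
    rwa [le_div_iff₀ hM, mul_comm] at this
  have hδ3 : ‖ℓ‖ * δ ≤ m / 4 := by
    have : δ ≤ m / (4 * (‖ℓ‖ + 1)) := (min_le_right _ _).trans (min_le_right _ _)
    rw [le_div_iff₀ (by positivity)] at this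
    have : 0 ≤ δ := by positivity
    nlinarith
  have hδ0 : 0 < δ := by positivity
  refine ⟨δ, hδ0, fun t' d ht' hd hdℓ => ?_⟩
  obtain ⟨u, hu, hux, hub, huℓ⟩ := hinterp (fun x => ℓ (t' x)) d δ hδ0.le (fun x hx => by
      refine (ℓ.le_opNorm _).trans (mul_le_mul_of_nonneg_left ?_ (norm_nonneg _))
      have := norm_add_le (t' x - x) x
      rw [sub_add_cancel] at this
      linarith [ht' x hx, hR x hx, le_max_right r R]) (fun x hx y hy hxy => by
      have h1 := hmT x hx y hy hxy
      have h2 : ℓ (x - y) = (ℓ (t' x) - ℓ (t' y)) - ℓ (t' x - x) + ℓ (t' y - y) := by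
        simp only [map_sub]; ring
      have h3 : ∀ x ∈ T, ‖ℓ (t' x - x)‖ ≤ m / 4 := fun x hx =>
        (ℓ.le_opNorm _).trans ((mul_le_mul_of_nonneg_left (ht' x hx) (norm_nonneg _)).trans hδ3)
      rw [h2] at h1
      have h4 := norm_add_le ((ℓ (t' x) - ℓ (t' y)) - ℓ (t' x - x)) (ℓ (t' y - y))
      have h5 := norm_sub_le (ℓ (t' x) - ℓ (t' y)) (ℓ (t' x - x))
      linarith [h3 x hx, h3 y hy]) hd
  have hb : ∀ z, ‖z‖ ≤ r → ‖u (ℓ z)‖ ≤ ε := fun z hz => (hub _ (by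
      refine (ℓ.le_opNorm _).trans (mul_le_mul_of_nonneg_left ?_ (norm_nonneg _))
      linarith [le_max_left r R])).trans hδ2
  refine ⟨shear ℓ u (huℓ ℓ hdℓ), isHolAut_shear ℓ u _ hu, fun x hx => ?_, fun z hz => ⟨?_, ?_⟩⟩
  · rw [shear_apply, hux x hx]
  · rw [shear_apply, add_sub_cancel_left]
    exact hb z hz
  · rw [shear_symm_apply, sub_sub_cancel_left, norm_neg]
    exact hb z hz

/-- A small perturbation of finitely many points is undone by an automorphism close to the
identity. -/
theorem exists_correction [FiniteDimensional ℂ E] (hE : 2 ≤ Module.finrank ℂ E) (T : Finset E)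
    (r : ℝ) {ε : ℝ} (hε : 0 < ε) :
    ∃ δ > 0, ∀ t' : E → E, (∀ x ∈ T, ‖t' x - x‖ ≤ δ) →
      ∃ C : E ≃ E, IsHolAut C ∧ (∀ x ∈ T, C (t' x) = x) ∧
        ∀ z, ‖z‖ ≤ r → ‖C z - z‖ ≤ ε ∧ ‖C.symm z - z‖ ≤ ε := by
  classical
  obtain ⟨f₁, hf₁⟩ := Module.exists_dual_forall_apply_ne_zero (K := ℂ) (M := E)
    (ι := T.offDiag) (fun p => p.1.1 - p.1.2)
    (fun p => sub_ne_zero.2 (Finset.mem_offDiag.1 p.2).2.2)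
  obtain ⟨v, hv, hv0⟩ := Submodule.exists_mem_ne_zero_of_ne_bot
    (LinearMap.ker_ne_bot_of_finrank_lt (f := f₁) (by rw [Module.finrank_self]; lia))
  obtain ⟨f₂, hf₂⟩ := Module.exists_dual_forall_apply_ne_zero (K := ℂ) (M := E)
    (ι := Option T.offDiag) (fun p => p.elim v fun p => p.1.1 - p.1.2)
    (fun p => by
      cases p with
      | none => exact hv0
      | some p => exact sub_ne_zero.2 (Finset.mem_offDiag.1 p.2).2.2)
  have hfv : f₂ v ≠ 0 := hf₂ none
  set ℓ₁ : E →L[ℂ] ℂ := f₁.toContinuousLinearMap with hℓ₁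
  set ℓ₂ : E →L[ℂ] ℂ := (f₂ v)⁻¹ • f₂.toContinuousLinearMap with hℓ₂
  have hv1 : ℓ₁ v = 0 := hv
  have hv2 : ℓ₂ v = 1 := by
    change (f₂ v)⁻¹ * f₂ v = 1
    exact inv_mul_cancel₀ hfv
  obtain ⟨δ₁, hδ₁, h₁⟩ := exists_shear_interpolating ℓ₁ T (fun x hx y hy hxy =>
    hf₁ ⟨(x, y), Finset.mem_offDiag.2 ⟨hx, hy, hxy⟩⟩) (r + 1) (ε := min 1 (ε / 2)) (by positivity)
  obtain ⟨δ₂, hδ₂, h₂⟩ := exists_shear_interpolating ℓ₂ T (fun x hx y hy hxy =>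
    mul_ne_zero (inv_ne_zero hfv)
      (hf₂ (some ⟨(x, y), Finset.mem_offDiag.2 ⟨hx, hy, hxy⟩⟩))) (r + 1) (ε := min 1 (ε / 2))
    (by positivity)
  set A := ‖ℓ₂‖ * ‖v‖ with hA
  have hA0 : 0 ≤ A := by positivity
  refine ⟨min δ₁ δ₂ / (1 + A), by positivity, fun t' ht' => ?_⟩
  have ht₁ : ∀ x ∈ T, (1 + A) * ‖t' x - x‖ ≤ min δ₁ δ₂ := fun x hx => by
    have := ht' x hx
    rwa [le_div_iff₀ (by positivity), mul_comm] at this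
  have hk : ∀ x, ‖ℓ₂ (x - t' x) • v‖ ≤ A * ‖t' x - x‖ := fun x => by
    rw [norm_smul, norm_sub_rev, hA]
    have := mul_le_mul_of_nonneg_right (ℓ₂.le_opNorm (x - t' x)) (norm_nonneg v)
    linarith
  have hkx : ∀ x, ‖t' x + ℓ₂ (x - t' x) • v - x‖ ≤ (1 + A) * ‖t' x - x‖ := fun x => by
    have := norm_add_le (t' x - x) (ℓ₂ (x - t' x) • v)
    rw [show t' x + ℓ₂ (x - t' x) • v - x = t' x - x + ℓ₂ (x - t' x) • v by abel]
    linarith [hk x]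
  obtain ⟨C₁, hC₁, hC₁t, hC₁ε⟩ := h₁ t' (fun x => ℓ₂ (x - t' x) • v)
    (fun x hx => by
      have := ht₁ x hx
      have := norm_nonneg (t' x - x)
      nlinarith [min_le_left δ₁ δ₂])
    (fun x hx => by
      have := ht₁ x hx
      have := norm_nonneg (t' x - x)
      nlinarith [min_le_left δ₁ δ₂, hk x])
    (fun x hx => by rw [map_smul, hv1, smul_zero])
  obtain ⟨C₂, hC₂, hC₂t, hC₂ε⟩ := h₂ (fun x => t' x + ℓ₂ (x - t' x) • v)
    (fun x => x - (t' x + ℓ₂ (x - t' x) • v))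
    (fun x hx => (hkx x).trans ((ht₁ x hx).trans (min_le_right _ _)))
    (fun x hx => by
      rw [norm_sub_rev]
      exact (hkx x).trans ((ht₁ x hx).trans (min_le_right _ _)))
    (fun x hx => by
      rw [← sub_sub, map_sub, map_smul, hv2, smul_eq_mul, mul_one, sub_self])
  refine ⟨C₁.trans C₂, hC₁.trans hC₂, fun x hx => ?_, fun z hz => ⟨?_, ?_⟩⟩
  · rw [Equiv.trans_apply, hC₁t x hx, hC₂t x hx, add_sub_cancel]
  · have h3 := (hC₁ε z (by linarith)).1
    have h4 : ‖C₁ z‖ ≤ r + 1 := by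
      have := norm_add_le (C₁ z - z) z
      rw [sub_add_cancel] at this
      linarith [min_le_left 1 (ε / 2)]
    have h5 := (hC₂ε _ h4).1
    have := norm_add_le (C₂ (C₁ z) - C₁ z) (C₁ z - z)
    rw [sub_add_sub_cancel] at this
    rw [Equiv.trans_apply]
    linarith [min_le_right 1 (ε / 2)]
  · have h3 := (hC₂ε z (by linarith)).2
    have h4 : ‖C₂.symm z‖ ≤ r + 1 := by
      have := norm_add_le (C₂.symm z - z) z
      rw [sub_add_cancel] at this
      linarith [min_le_left 1 (ε / 2)]
    have h5 := (hC₁ε _ h4).2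
    have := norm_add_le (C₁.symm (C₂.symm z) - C₂.symm z) (C₂.symm z - z)
    rw [sub_add_sub_cancel] at this
    rw [Equiv.symm_trans_apply]
    linarith [min_le_right 1 (ε / 2)]

end Correction

/-- The Runge approximation theorem on convex compact sets. -/
theorem runge_convex {K U : Set ℂ} (hK : IsCompact K) (hKc : Convex ℝ K) (hU : IsOpen U)
    (hKU : K ⊆ U)
    {f : ℂ → ℂ} (hf : DifferentiableOn ℂ f U) {ε : ℝ} (hε : 0 < ε) :
    ∃ p : Polynomial ℂ, ∀ z ∈ K, ‖f z - p.eval z‖ ≤ ε := by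
  rcases K.eq_empty_or_nonempty with rfl | ⟨k, hk⟩
  · exact ⟨0, by simp⟩
  refine runge hK hU hf (fun S hS _ hfr => ?_) hε
  intro t ht
  by_contra htU
  have htK : t ∉ K := fun h => htU (hKU h)
  refine notMem_of_ray hS hfr (v := t - k) (sub_ne_zero.2 fun h => htK (h ▸ hk)) (fun s hs hsK =>
    htK ?_) ht
  have h1 : (0 : ℝ) < 1 + s := by linarith
  have := hKc hk hsK (a := s / (1 + s)) (b := 1 / (1 + s)) (by positivity) (by positivity)
    (by field_simp; ring)
  convert this using 1
  simp only [Complex.real_smul]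
  have h2 : (1 + s : ℂ) ≠ 0 := by exact_mod_cast h1.ne'
  push_cast
  field_simp
  ring

section Stretch

variable {E : Type*} [NormedAddCommGroup E] [NormedSpace ℂ E]

/-- An automorphism close to the identity on the hypersurface `W = 0` and stretching a segment
`[q, q + s • e]` transverse to it to the segment `[q, q + e]`. -/
theorem exists_isHolAut_stretch [FiniteDimensional ℂ E] (hE : 2 ≤ Module.finrank ℂ E) {W : E → ℂ}
    (hW : ExpApprox W) (hWd : ContDiff ℂ 1 W) {q e : E} (hq : W q = 0)
    (hne : ∀ s : ℝ, 0 < s → s ≤ 1 → W (q + (s : ℂ) • e) ≠ 0)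
    (hd : deriv (fun t : ℂ => W (q + t • e)) 0 ≠ 0) {s₀ : ℝ} (hs₀ : 0 < s₀) (hs₁ : s₀ < 1) (R : ℝ)
    {ε : ℝ} (hε : 0 < ε) :
    ∃ Φ : E ≃ E, IsHolAut Φ ∧ (∀ z, W z = 0 → ‖z‖ ≤ R → ‖Φ z - z‖ ≤ ε) ∧
      ∀ u ∈ Icc (0 : ℝ) 1, ‖Φ (q + ((s₀ * u : ℝ) : ℂ) • e) - (q + (u : ℂ) • e)‖ ≤ ε := by
  have he : e ≠ 0 := by
    rintro rfl
    simp at hd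
  obtain ⟨x, hx⟩ := SeparatingDual.exists_eq_one (R := ℂ) he
  set θ : ℂ → ℂ := fun t => W (q + t • e) with hθ
  have hθd : Differentiable ℂ θ := by
    have : ContDiff ℂ 1 θ := hWd.comp (by fun_prop)
    exact this.differentiable one_ne_zero
  have hθ0 : θ 0 = 0 := by simp [hθ, hq]
  set g : ℂ → ℂ := dslope θ 0 with hg
  have hgd : Differentiable ℂ g := by
    rw [← differentiableOn_univ] at hθd ⊢
    exact (Complex.differentiableOn_dslope Filter.univ_mem).2 hθd
  have hgθ : ∀ t, t * g t = θ t := fun t => by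
    have := sub_smul_dslope θ 0 t
    simpa [hθ0] using this
  set Z : Set ℂ := (fun s : ℝ => (s : ℂ)) '' Icc 0 1 with hZ
  have hZc : IsCompact Z := isCompact_Icc.image (by fun_prop)
  have hZcv : Convex ℝ Z := (convex_Icc (0 : ℝ) 1).linear_image (Complex.ofRealCLM : ℝ →ₗ[ℝ] ℂ)
  have hgZ : ∀ t ∈ Z, g t ≠ 0 := by
    rintro _ ⟨s, hs, rfl⟩
    rcases hs.1.eq_or_lt with rfl | h
    · simpa [hg, dslope_same] using hd
    · intro h0
      refine hne s h hs.2 ?_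
      have := hgθ s
      rw [h0, mul_zero] at this
      exact this.symm
  set O : Set ℂ := {t | g t ≠ 0} with hO
  have hOo : IsOpen O := isOpen_ne_fun hgd.continuous continuous_const
  obtain ⟨ρ₁, hρ₁, hρO⟩ := hZc.exists_cthickening_subset_open hOo hgZ
  set K := cthickening ρ₁ Z with hK
  have hKc : IsCompact K := hZc.cthickening
  set h₀ : ℂ → ℂ := fun t => (g t)⁻¹ with hh₀
  have hh₀d : DifferentiableOn ℂ h₀ O := fun t ht => (hgd t).inv ht |>.differentiableWithinAt
  -- the model field on a tube around the segment
  set V₀ : E → E := fun y => (W y * h₀ (x (y - q))) • e with hV₀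
  set ρ := ρ₁ / (‖x‖ + 1) with hρ
  have hρ0 : 0 < ρ := by positivity
  set Y : Set E := (fun t : ℂ => q + t • e) '' Z with hY
  have hYc : IsCompact Y := hZc.image (by fun_prop)
  have hYcv : Convex ℝ Y := by
    have h1 : Convex ℝ ((fun t : ℂ => t • e) '' Z) :=
      hZcv.linear_image ((LinearMap.toSpanSingleton ℂ E e).restrictScalars ℝ)
    have h2 := h1.translate q
    rw [image_image] at h2
    exact h2
  set Tb := cthickening ρ Y with hTb
  have hTc : IsCompact Tb := by
    have : ProperSpace E := FiniteDimensional.proper ℂ E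
    exact hYc.cthickening
  have hTx : ∀ y ∈ Tb, x (y - q) ∈ K := by
    intro y hy
    rw [hTb, hYc.cthickening_eq_biUnion_closedBall hρ0.le] at hy
    simp only [mem_iUnion, hY] at hy
    obtain ⟨_, ⟨t, ht, rfl⟩, hyt⟩ := hy
    refine mem_cthickening_of_dist_le _ t _ _ ht ?_
    have h1 : x (y - q) - t = x (y - (q + t • e)) := by
      simp only [map_sub, map_add, map_smul, hx, smul_eq_mul]; ring
    rw [dist_eq_norm, h1]
    refine (x.le_opNorm _).trans ?_
    rw [mem_closedBall, dist_eq_norm] at hyt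
    calc ‖x‖ * ‖y - (q + t • e)‖ ≤ (‖x‖ + 1) * ρ :=
          mul_le_mul (by linarith) hyt (norm_nonneg _) (by positivity)
      _ = ρ₁ := by rw [hρ]; field_simp
  obtain ⟨L₀, hL₀⟩ : ∃ L, LipschitzOnWith L V₀ Tb := by
    refine ContDiffOn.exists_lipschitzOnWith (n := 1) ?_ one_ne_zero (hYcv.cthickening _) hTc
    have h1 : ContDiffOn ℂ 1 h₀ O := hh₀d.contDiffOn hOo
    have h2 : ContDiffOn ℂ 1 V₀ Tb := by
      refine (hWd.contDiffOn.mul (h1.comp (f := fun y => x (y - q)) (by fun_prop) ?_)).smul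
        contDiffOn_const
      exact fun y hy => hρO (hTx y hy)
    exact h2.restrict_scalars ℝ
  obtain ⟨B, hB⟩ := hTc.exists_bound_of_continuousOn (f := fun y => ‖W y‖ * ‖e‖)
    (hWd.continuous.norm.mul continuous_const).continuousOn
  set T₀ := s₀⁻¹ with hT₀
  have hT₀0 : 0 < T₀ := by positivity
  have hT₀1 : 1 < T₀ := (one_lt_inv₀ hs₀).2 hs₁
  obtain ⟨RT, hRT⟩ := hTc.isBounded.exists_norm_le
  -- the accuracy of the polynomial field
  set ε' := min ε ρ with hε'
  set b₀ := ε' / (T₀ * Real.exp (L₀ * T₀)) with hb₀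
  have hb₀0 : 0 < b₀ := by positivity
  obtain ⟨h, hh⟩ := runge_convex hKc (hZcv.cthickening _) hOo hρO hh₀d
    (ε := b₀ / 2 / (|B| + 1)) (by positivity)
  set V : E → E := fun y => (W y * h.eval (x (y - q))) • e with hV
  have hVfl : FlowApprox V := by
    refine ExpApprox.flowApprox_smul hE (hW.mul (ExpApprox.polynomial (f := fun y => x
      (y - q)) ?_ h)) e
    have := (ExpApprox.linear x).sub (.const (x q))
    simpa using this
  have hVV : ∀ y ∈ Tb, ‖V y - V₀ y‖ ≤ b₀ / 2 := by
    intro y hy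
    have h1 := hh _ (hTx y hy)
    have h2 := hB y hy
    rw [hV, hV₀, ← sub_smul, ← mul_sub, norm_smul, norm_mul]
    rw [norm_sub_rev] at h1
    have h3 : ‖W y‖ * ‖e‖ ≤ |B| + 1 := by
      rw [Real.norm_of_nonneg (by positivity)] at h2
      linarith [le_abs_self B]
    calc _ = (‖W y‖ * ‖e‖) * ‖h.eval (x (y - q)) - h₀ (x (y - q))‖ := by ring
      _ ≤ (|B| + 1) * (b₀ / 2 / (|B| + 1)) := mul_le_mul h3 h1 (norm_nonneg _) (by positivity)
      _ = b₀ / 2 := by field_simp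
  obtain ⟨L, hL⟩ : ∃ L, LipschitzOnWith L V (closedBall 0 (R + 1)) := by
    have : ProperSpace E := FiniteDimensional.proper ℂ E
    refine ContDiffOn.exists_lipschitzOnWith (n := 1) ?_ one_ne_zero (convex_closedBall _ _)
      (isCompact_closedBall _ _)
    have h2 : ContDiff ℂ 1 V := by
      refine (hWd.mul ?_).smul contDiff_const
      exact (h.contDiff_aeval (R := ℂ) 1).comp (by fun_prop : ContDiff ℂ 1 fun y => x (y - q))
    exact (h2.restrict_scalars ℝ).contDiffOn
  set ε'' := min ε 1 with hε''
  set b₁ := ε'' / (T₀ * Real.exp (L * T₀)) with hb₁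
  have hb₁0 : 0 < b₁ := by positivity
  obtain ⟨τ₀, hτ₀, hfl⟩ := hVfl (max (R + 1) RT) (min (b₀ / 2) b₁) (by positivity)
  -- the time step
  obtain ⟨N, hN⟩ := exists_nat_gt (T₀ / τ₀)
  have hN0 : (0 : ℝ) < N := lt_trans (by positivity) hN
  have hN0' : N ≠ 0 := by rintro rfl; simp at hN0
  set τ := T₀ ^ ((N : ℝ)⁻¹) - 1 with hτ
  have hτN : (1 + τ) ^ N = T₀ := by
    rw [hτ, add_sub_cancel, Real.rpow_inv_natCast_pow hT₀0.le hN0']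
  have hτ0 : 0 < τ := by
    rw [hτ, sub_pos]
    exact Real.one_lt_rpow hT₀1 (by positivity)
  have hNτ : N * τ ≤ T₀ := by
    have := one_add_mul_le_pow (a := τ) (by linarith) N
    linarith
  have hττ : τ < τ₀ := by
    rw [div_lt_iff₀ hτ₀] at hN
    by_contra! h
    have := mul_le_mul_of_nonneg_left h hN0.le
    linarith
  obtain ⟨Φ, hΦ, hΦV⟩ := hfl τ hτ0 hττ
  obtain ⟨Ψ, hΨ, hΨΦ⟩ := hΦ.exists_iterate N
  have hbound : ∀ (Λ b c : ℝ), 0 ≤ Λ → 0 < c → b = c / (T₀ * Real.exp (Λ * T₀)) →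
      b * (N * τ) * Real.exp (Λ * (N * τ)) ≤ c := by
    intro Λ b c hΛ hc hb
    calc b * (N * τ) * Real.exp (Λ * (N * τ)) ≤ b * T₀ * Real.exp (Λ * T₀) := by
          have : 0 < b := by rw [hb]; positivity
          gcongr
      _ = c := by rw [hb]; field_simp
  refine ⟨Ψ, hΨ, fun z hz hzR => ?_, fun u hu => ?_⟩
  · have hVz : V z = 0 := by simp [hV, hz]
    have h1 := norm_iterate_sub_le (s := Φ) (z := fun _ => z) (N := N) (L := L) (b := b₁) (ρ := 1)
      (τ := τ) L.2 hb₁0.le hτ0.le (fun j hj y hy => ?_)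
      ((hbound L b₁ ε'' L.2 (by positivity) hb₁).trans (min_le_right _ _)) N le_rfl
    · rw [hΨΦ]
      exact h1.trans ((hbound L b₁ ε'' L.2 (by positivity) hb₁).trans (min_le_left _ _))
    · have hyR : ‖y‖ ≤ R + 1 := by
        have := norm_add_le (y - z) z
        rw [sub_add_cancel] at this
        linarith
      have h2 := hΦV y (hyR.trans (le_max_left _ _))
      have h3 := hL.norm_sub_le (x := y) (y := z) (by simpa using hyR) (by simp; linarith)
      rw [hVz, sub_zero] at h3
      have h4 : Φ y - z = (Φ y - y - (τ : ℂ) • V y) + (y - z) + (τ : ℂ) • V y := by abel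
      rw [h4]
      refine norm_add₃_le.trans ?_
      have h5 : ‖(τ : ℂ) • V y‖ ≤ τ * (L * ‖y - z‖) := by
        rw [norm_smul, Complex.norm_real, Real.norm_of_nonneg hτ0.le]
        gcongr
      have h6 : min (b₀ / 2) b₁ * τ ≤ b₁ * τ := by gcongr; exact min_le_right _ _
      linarith
  · set zj : ℕ → E := fun j => q + ((s₀ * (1 + τ) ^ j * u : ℝ) : ℂ) • e with hzj
    have hz0 : zj 0 = q + ((s₀ * u : ℝ) : ℂ) • e := by simp [hzj]
    have hzN : zj N = q + (u : ℂ) • e := by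
      simp only [hzj, hτN, hT₀]
      rw [mul_inv_cancel₀ hs₀.ne', one_mul]
    have hzZ : ∀ j ≤ N, ((s₀ * (1 + τ) ^ j * u : ℝ) : ℂ) ∈ Z := by
      intro j hj
      refine ⟨_, ⟨by have := hu.1; positivity, ?_⟩, rfl⟩
      have h1 : (1 + τ) ^ j ≤ T₀ := hτN ▸ pow_le_pow_right₀ (by linarith) hj
      calc s₀ * (1 + τ) ^ j * u ≤ s₀ * T₀ * 1 := by
            refine mul_le_mul (by gcongr) hu.2 hu.1 (by positivity)
        _ = 1 := by rw [hT₀, mul_inv_cancel₀ hs₀.ne', one_mul]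
    have h1 := norm_iterate_sub_le (s := Φ) (z := zj) (N := N) (L := L₀) (b := b₀) (ρ := ρ)
      (τ := τ) L₀.2 hb₀0.le hτ0.le (fun j hj y hy => ?_)
      ((hbound L₀ b₀ ε' L₀.2 (by positivity) hb₀).trans (min_le_right _ _)) N le_rfl
    · rw [hΨΦ, ← hz0, ← hzN]
      exact h1.trans ((hbound L₀ b₀ ε' L₀.2 (by positivity) hb₀).trans (min_le_left _ _))
    · have hzY : zj j ∈ Y := ⟨_, hzZ j hj.le, rfl⟩
      have hzT : zj j ∈ Tb := self_subset_cthickening _ hzY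
      have hyT : y ∈ Tb := mem_cthickening_of_dist_le _ _ _ _ hzY (by rwa [dist_eq_norm])
      have h2 := hΦV y ((hRT y hyT).trans (le_max_right _ _))
      have h3 := hL₀.norm_sub_le hyT hzT
      have h5 := hVV y hyT
      have hVz : (τ : ℂ) • V₀ (zj j) = zj (j + 1) - zj j := by
        obtain ⟨t, ht⟩ : ∃ t : ℂ, t = ((s₀ * (1 + τ) ^ j * u : ℝ) : ℂ) := ⟨_, rfl⟩
        have e1 : zj j = q + t • e := by rw [ht]
        have e2 : zj (j + 1) = q + ((1 + τ) * t) • e := by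
          rw [ht]; simp only [hzj]; congr 2; push_cast; ring
        have e3 : x (zj j - q) = t := by rw [e1, add_sub_cancel_left, map_smul, hx, smul_eq_mul,
          mul_one]
        have e4 : W (zj j) = t * g t := by rw [hgθ, e1]
        have e5 : g t ≠ 0 := hgZ t (ht ▸ hzZ j hj.le)
        have e6 : V₀ (zj j) = t • e := by
          simp only [hV₀]
          rw [e3, e4, hh₀]
          simp only
          rw [mul_assoc, mul_inv_cancel₀ e5, mul_one]
        rw [e6, e1, e2, smul_smul, add_sub_add_left_eq_sub, ← sub_smul]
        congr 1
        ring
      have h4 : Φ y - zj (j + 1) = (Φ y - y - (τ : ℂ) • V y) + (y - zj j) +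
          (τ : ℂ) • ((V y - V₀ y) + (V₀ y - V₀ (zj j))) := by
        rw [sub_add_sub_cancel, smul_sub, hVz]; abel
      rw [h4]
      refine norm_add₃_le.trans ?_
      have h6 : ‖(τ : ℂ) • ((V y - V₀ y) + (V₀ y - V₀ (zj j)))‖ ≤
          τ * (b₀ / 2 + L₀ * ‖y - zj j‖) := by
        rw [norm_smul, Complex.norm_real, Real.norm_of_nonneg hτ0.le]
        gcongr
        exact (norm_add_le _ _).trans (add_le_add h5 h3)
      have h7 : min (b₀ / 2) b₁ * τ ≤ b₀ / 2 * τ := by gcongr; exact min_le_left _ _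
      linarith

end Stretch

/-- Near a regular point of `θ`, every holomorphic function is approximately a polynomial in `θ`. -/
theorem exists_polynomial_comp_approx {θ κ : ℂ → ℂ} (hθ : Differentiable ℂ θ)
    (hκ : Differentiable ℂ κ) (h0 : θ 0 = 0) (hd : deriv θ 0 ≠ 0) :
    ∃ r > 0, ∀ η > 0, ∃ p : Polynomial ℂ, ∀ s : ℂ, ‖s‖ ≤ r → ‖p.eval (θ s) - κ s‖ ≤ η := by
  have h1 : ContDiffAt ℂ 1 θ 0 := hθ.contDiff.contDiffAt
  have h2 : HasFDerivAt θ ((ContinuousLinearEquiv.unitsEquivAut ℂ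
    (Units.mk0 _ hd) : ℂ ≃L[ℂ] ℂ) : ℂ →L[ℂ] ℂ) 0 :=
    ((h1.hasStrictDerivAt one_ne_zero).hasStrictFDerivAt_equiv hd).hasFDerivAt
  set ψ := h1.localInverse h2 one_ne_zero with hψ
  have h3 : ContDiffAt ℂ 1 ψ 0 := by
    have := h1.to_localInverse h2 one_ne_zero
    rwa [h0] at this
  have h4 : ∀ᶠ s in nhds (0 : ℂ), ψ (θ s) = s :=
    (h1.hasStrictFDerivAt' h2 one_ne_zero).eventually_left_inverse
  obtain ⟨ρ, hρ, h5⟩ := Metric.eventually_nhds_iff_ball.1 (h3.eventually (by simp))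
  have h6 : ∀ᶠ s in nhds (0 : ℂ), θ s ∈ ball (0 : ℂ) (ρ / 2) := by
    refine hθ.continuous.continuousAt.eventually_mem ?_
    rw [h0]
    exact ball_mem_nhds _ (by positivity)
  obtain ⟨r, hr, h7⟩ := Metric.eventually_nhds_iff_ball.1 (h4.and h6)
  refine ⟨r / 2, by positivity, fun η hη => ?_⟩
  obtain ⟨p, hp⟩ := runge_convex (isCompact_closedBall (0 : ℂ) (ρ / 2)) (convex_closedBall _ _)
    isOpen_ball (closedBall_subset_ball (by linarith : ρ / 2 < ρ)) (f := fun t => κ (ψ t))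
    (fun t ht => ((hκ _).comp t ((h5 t ht).differentiableAt one_ne_zero)).differentiableWithinAt) hη
  refine ⟨p, fun s hs => ?_⟩
  have hs' := h7 s (by rw [mem_ball_zero_iff]; linarith)
  have := hp (θ s) (ball_subset_closedBall hs'.2)
  rw [norm_sub_rev]
  beta_reduce at this
  rwa [hs'.1] at this

section Tentacle

variable {E : Type*} [NormedAddCommGroup E] [NormedSpace ℂ E]

/-- An automorphism which almost fixes the part of the line `ℂ • e₀` lying to the left of `b`
and bends a short piece of the line next to `b` onto a short piece of a given curve `G`. -/
theorem exists_isHolAut_tentacle [FiniteDimensional ℂ E] {π₀ π₁ : E →L[ℂ] ℂ} {e₀ : E}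
    (h00 : π₀ e₀ = 1) (h10 : π₁ e₀ = 0) {G : ℂ → E} (hG : Differentiable ℂ G) {b : ℂ}
    (hG0 : G 0 = b • e₀) (hGd : deriv (fun s => π₁ (G s)) 0 ≠ 0) :
    ∃ r > 0, ∀ s₀ : ℝ, 0 < s₀ → s₀ ≤ r → ∀ δ > 0, ∀ ε > 0, ∃ δ' > 0, δ' ≤ δ ∧ ∃ T : E ≃ E,
      IsHolAut T ∧ (∀ ζ : ℂ, ζ.re ≤ b.re - δ' → ‖T (ζ • e₀) - ζ • e₀‖ ≤ ε) ∧
      (∀ v ∈ Icc (0 : ℝ) δ', ∃ σ ∈ Icc (0 : ℝ) s₀, ‖T ((b - v) • e₀) - G σ‖ ≤ ε) ∧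
      ‖T (b • e₀) - G s₀‖ ≤ ε := by
  set α : ℂ → ℂ := fun s => π₀ (G s) with hα
  set β : ℂ → E := fun s => G s - α s • e₀ with hβ
  have hαd : Differentiable ℂ α := by fun_prop
  have hβd : Differentiable ℂ β := by fun_prop
  have hβ0 : β 0 = 0 := by simp [hβ, hα, hG0, h00]
  have hα0 : α 0 = b := by simp [hα, hG0, h00]
  have hπβ : ∀ s, π₀ (β s) = 0 := fun s => by simp [hβ, hα, h00]
  have hπ1β : ∀ s, π₁ (β s) = π₁ (G s) := fun s => by simp [hβ, h10]
  have hθ0 : π₁ (G 0) = 0 := by simp [hG0, h10]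
  obtain ⟨r, hr, hp⟩ := exists_polynomial_comp_approx (θ := fun s => π₁ (G s))
    (κ := fun s => α s - b) (by fun_prop) (by fun_prop) hθ0 hGd
  refine ⟨r, hr, fun s₀ hs₀ hs₀r δ hδ ε hε => ?_⟩
  set M := ‖e₀‖ + 1 with hM
  have hM0 : 0 < M := by positivity
  obtain ⟨p, hp⟩ := hp (ε / 4 / M) (by positivity)
  set δ' := min δ (ε / 4 / M) with hδ'
  have hδ'0 : 0 < δ' := by positivity
  have hc : ContinuousAt (fun s => β s + p.eval (π₁ (G s)) • e₀) 0 := by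
    have : Continuous fun s => p.eval (π₁ (G s)) := p.continuous.comp
      (π₁.continuous.comp hG.continuous)
    exact (hβd.continuous.add (this.smul continuous_const)).continuousAt
  have hc0 : ‖β 0 + p.eval (π₁ (G 0)) • e₀‖ < ε := by
    rw [hβ0, zero_add, norm_smul]
    have h1 := hp 0 (by simpa using hr.le)
    rw [hα0, sub_self, sub_zero] at h1
    calc _ ≤ ε / 4 / M * M := mul_le_mul h1 (by linarith) (norm_nonneg _) (by positivity)
      _ = ε / 4 := by field_simp
      _ < ε := by linarith
  obtain ⟨ρ, hρ, hρε⟩ := Metric.eventually_nhds_iff_ball.1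
    (hc.norm.eventually_lt continuousAt_const hc0)
  obtain ⟨N, hN⟩ : ∃ N : ℕ, s₀ * Real.exp (-(N * δ')) < ρ := by
    have h1 : Filter.Tendsto (fun N : ℕ => s₀ * Real.exp (-(N * δ'))) Filter.atTop (nhds
      (s₀ * 0)) := by
      refine Filter.Tendsto.const_mul _ (Real.tendsto_exp_neg_atTop_nhds_zero.comp ?_)
      exact tendsto_natCast_atTop_atTop.atTop_mul_const hδ'0
    rw [mul_zero] at h1
    exact (h1.eventually (gt_mem_nhds hρ)).exists
  set T₁ := shear π₀ (fun ζ => β (s₀ * Complex.exp (N * (ζ - b)))) (fun _ => hπβ _) with hT₁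
  set T₂ := shear π₁ (fun t => p.eval t • e₀) (fun t => by rw [map_smul, h10, smul_zero]) with hT₂
  have hT : ∀ ζ : ℂ, (T₁.trans T₂) (ζ • e₀) = ζ • e₀ + (β (s₀ * Complex.exp (N * (ζ - b))) +
      p.eval (π₁ (G (s₀ * Complex.exp (N * (ζ - b))))) • e₀) := by
    intro ζ
    rw [Equiv.trans_apply, hT₁, hT₂, shear_apply, shear_apply, map_smul, h00, smul_eq_mul, mul_one,
      map_add, map_smul, h10, smul_zero, zero_add, hπ1β, add_assoc]
  have hnear : ∀ v : ℝ, 0 ≤ v → v ≤ δ' → ‖(T₁.trans T₂) ((b - v) • e₀) -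
      G ((s₀ * Real.exp (-(N * v)) : ℝ) : ℂ)‖ ≤ ε := by
    intro v hv hvδ
    have e1 : (s₀ : ℂ) * Complex.exp (N * (b - v - b)) = ((s₀ * Real.exp (-(N * v)) : ℝ) : ℂ) := by
      push_cast
      congr 2
      ring
    rw [hT, e1]
    set s : ℂ := ((s₀ * Real.exp (-(N * v)) : ℝ) : ℂ) with hs
    have hsn : ‖s‖ ≤ r := by
      rw [hs, Complex.norm_real, Real.norm_of_nonneg (by positivity)]
      refine le_trans ?_ hs₀r
      exact mul_le_of_le_one_right hs₀.le (Real.exp_le_one_iff.2 (by simp; positivity))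
    have e2 : (b - v) • e₀ + (β s + p.eval (π₁ (G s)) • e₀) - G s =
        (p.eval (π₁ (G s)) - (α s - b) - v) • e₀ := by
      simp only [hβ, sub_smul]; abel
    rw [e2, norm_smul]
    have h1 := norm_sub_le (p.eval (π₁ (G s)) - (α s - b)) v
    have h2 := hp s hsn
    rw [Complex.norm_real, Real.norm_of_nonneg hv] at h1
    have h3 : v ≤ ε / 4 / M := hvδ.trans (min_le_right _ _)
    calc _ ≤ (ε / 4 / M + ε / 4 / M) * M :=
          mul_le_mul (by linarith) (by linarith) (norm_nonneg _) (by positivity)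
      _ = ε / 2 := by field_simp; ring
      _ ≤ ε := by linarith
  refine ⟨δ', hδ'0, min_le_left _ _, T₁.trans T₂, ?_, fun ζ hζ => ?_, fun v hv => ?_, ?_⟩
  · refine (isHolAut_shear _ _ _ ?_).trans (isHolAut_shear _ _ _ ?_)
    · fun_prop
    · exact p.differentiable.smul_const _
  · rw [hT, add_sub_cancel_left]
    refine (hρε _ ?_).le
    rw [mem_ball_zero_iff, norm_mul, Complex.norm_real, Real.norm_of_nonneg hs₀.le,
      Complex.norm_exp]
    refine lt_of_le_of_lt ?_ hN
    gcongr
    have : ((N : ℂ) * (ζ - b)).re = N * (ζ.re - b.re) := by simp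
    rw [this]
    have : (N : ℝ) * (ζ.re - b.re) ≤ N * (-δ') := by gcongr; linarith
    linarith
  · refine ⟨_, ⟨by positivity, ?_⟩, hnear v hv.1 hv.2⟩
    have := hv.1
    exact mul_le_of_le_one_right hs₀.le (Real.exp_le_one_iff.2 (by simp; positivity))
  · simpa using hnear 0 le_rfl hδ'0.le

end Tentacle

theorem exists_ray_avoiding_zeros {θ : ℂ → ℂ} (hθ : Differentiable ℂ θ) (hd : deriv θ 0 ≠ 0) {δ : ℝ}
    (hδ : 0 < δ) : ∃ c : ℂ, c ≠ 0 ∧ ‖c - 1‖ ≤ δ ∧ ∀ s : ℝ, 0 < s → s ≤ 1 → θ (s * c) ≠ 0 := by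
  have hfin : {z ∈ closedBall (0 : ℂ) 2 | θ z = 0}.Finite := by
    by_contra hinf
    obtain ⟨x, hx, hacc⟩ := Set.Infinite.exists_accPt_of_subset_isCompact hinf
      (isCompact_closedBall (0 : ℂ) 2) (sep_subset _ _)
    have han : AnalyticOnNhd ℂ θ univ := fun z _ => hθ.analyticAt z
    have hfr : ∃ᶠ z in nhdsWithin x {x}ᶜ, θ z = 0 := by
      have := accPt_iff_frequently_nhdsNE.1 hacc
      exact this.mono fun z hz => hz.2
    have := han.eqOn_zero_of_preconnected_of_frequently_eq_zero isPreconnected_univ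
      (mem_univ x) hfr
    refine hd ?_
    have h0 : θ = fun _ => 0 := funext fun z => this (mem_univ z)
    rw [h0, deriv_const]
  obtain ⟨y, hy, hyb⟩ := (Ioo_infinite (lt_min hδ one_pos)).exists_notMem_finite
    (hfin.image fun z => z.im / z.re)
  have hy1 : y < 1 := hy.2.trans_le (min_le_right _ _)
  have hyδ : y < δ := hy.2.trans_le (min_le_left _ _)
  refine ⟨1 + y * Complex.I, fun h => ?_, ?_, fun s hs hs1 h => hyb ⟨_, ⟨?_, h⟩, ?_⟩⟩
  · have := congrArg Complex.re h
    simp at this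
  · simp [abs_of_pos hy.1, hyδ.le]
  · rw [mem_closedBall_zero_iff, norm_mul, Complex.norm_real, Real.norm_of_nonneg hs.le]
    have h1 := norm_add_le (1 : ℂ) (y * Complex.I)
    simp only [norm_one, norm_mul, Complex.norm_real, Complex.norm_I, mul_one,
      Real.norm_of_nonneg hy.1.le] at h1
    nlinarith [norm_nonneg (1 + y * Complex.I)]
  · simp [hs.ne']

theorem _root_.IsCompact.exists_dist_le_of_continuous {α β : Type*} [PseudoMetricSpace α]
    [PseudoMetricSpace β] {f : α → β} (hf : Continuous f) {K : Set α} (hK : IsCompact K) {ε : ℝ}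
    (hε : 0 < ε) : ∃ δ > 0, ∀ x ∈ K, ∀ y, dist y x ≤ δ → dist (f y) (f x) ≤ ε := by
  have h := hK.uniformContinuousAt_of_continuousAt f (fun a _ => hf.continuousAt)
    (dist_mem_uniformity hε)
  obtain ⟨δ, hδ, h⟩ := Metric.mem_uniformity_dist.1 h
  refine ⟨δ / 2, by positivity, fun x hx y hy => ?_⟩
  have : dist (f x) (f y) < ε := h (a := x) (b := y) (by rw [dist_comm]; linarith) hx
  rw [dist_comm]
  exact this.le

section Hitting

variable {E : Type*} [NormedAddCommGroup E] [NormedSpace ℂ E]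

theorem exists_isHolAut_hit [FiniteDimensional ℂ E] (hE : 2 ≤ Module.finrank ℂ E)
    {π₀ π₁ : E →L[ℂ] ℂ} {e₀ e₁ : E} (h00 : π₀ e₀ = 1) (h10 : π₁ e₀ = 0) (h11 : π₁ e₁ = 1)
    {F : E ≃ E} (hF : IsHolAut F) {K : Set ℂ} (hK : IsCompact K) (hKne : K.Nonempty) {m r : ℝ}
    (hmr : m < r) (hKm : ∀ ζ ∈ K, ‖F (ζ • e₀)‖ ≤ m) {p : E} (hp : ‖p‖ ≤ m) {S : Finset ℂ}
    (hS : ∀ ζ ∈ S, ζ ∈ K) {ε : ℝ} (hε : 0 < ε) :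
    ∃ F' : E ≃ E, IsHolAut F' ∧ (∀ ζ ∈ K, ‖F' (ζ • e₀) - F (ζ • e₀)‖ ≤ ε) ∧
      (∀ ζ ∈ S, F' (ζ • e₀) = F (ζ • e₀)) ∧
      ∃ b ∈ K, ∃ b', F' (b' • e₀) = p ∧ ∀ ζ ∈ segment ℝ b b', ‖F' (ζ • e₀)‖ < r := by
  classical
  by_cases hpS : ∃ s ∈ S, F (s • e₀) = p
  · obtain ⟨s, hs, rfl⟩ := hpS
    refine ⟨F, hF, by simpa using fun ζ _ => hε.le, fun _ _ => rfl, s, hS s hs, s, rfl, fun ζ hζ =>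
      ?_⟩
    rw [segment_same, mem_singleton_iff] at hζ
    exact hζ ▸ hp.trans_lt hmr
  push Not at hpS
  have hFc : Continuous F := hF.contDiff.continuous
  obtain ⟨W, hW⟩ : ∃ W : E → ℂ, W = fun z => π₁ (F.symm z) := ⟨_, rfl⟩
  have hWd : ContDiff ℂ 1 W := hW ▸ π₁.contDiff.comp hF.contDiff_symm
  have hWe : ExpApprox W := hW ▸ hF.expApprox_symm π₁
  have hW0 : ∀ ζ : ℂ, W (F (ζ • e₀)) = 0 := fun ζ => by simp [hW, h10]
  set μ := min (ε / 8) ((r - m) / 8) with hμ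
  have hμ0 : 0 < μ := lt_min (by positivity) (by linarith)
  have hμε : 8 * μ ≤ ε := by linarith [min_le_left (ε / 8) ((r - m) / 8)]
  have hμr : 8 * μ ≤ r - m := by linarith [min_le_right (ε / 8) ((r - m) / 8)]
  -- correction of the finitely many points
  obtain ⟨δc, hδc, hcorr⟩ := exists_correction hE (insert p (S.image fun s => F (s • e₀))) (r + 1)
    (ε := μ) hμ0
  set η := min 1 (min μ (δc / 8)) with hη
  have hη0 : 0 < η := by positivity
  have hη1 : η ≤ 1 := min_le_left _ _
  have hημ : η ≤ μ := (min_le_right _ _).trans (min_le_left _ _)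
  have hηc : 8 * η ≤ δc := by
    linarith [(min_le_right 1 (min μ (δc / 8))).trans (min_le_right _ _)]
  -- the tip
  obtain ⟨b, hb, hbmax⟩ := hK.exists_isMaxOn hKne Complex.continuous_re.continuousOn
  obtain ⟨δ₀, hδ₀, hδ₀m⟩ : ∃ δ > 0, ∀ t : ℂ, ‖t‖ ≤ δ → ‖F ((b + t) • e₀)‖ ≤ m + μ := by
    have hc : Continuous fun t : ℂ => ‖F ((b + t) • e₀)‖ := by fun_prop
    obtain ⟨δ, hδ, h⟩ := (isCompact_singleton (x := (0 : ℂ))).exists_dist_le_of_continuous hc hμ0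
    refine ⟨δ, hδ, fun t ht => ?_⟩
    have h1 := h 0 rfl t (by simpa using ht)
    rw [Real.dist_eq, add_zero] at h1
    linarith [le_abs_self (‖F ((b + t) • e₀)‖ - ‖F (b • e₀)‖), hKm b hb]
  set b' : ℂ := b + δ₀ with hb'
  set q := F (b' • e₀) with hq
  have hqm : ‖q‖ ≤ m + μ := hδ₀m δ₀ (by simp [abs_of_pos hδ₀])
  have hWq : W q = 0 := hW0 b'
  have hWq' : HasFDerivAt W (fderiv ℂ W q) q := (hWd.differentiable one_ne_zero q).hasFDerivAt
  obtain ⟨w, hw⟩ : ∃ w, fderiv ℂ W q w ≠ 0 := by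
    by_contra! h
    have h0 : fderiv ℂ W q = 0 := by ext w; simp [h w]
    rw [h0] at hWq'
    have h1 : HasFDerivAt F (fderiv ℂ F (b' • e₀)) (b' • e₀) :=
      (hF.contDiff.differentiable one_ne_zero _).hasFDerivAt
    have h2 : HasFDerivAt (W ∘ F) _ (b' • e₀) := hWq'.comp (b' • e₀) h1
    have h3 : W ∘ F = π₁ := funext fun z => by simp [hW]
    rw [h3, ContinuousLinearMap.zero_comp] at h2
    have h4 := π₁.hasFDerivAt.unique h2
    rw [h4] at h11
    simp at h11
  obtain ⟨e₂, he₂, he₂p⟩ : ∃ e, fderiv ℂ W q e ≠ 0 ∧ ‖q + e - p‖ ≤ η := by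
    by_cases h : fderiv ℂ W q (p - q) = 0
    · have hw0 : w ≠ 0 := by rintro rfl; simp at hw
      have hwn : 0 < ‖w‖ := norm_pos_iff.2 hw0
      refine ⟨p - q + ((η / ‖w‖ : ℝ) : ℂ) • w, ?_, ?_⟩
      · rw [map_add, h, zero_add, map_smul]
        exact smul_ne_zero (by exact_mod_cast (by positivity : η / ‖w‖ ≠ 0)) hw
      · rw [← add_assoc, add_sub_cancel, add_sub_cancel_left, norm_smul, Complex.norm_real,
          Real.norm_of_nonneg (by positivity), div_mul_cancel₀ _ hwn.ne']
    · exact ⟨p - q, h, by simpa using hη0.le⟩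
  have hlin : ∀ e : E, HasDerivAt (fun t : ℂ => W (q + t • e)) (fderiv ℂ W q e) 0 := by
    intro e
    have h1 : HasDerivAt (fun t : ℂ => q + t • e) e 0 := by
      simpa using ((hasDerivAt_id (0 : ℂ)).smul_const e).const_add q
    have h2 : HasFDerivAt W (fderiv ℂ W q) (q + (0 : ℂ) • e) := by simpa using hWq'
    exact h2.comp_hasDerivAt 0 h1
  obtain ⟨c, hc0, hc1, hcθ⟩ := exists_ray_avoiding_zeros (θ := fun t => W (q + t • e₂))
    ((hWd.comp (by fun_prop : ContDiff ℂ 1 fun t : ℂ => q + t • e₂)).differentiable one_ne_zero)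
    (by rw [(hlin e₂).deriv]; exact he₂) (δ := η / (‖e₂‖ + 1)) (by positivity)
  set e := c • e₂ with he
  have hqe : ‖q + e - p‖ ≤ 2 * η := by
    have h1 : q + e - p = (q + e₂ - p) + (c - 1) • e₂ := by rw [he, sub_smul, one_smul]; abel
    rw [h1]
    refine (norm_add_le _ _).trans ?_
    rw [norm_smul]
    have : ‖c - 1‖ * ‖e₂‖ ≤ η / (‖e₂‖ + 1) * (‖e₂‖ + 1) :=
      mul_le_mul hc1 (by linarith) (norm_nonneg _) (by positivity)
    rw [div_mul_cancel₀ _ (by positivity)] at this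
    linarith
  have hne : ∀ s : ℝ, 0 < s → s ≤ 1 → W (q + (s : ℂ) • e) ≠ 0 := fun s hs hs1 => by
    rw [he, smul_smul]; exact hcθ s hs hs1
  have hWe0 : deriv (fun t : ℂ => W (q + t • e)) 0 ≠ 0 := by
    rw [(hlin e).deriv, he, map_smul]
    exact smul_ne_zero hc0 he₂
  -- the automorphisms
  set G : ℂ → E := fun s => F.symm (q + s • e) with hG
  have hGd : Differentiable ℂ G :=
    (hF.contDiff_symm.comp (by fun_prop : ContDiff ℂ 1 fun s : ℂ => q + s • e)).differentiable
      one_ne_zero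
  have hFG : ∀ s, F (G s) = q + s • e := fun s => by simp [hG]
  obtain ⟨r₁, hr₁, htent⟩ := exists_isHolAut_tentacle h00 h10 hGd (b := b')
    (by simp [hG, hq]) (by rw [hW] at hWe0; exact hWe0)
  set s₀ := min r₁ (1 / 2) with hs₀
  have hs₀0 : 0 < s₀ := by positivity
  obtain ⟨Φ, hΦ, hΦW, hΦs⟩ := exists_isHolAut_stretch hE hWe hWd hWq hne hWe0 hs₀0
    ((min_le_right _ _).trans_lt (by norm_num)) r hη0
  have hΨc : Continuous fun z => Φ (F z) := hΦ.contDiff.continuous.comp hFc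
  have hK₀ : IsCompact ((fun ζ : ℂ => ζ • e₀) '' (K ∪ segment ℝ b b') ∪
      (fun s : ℝ => G s) '' Icc 0 s₀) := by
    refine ((hK.union ?_).image (by fun_prop)).union (isCompact_Icc.image ?_)
    · rw [segment_eq_image_lineMap]
      exact isCompact_Icc.image (by fun_prop)
    · exact hGd.continuous.comp Complex.continuous_ofReal
  obtain ⟨εT, hεT, hΨ⟩ := hK₀.exists_dist_le_of_continuous hΨc hη0
  obtain ⟨δ', hδ'0, hδ', T, hT, hTK, hTG, hTb⟩ := htent s₀ hs₀0 (min_le_left _ _) δ₀ hδ₀ εT hεT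
  have hseg : ∀ ζ ∈ segment ℝ b b', ∃ v : ℝ, 0 ≤ v ∧ v ≤ δ₀ ∧ ζ = b' - v := by
    intro ζ hζ
    rw [segment_eq_image_lineMap] at hζ
    obtain ⟨t, ht, rfl⟩ := hζ
    refine ⟨(1 - t) * δ₀, mul_nonneg (by linarith [ht.2]) hδ₀.le,
      mul_le_of_le_one_left hδ₀.le (by linarith [ht.1]), ?_⟩
    simp only [AffineMap.lineMap_apply, vsub_eq_sub, vadd_eq_add, hb', Complex.real_smul]
    push_cast; ring
  have hsegm : ∀ v : ℝ, 0 ≤ v → v ≤ δ₀ → ‖F ((b' - v) • e₀)‖ ≤ m + μ := by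
    intro v hv hv0
    have h1 : b' - v = b + ((δ₀ - v : ℝ) : ℂ) := by rw [hb']; push_cast; ring
    rw [h1]
    refine hδ₀m _ ?_
    rw [Complex.norm_real, Real.norm_of_nonneg (by linarith)]
    linarith
  have hA : ∀ ζ ∈ K ∪ segment ℝ b b', ζ.re ≤ b'.re - δ' → ‖F (ζ • e₀)‖ ≤ m + μ →
      ‖Φ (F (T (ζ • e₀))) - F (ζ • e₀)‖ ≤ 2 * η := by
    intro ζ hζ hre hn
    have h1 := hΨ (ζ • e₀) (Or.inl ⟨ζ, hζ, rfl⟩) (T (ζ • e₀))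
      (by rw [dist_eq_norm]; exact hTK ζ hre)
    rw [dist_eq_norm] at h1
    have h2 := hΦW _ (hW0 ζ) (by linarith)
    have := norm_sub_le_norm_sub_add_norm_sub (Φ (F (T (ζ • e₀)))) (Φ (F (ζ • e₀))) (F (ζ • e₀))
    linarith
  have hK1 : ∀ ζ ∈ K, ‖Φ (F (T (ζ • e₀))) - F (ζ • e₀)‖ ≤ 2 * η := by
    intro ζ hζ
    refine hA ζ (Or.inl hζ) ?_ (by linarith [hKm ζ hζ])
    have h1 : ζ.re ≤ b.re := hbmax hζ
    have h2 : b'.re = b.re + δ₀ := by simp [hb']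
    linarith
  have hB : ∀ σ ∈ Icc (0 : ℝ) s₀, ∀ z, ‖z - G σ‖ ≤ εT →
      ‖Φ (F z) - (q + ((σ / s₀ : ℝ) : ℂ) • e)‖ ≤ 2 * η := by
    intro σ hσ z hz
    have h1 := hΨ (G σ) (Or.inr ⟨σ, hσ, rfl⟩) z (by rwa [dist_eq_norm])
    rw [dist_eq_norm, hFG] at h1
    have h2 := hΦs (σ / s₀) ⟨div_nonneg hσ.1 hs₀0.le, (div_le_one hs₀0).2 hσ.2⟩
    rw [mul_div_cancel₀ _ hs₀0.ne'] at h2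
    have := norm_sub_le_norm_sub_add_norm_sub (Φ (F z)) (Φ (q + (σ : ℂ) • e))
      (q + ((σ / s₀ : ℝ) : ℂ) • e)
    linarith
  have hqe' : ∀ u : ℝ, 0 ≤ u → u ≤ 1 → ‖q + (u : ℂ) • e‖ ≤ m + 2 * μ := by
    intro u hu hu1
    have h1 : q + (u : ℂ) • e = ((1 - u : ℝ) : ℂ) • q + (u : ℂ) • (q + e) := by
      push_cast; rw [sub_smul, one_smul, smul_add]; abel
    rw [h1]
    refine (norm_add_le _ _).trans ?_
    rw [norm_smul, norm_smul, Complex.norm_real, Complex.norm_real, Real.norm_of_nonneg hu,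
      Real.norm_of_nonneg (by linarith)]
    have h2 : ‖q + e‖ ≤ m + 2 * μ := by
      have := norm_add_le (q + e - p) p
      rw [sub_add_cancel] at this
      linarith
    nlinarith
  have hsegn : ∀ ζ ∈ segment ℝ b b', ‖Φ (F (T (ζ • e₀)))‖ ≤ m + 4 * μ := by
    intro ζ hζ
    obtain ⟨v, hv, hv0, rfl⟩ := hseg ζ hζ
    rcases le_total δ' v with hvδ | hvδ
    · have h1 := hA _ (Or.inr hζ) (by simp; linarith) (hsegm v hv hv0)
      have := norm_add_le (Φ (F (T ((b' - v) • e₀))) - F ((b' - v) • e₀)) (F ((b' - v) • e₀))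
      rw [sub_add_cancel] at this
      linarith [hsegm v hv hv0]
    · obtain ⟨σ, hσ, hσT⟩ := hTG v ⟨hv, hvδ⟩
      have h1 := hB σ hσ _ hσT
      have h2 := hqe' (σ / s₀) (div_nonneg hσ.1 hs₀0.le) ((div_le_one hs₀0).2 hσ.2)
      have := norm_add_le (Φ (F (T ((b' - v) • e₀))) - (q + ((σ / s₀ : ℝ) : ℂ) • e))
        (q + ((σ / s₀ : ℝ) : ℂ) • e)
      rw [sub_add_cancel] at this
      linarith
  have htip : ‖Φ (F (T (b' • e₀))) - p‖ ≤ 4 * η := by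
    have h1 := hB s₀ ⟨hs₀0.le, le_rfl⟩ _ hTb
    rw [div_self hs₀0.ne', Complex.ofReal_one, one_smul] at h1
    have := norm_sub_le_norm_sub_add_norm_sub (Φ (F (T (b' • e₀)))) (q + e) p
    linarith
  obtain ⟨C, hC, hCt, hCr⟩ := hcorr (fun x => if x = p then Φ (F (T (b' • e₀))) else
    Φ (F (T (F.symm x)))) (fun x hx => by
      rw [Finset.mem_insert, Finset.mem_image] at hx
      rcases eq_or_ne x p with rfl | hxp
      · simp only [if_true]; linarith
      · obtain ⟨s, hs, rfl⟩ := hx.resolve_left hxp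
        simp only [hxp, if_false, Equiv.symm_apply_apply]
        linarith [hK1 s (hS s hs)])
  refine ⟨T.trans (F.trans (Φ.trans C)), hT.trans (hF.trans (hΦ.trans hC)), fun ζ hζ => ?_,
    fun ζ hζ => ?_, b, hb, b', ?_, fun ζ hζ => ?_⟩
  · have h1 := hK1 ζ hζ
    have h2 : ‖Φ (F (T (ζ • e₀)))‖ ≤ r + 1 := by
      have := norm_add_le (Φ (F (T (ζ • e₀))) - F (ζ • e₀)) (F (ζ • e₀))
      rw [sub_add_cancel] at this
      linarith [hKm ζ hζ]
    have h3 := (hCr _ h2).1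
    have := norm_sub_le_norm_sub_add_norm_sub (C (Φ (F (T (ζ • e₀))))) (Φ (F (T (ζ • e₀))))
      (F (ζ • e₀))
    simp only [Equiv.trans_apply]
    linarith
  · have h1 := hCt (F (ζ • e₀)) (Finset.mem_insert_of_mem (Finset.mem_image_of_mem _ hζ))
    simp only [hpS ζ hζ, if_false, Equiv.symm_apply_apply] at h1
    exact h1
  · have h1 := hCt p (Finset.mem_insert_self _ _)
    simp only [if_true] at h1
    exact h1
  · have h1 := hsegn ζ hζ
    have h3 := (hCr _ (by linarith)).1
    have := norm_add_le (C (Φ (F (T (ζ • e₀)))) - Φ (F (T (ζ • e₀)))) (Φ (F (T (ζ • e₀))))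
    rw [sub_add_cancel] at this
    simp only [Equiv.trans_apply]
    linarith

end Hitting

section Core

variable {E : Type*} [NormedAddCommGroup E]

/-- The component containing the origin of the sublevel set of `‖φ‖` of height `r`. -/
def core (φ : ℂ → E) (r : ℝ) : Set ℂ := connectedComponentIn {ζ | ‖φ ζ‖ < r} 0

variable {φ : ℂ → E} {r : ℝ}

theorem isOpen_core (hφ : Continuous φ) : IsOpen (core φ r) :=
  (isOpen_lt hφ.norm continuous_const).connectedComponentIn

theorem zero_mem_core (h0 : ‖φ 0‖ < r) : (0 : ℂ) ∈ core φ r := mem_connectedComponentIn h0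

theorem norm_lt_of_mem_core {ζ : ℂ} (hζ : ζ ∈ core φ r) : ‖φ ζ‖ < r := by
  have h : ζ ∈ {ζ | ‖φ ζ‖ < r} := connectedComponentIn_subset _ _ hζ
  exact h

theorem isPreconnected_core : IsPreconnected (core φ r) := isPreconnected_connectedComponentIn

theorem subset_core {C : Set ℂ} (hC : IsPreconnected C) (hC0 : (0 : ℂ) ∈ C)
    (h : ∀ ζ ∈ C, ‖φ ζ‖ < r) : C ⊆ core φ r :=
  hC.subset_connectedComponentIn hC0 h

theorem norm_le_of_mem_closure_core (hφ : Continuous φ) {ζ : ℂ} (hζ : ζ ∈ closure (core φ r)) :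
    ‖φ ζ‖ ≤ r :=
  closure_minimal (fun _ h => (norm_lt_of_mem_core h).le) (isClosed_le hφ.norm continuous_const) hζ

theorem closure_core_subset_core (hφ : Continuous φ) (h0 : ‖φ 0‖ < r) {ρ : ℝ} (hr : r < ρ) :
    closure (core φ r) ⊆ core φ ρ :=
  subset_core isPreconnected_core.closure (subset_closure (zero_mem_core h0))
    fun _ h => (norm_le_of_mem_closure_core hφ h).trans_lt hr

theorem isCompact_closure_core (hφ : Continuous φ) (hb : Bornology.IsBounded {ζ | ‖φ ζ‖ ≤ r}) :
    IsCompact (closure (core φ r)) :=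
  isCompact_of_isClosed_isBounded isClosed_closure
    (hb.subset fun _ h => norm_le_of_mem_closure_core hφ h)

/-- A compact set whose frontier lies in the closure of `core φ r` stays in any larger core. -/
theorem subset_core_of_frontier_subset [NormedSpace ℂ E] (hφ : Differentiable ℂ φ)
    (h0 : ‖φ 0‖ < r) {ρ : ℝ}
    (hr : r < ρ) {S : Set ℂ} (hS : IsCompact S) (hfr : frontier S ⊆ closure (core φ r)) :
    S ⊆ core φ ρ := by
  have hSr : ∀ z ∈ S, ‖φ z‖ ≤ r := by
    intro z hz
    by_cases hzi : z ∈ interior S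
    · refine Complex.norm_le_of_forall_mem_frontier_norm_le
        (hS.isBounded.subset interior_subset) hφ.diffContOnCl (fun w hw => ?_)
        (subset_closure hzi)
      exact norm_le_of_mem_closure_core hφ.continuous (hfr (frontier_interior_subset hw))
    · exact norm_le_of_mem_closure_core hφ.continuous (hfr ⟨subset_closure hz, hzi⟩)
  intro z hz
  by_contra hzc
  set A := {ζ | ‖φ ζ‖ < ρ} with hA
  have hAo : IsOpen A := isOpen_lt hφ.continuous.norm continuous_const
  set C := connectedComponentIn A z with hC
  have hzA : z ∈ A := (hSr z hz).trans_lt hr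
  have hzC : z ∈ C := mem_connectedComponentIn hzA
  have hdisj : ∀ w ∈ C, w ∉ core φ ρ := by
    intro w hw hw'
    have h1 : connectedComponentIn A z = connectedComponentIn A w := connectedComponentIn_eq hw
    have h2 : connectedComponentIn A 0 = connectedComponentIn A w := connectedComponentIn_eq hw'
    exact hzc (by rw [core, h2, ← h1]; exact hzC)
  have hCS : C ⊆ S := by
    by_contra hCS
    obtain ⟨w, hw, hwS⟩ := not_subset.1 hCS
    obtain ⟨v, hv, hvS⟩ := inter_frontier_nonempty_of_isPreconnected
      (isPreconnected_connectedComponentIn (F := A) (x := z)) ⟨z, hzC, hz⟩ ⟨w, hw, hwS⟩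
    exact hdisj v hv (closure_core_subset_core hφ.continuous h0 hr (hfr hvS))
  have hcl : closure C ⊆ C := by
    refine isPreconnected_connectedComponentIn.closure.subset_connectedComponentIn
      (subset_closure hzC) fun w hw => ?_
    exact (hSr w (closure_minimal hCS hS.isClosed hw)).trans_lt hr
  have huniv : C = univ := IsClopen.eq_univ
    ⟨closure_subset_iff_isClosed.1 hcl, hAo.connectedComponentIn⟩ ⟨z, hzC⟩
  have : IsCompact (univ : Set ℂ) := by
    rw [← huniv]
    exact hS.of_isClosed_subset (closure_subset_iff_isClosed.1 hcl) hCS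
  exact noncompact_univ ℂ this

end Core

section Step

variable {E : Type*} [NormedAddCommGroup E]

section Normed

variable [NormedSpace ℂ E] {F : E ≃ E} {e₀ : E} {π₀ : E →L[ℂ] ℂ}

theorem IsHolAut.differentiable_line (hF : IsHolAut F) : Differentiable ℂ fun ζ : ℂ => F (ζ • e₀) :=
  (hF.contDiff.comp (by fun_prop : ContDiff ℂ 1 fun ζ : ℂ => ζ • e₀)).differentiable one_ne_zero

theorem IsHolAut.exists_le_norm_sub [FiniteDimensional ℂ E] (hF : IsHolAut F) (h00 : π₀ e₀ = 1) :
    ∃ c > 0, ∀ x y : ℂ, ‖F (x • e₀)‖ ≤ 1 → ‖F (y • e₀)‖ ≤ 1 →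
      c * ‖x - y‖ ≤ ‖F (x • e₀) - F (y • e₀)‖ := by
  have : ProperSpace E := FiniteDimensional.proper ℂ E
  obtain ⟨L, hL⟩ : ∃ L, LipschitzOnWith L F.symm (closedBall 0 1) :=
    ContDiffOn.exists_lipschitzOnWith (n := 1) (hF.contDiff_symm.restrict_scalars ℝ).contDiffOn
      one_ne_zero (convex_closedBall _ _) (isCompact_closedBall _ _)
  refine ⟨1 / (‖π₀‖ * L + 1), by positivity, fun x y hx hy => ?_⟩
  have h1 := hL.norm_sub_le (x := F (x • e₀)) (y := F (y • e₀)) (by simpa using hx)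
    (by simpa using hy)
  rw [Equiv.symm_apply_apply, Equiv.symm_apply_apply] at h1
  have h2 : x - y = π₀ (x • e₀ - y • e₀) := by simp [h00]
  have h3 : ‖x - y‖ ≤ ‖π₀‖ * (L * ‖F (x • e₀) - F (y • e₀)‖) := by
    rw [h2]
    exact (π₀.le_opNorm _).trans (by gcongr)
  rw [one_div, inv_mul_le_iff₀ (by positivity)]
  linarith [norm_nonneg (F (x • e₀) - F (y • e₀))]

theorem IsHolAut.isBounded_line [FiniteDimensional ℂ E] (hF : IsHolAut F) (h00 : π₀ e₀ = 1)
    (r : ℝ) :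
    Bornology.IsBounded {ζ : ℂ | ‖F (ζ • e₀)‖ ≤ r} := by
  have : ProperSpace E := FiniteDimensional.proper ℂ E
  refine (((isCompact_closedBall (0 : E) r).image hF.contDiff_symm.continuous).image
    π₀.continuous).isBounded.subset fun ζ hζ => ?_
  have hζ' : ‖F (ζ • e₀)‖ ≤ r := hζ
  exact ⟨_, ⟨F (ζ • e₀), by simpa using hζ', rfl⟩, by simp [h00]⟩

/-- An entire curve which is uniformly small on a core has increments on a smaller core which are
small compared to those of the line. -/
theorem IsHolAut.exists_norm_sub_le [FiniteDimensional ℂ E] (hF : IsHolAut F) (h00 : π₀ e₀ =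
    1) {r ρ : ℝ}
    (h0 : ‖F ((0 : ℂ) • e₀)‖ < r) (hr : r < ρ) (hr1 : r ≤ 1) {κ : ℝ} (hκ : 0 < κ) :
    ∃ ε > 0, ∀ ψ : ℂ → E, Differentiable ℂ ψ →
      (∀ ζ ∈ closure (core (fun ζ : ℂ => F (ζ • e₀)) ρ), ‖ψ ζ‖ ≤ ε) →
      ∀ x ∈ closure (core (fun ζ : ℂ => F (ζ • e₀)) r),
        ∀ y ∈ closure (core (fun ζ : ℂ => F (ζ • e₀)) r),
          ‖ψ x - ψ y‖ ≤ κ * ‖F (x • e₀) - F (y • e₀)‖ := by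
  set φ := fun ζ : ℂ => F (ζ • e₀) with hφ
  have hφc : Continuous φ := hF.differentiable_line.continuous
  obtain ⟨c, hc, hcF⟩ := hF.exists_le_norm_sub h00
  obtain ⟨d, hd, hdρ⟩ := (isCompact_closure_core hφc
    (hF.isBounded_line h00 r)).exists_cthickening_subset_open
    (isOpen_core hφc) (closure_core_subset_core hφc h0 hr)
  refine ⟨κ * c * d / 4, by positivity, fun ψ hψ hψε x hx y hy => ?_⟩
  have hxy := hcF x y ((norm_le_of_mem_closure_core hφc hx).trans hr1)
    ((norm_le_of_mem_closure_core hφc hy).trans hr1)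
  suffices h : ‖ψ x - ψ y‖ ≤ κ * c * ‖x - y‖ by
    refine h.trans ?_
    rw [mul_assoc]
    gcongr
  have hball : ∀ z, ‖z - x‖ ≤ d → ‖ψ z‖ ≤ κ * c * d / 4 := fun z hz =>
    hψε z (subset_closure (hdρ (mem_cthickening_of_dist_le z x d _ hx (by rwa [dist_eq_norm]))))
  rcases le_total ‖x - y‖ (d / 2) with h | h
  · have hder : ∀ z ∈ closedBall x (d / 2), ‖deriv ψ z‖ ≤ κ * c / 2 := by
      intro z hz
      rw [mem_closedBall, dist_eq_norm] at hz
      have := Complex.norm_deriv_le_of_forall_mem_sphere_norm_le (c := z) (R := d / 2) (f := ψ)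
        (C := κ * c * d / 4) (by positivity) hψ.diffContOnCl (fun w hw => hball w ?_)
      · refine this.trans (le_of_eq ?_)
        field_simp
        ring
      · rw [mem_sphere, dist_eq_norm] at hw
        have := norm_sub_le_norm_sub_add_norm_sub w z x
        linarith
    have := (convex_closedBall x (d / 2)).norm_image_sub_le_of_norm_deriv_le
      (fun z _ => hψ z) hder (x := y) (y := x)
      (by rw [mem_closedBall, dist_eq_norm, norm_sub_rev]; exact h)
      (mem_closedBall_self (by positivity))
    refine this.trans ?_
    gcongr
    linarith [mul_pos hκ hc]
  · have h1 := hball x (by simp [hd.le])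
    have h2 := hψε y (subset_closure (closure_core_subset_core hφc h0 hr hy))
    refine (norm_sub_le _ _).trans ?_
    have : κ * c * (d / 2) ≤ κ * c * ‖x - y‖ := by gcongr
    linarith

end Normed

end Step

section PathLength

variable {E : Type*} [NormedAddCommGroup E] [NormedSpace ℂ E]

/-- A holomorphic map which is `1`-close to the identity on a ball of radius two is `2`-Lipschitz
on the concentric ball of radius one. -/
theorem lipschitzOnWith_two_of_norm_sub_le {g : E → E} (hg : Differentiable ℂ g)
    (h : ∀ z, ‖z‖ ≤ 2 → ‖g z - z‖ ≤ 1) : LipschitzOnWith 2 g (closedBall 0 1) := by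
  have hd : Differentiable ℂ fun z => g z - z := hg.sub differentiable_id
  have hder : ∀ z ∈ closedBall (0 : E) 1, ‖fderiv ℂ (fun z => g z - z) z‖ ≤ 1 := by
    intro z hz
    rw [mem_closedBall_zero_iff] at hz
    refine ContinuousLinearMap.opNorm_le_of_unit_norm (𝕜 := ℂ) zero_le_one fun v hv => ?_
    have hl : HasDerivAt (fun s : ℂ => z + s • v) v 0 := by
      simpa using ((hasDerivAt_id (0 : ℂ)).smul_const v).const_add z
    have h1 : HasDerivAt (fun s : ℂ => g (z + s • v) - (z + s • v))
        (fderiv ℂ (fun z => g z - z) z v) 0 := by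
      have h2 : HasFDerivAt (fun z => g z - z) (fderiv ℂ (fun z => g z - z) z)
          (z + (0 : ℂ) • v) := by
        simpa using (hd z).hasFDerivAt
      exact h2.comp_hasDerivAt (0 : ℂ) hl
    have h3 : Differentiable ℂ fun s : ℂ => g (z + s • v) - (z + s • v) :=
      hd.comp (by fun_prop : Differentiable ℂ fun s : ℂ => z + s • v)
    rw [← h1.deriv]
    have := Complex.norm_deriv_le_of_forall_mem_sphere_norm_le (c := 0) (R := 1) (C := 1)
      one_pos h3.diffContOnCl (fun w hw => h _ ?_)
    · simpa using this
    · rw [mem_sphere_zero_iff_norm] at hw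
      refine (norm_add_le _ _).trans ?_
      rw [norm_smul, hw, hv]
      linarith
  refine LipschitzOnWith.of_dist_le_mul fun x hx y hy => ?_
  have := (convex_closedBall (0 : E) 1).norm_image_sub_le_of_norm_fderiv_le
    (fun z _ => hd z) hder hy hx
  have h4 : g x - g y = ((g x - x) - (g y - y)) + (x - y) := by abel
  rw [dist_eq_norm, dist_eq_norm, h4]
  refine (norm_add_le _ _).trans ?_
  push_cast
  linarith

end PathLength

section LabyrinthPathLength

variable {E : Type*} [NormedAddCommGroup E] [InnerProductSpace ℂ E]

/-- A path starting deep inside a labyrinth and leaving a core is long. -/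
theorem Labyrinth.one_le_two_mul_eVariationOn {ρ r r' d : ℝ} {L : List (Wall E)}
    (hL : Labyrinth ρ r 1 L) {G : ℂ → E} (hG : Continuous G) (hGL : ∀ w ∈ L, ∀ ζ, G ζ ∉ w.carrier)
    {C : E ≃ E} (hC : IsHolAut C) (hd : d ≤ 1) (hCd : ∀ z, ‖z‖ ≤ 2 → ‖C.symm z - z‖ ≤ d)
    (hr' : r' ≤ 1) (hrr' : r + d ≤ r') {γ : ℝ → ℂ} {a b : ℝ} (hab : a ≤ b)
    (hγ : ContinuousOn γ (Icc a b)) (ha : ‖G (γ a)‖ ≤ ρ) (ha' : γ a ∈ core (fun ζ => C (G ζ)) r')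
    (hb : γ b ∉ core (fun ζ => C (G ζ)) r') :
    1 ≤ 2 * eVariationOn (fun t => C (G (γ t))) (Icc a b) := by
  set ψ := fun ζ => C (G ζ) with hψ
  have hψc : Continuous ψ := hC.contDiff.continuous.comp hG
  have hψγ : ContinuousOn (fun t => ‖ψ (γ t)‖) (Icc a b) := (hψc.comp_continuousOn hγ).norm
  obtain ⟨t₀, ht₀, ht₀r⟩ : ∃ t ∈ Icc a b, r' ≤ ‖ψ (γ t)‖ := by
    by_contra! hcon
    have h1 : γ '' Icc a b ⊆ connectedComponentIn {ζ | ‖ψ ζ‖ < r'} (γ a) := by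
      refine (isPreconnected_Icc.image γ hγ).subset_connectedComponentIn
        ⟨a, left_mem_Icc.2 hab, rfl⟩ ?_
      rintro _ ⟨t, ht, rfl⟩
      exact hcon t ht
    have h2 : connectedComponentIn {ζ | ‖ψ ζ‖ < r'} 0 =
      connectedComponentIn {ζ | ‖ψ ζ‖ < r'} (γ a) := connectedComponentIn_eq ha'
    exact hb (by rw [core, h2]; exact h1 ⟨b, right_mem_Icc.2 hab, rfl⟩)
  have hclosed : IsClosed (Icc a b ∩ (fun t => ‖ψ (γ t)‖) ⁻¹' Ici r') :=
    hψγ.preimage_isClosed_of_isClosed isClosed_Icc isClosed_Ici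
  obtain ⟨c, ⟨hc, hcr⟩, hcmin⟩ :=
    (isCompact_Icc.of_isClosed_subset hclosed inter_subset_left).exists_isLeast
      ⟨t₀, ht₀, ht₀r⟩
  have hcr' : r' ≤ ‖ψ (γ c)‖ := hcr
  have hsub : Icc a c ⊆ Icc a b := Icc_subset_Icc_right hc.2
  have hle : ∀ t ∈ Icc a c, ‖ψ (γ t)‖ ≤ r' := by
    intro t ht
    by_contra! hlt
    have hlta := norm_lt_of_mem_core ha'
    obtain ⟨s, hs, hsr⟩ := intermediate_value_Icc ht.1 (hψγ.mono (Icc_subset_Icc_right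
      (ht.2.trans hc.2)))
      ⟨hlta.le, hlt.le⟩
    have hsr' : ‖ψ (γ s)‖ = r' := hsr
    have hcs := hcmin ⟨hsub ⟨hs.1, hs.2.trans ht.2⟩, hsr'.ge⟩
    have : s = t := le_antisymm hs.2 (ht.2.trans hcs)
    rw [this] at hsr'
    exact hlt.ne' hsr'
  have hGψ : ∀ t, C.symm (ψ (γ t)) = G (γ t) := fun t => by simp [hψ]
  have hGc : r ≤ ‖G (γ c)‖ := by
    have h1 := hCd (ψ (γ c)) ((hle c (right_mem_Icc.2 hc.1)).trans (by linarith))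
    rw [hGψ] at h1
    have := norm_sub_norm_le (ψ (γ c)) (G (γ c))
    rw [norm_sub_rev] at this
    linarith
  have h1 := hL.le_eVariationOn (fun t => G (γ t)) a c hc.1 (hG.comp_continuousOn (hγ.mono hsub))
    ha hGc fun t _ w hw => hGL w hw _
  have hlip := lipschitzOnWith_two_of_norm_sub_le (hC.contDiff_symm.differentiable one_ne_zero)
    fun z hz => (hCd z hz).trans hd
  have h2 := hlip.comp_eVariationOn_le (g := fun t => ψ (γ t)) (s := Icc a c)
    fun t ht => mem_closedBall_zero_iff.2 ((hle t ht).trans hr')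
  have h3 : C.symm ∘ (fun t => ψ (γ t)) = fun t => G (γ t) := funext hGψ
  rw [h3] at h2
  calc (1 : ℝ≥0∞) = ENNReal.ofReal 1 := by simp
    _ ≤ _ := h1
    _ ≤ _ := h2
    _ ≤ _ := by
      exact mul_le_mul_right (eVariationOn.mono _ hsub) _

end LabyrinthPathLength

section StepTheorem

variable {E : Type*} [NormedAddCommGroup E] [InnerProductSpace ℂ E] [FiniteDimensional ℂ E]

theorem IsHolAut.exists_step (hE : 2 ≤ Module.finrank ℂ E)
    {π₀ π₁ : E →L[ℂ] ℂ} {e₀ e₁ : E} (h00 : π₀ e₀ = 1) (h10 : π₁ e₀ = 0) (h11 : π₁ e₁ = 1)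
    {F : E ≃ E} (hF : IsHolAut F) {r : ℝ} (h0 : ‖F ((0 : ℂ) • e₀)‖ < r) (hr1 : r < 1)
    {S : Finset ℂ} (hS : ∀ ζ ∈ S, ζ ∈ core (fun ζ : ℂ => F (ζ • e₀)) r) {p : E} (hp : ‖p‖ < 1)
    {ε : ℝ} (hε : 0 < ε) :
    ∃ (F' : E ≃ E) (r' : ℝ) (S' : Finset ℂ), IsHolAut F' ∧ r < r' ∧ r' < 1 ∧ S ⊆ S' ∧
      (∀ ζ ∈ S', ζ ∈ core (fun ζ : ℂ => F' (ζ • e₀)) r') ∧ (∃ ζ ∈ S', F' (ζ • e₀) = p) ∧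
      (∀ ζ ∈ S, F' (ζ • e₀) = F (ζ • e₀)) ∧
      (∀ ζ ∈ closure (core (fun ζ : ℂ => F (ζ • e₀)) ((1 + r) / 2)),
        ‖F' (ζ • e₀) - F (ζ • e₀)‖ ≤ ε ∧ ζ ∈ core (fun ζ : ℂ => F' (ζ • e₀)) r') ∧
      ∀ (γ : ℝ → ℂ) (a b : ℝ), a ≤ b → ContinuousOn γ (Icc a b) →
        γ a ∈ closure (core (fun ζ : ℂ => F (ζ • e₀)) ((1 + r) / 2)) →
        γ b ∉ core (fun ζ : ℂ => F' (ζ • e₀)) r' →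
        1 ≤ 2 * eVariationOn (fun t => F' (γ t • e₀)) (Icc a b) := by
  classical
  have : ProperSpace E := FiniteDimensional.proper ℂ E
  set ρ := (1 + r) / 2 with hρ
  set φ := fun ζ : ℂ => F (ζ • e₀) with hφ
  have hφc : Continuous φ := hF.differentiable_line.continuous
  have hr0 : 0 < r := (norm_nonneg _).trans_lt h0
  have hrρ : r < ρ := by rw [hρ]; linarith
  have hρ1 : ρ < 1 := by rw [hρ]; linarith
  have h0ρ : ‖φ 0‖ < ρ := h0.trans hrρ
  set K := closure (core φ ρ) with hK
  have hKc : IsCompact K := isCompact_closure_core hφc (hF.isBounded_line h00 ρ)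
  have h0K : (0 : ℂ) ∈ K := subset_closure (zero_mem_core h0ρ)
  have hKpre : IsPreconnected K := isPreconnected_core.closure
  obtain ⟨m, hρm, hpm, hm1⟩ : ∃ m, ρ ≤ m ∧ ‖p‖ ≤ m ∧ m < 1 :=
    ⟨max ρ ‖p‖, le_max_left _ _, le_max_right _ _, max_lt hρ1 hp⟩
  obtain ⟨r₁, hmr₁, hr₁⟩ := exists_between hm1
  have hSK : ∀ ζ ∈ S, ζ ∈ K := fun ζ hζ =>
    subset_closure (closure_core_subset_core hφc h0 hrρ (subset_closure (hS ζ hζ)))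
  obtain ⟨F₁, hF₁, hF₁K, hF₁S, b, hb, b', hb'p, hseg⟩ := exists_isHolAut_hit hE h00 h10 h11 hF hKc
    ⟨0, h0K⟩ hmr₁ (fun ζ hζ => (norm_le_of_mem_closure_core hφc hζ).trans hρm) hpm hSK
    (lt_min (half_pos hε) (half_pos (sub_pos.2 hmr₁)))
  set f := fun ζ : ℂ => F₁ (ζ • e₀) with hf
  set Q := K ∪ segment ℝ b b' with hQ
  have hQr : ∀ ζ ∈ Q, ‖f ζ‖ < r₁ := by
    rintro ζ (hζ | hζ)
    · have h1 := (hF₁K ζ hζ).trans (min_le_right _ _)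
      have h2 : ‖F (ζ • e₀)‖ ≤ ρ := norm_le_of_mem_closure_core hφc hζ
      have h3 := norm_sub_norm_le (F₁ (ζ • e₀)) (F (ζ • e₀))
      have : ‖F₁ (ζ • e₀)‖ < r₁ := by linarith
      exact this
    · exact hseg ζ hζ
  have hQpre : IsPreconnected Q :=
    hKpre.union b hb (left_mem_segment ℝ b b') (convex_segment b b').isPreconnected
  obtain ⟨d, hd, hd1⟩ : ∃ d > 0, r₁ + 4 * d = 1 := ⟨(1 - r₁) / 4, by linarith, by ring⟩
  have hr₁0 : 0 < r₁ := by linarith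
  obtain ⟨δ, hδ, hcorr⟩ := exists_correction hE ((insert b' S).image f) 2
    (lt_min hd (by positivity : 0 < ε / 4))
  obtain ⟨L, hL⟩ := exists_labyrinth (E := E) (ρ := r₁ + d) (r := r₁ + 2 * d) (by linarith)
    (by linarith)
  have hfd : ContDiff ℂ 1 f := hF₁.contDiff.comp (by fun_prop : ContDiff ℂ 1 fun ζ : ℂ => ζ • e₀)
  have hlin : IsClosed (range fun ζ : ℂ => ζ • e₀) := by
    have h1 : IsClosed {z : E | z = π₀ z • e₀} := isClosed_eq continuous_id (by fun_prop)
    convert h1 using 1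
    ext z
    exact ⟨fun ⟨ζ, h⟩ => by subst h; simp [h00], fun h => ⟨π₀ z, (show z = π₀ z • e₀ from h).symm⟩⟩
  obtain ⟨Φ, hΦ, hΦK, hΦL⟩ := exists_isHolAut_avoid_walls hE L hL.pairwise hfd
    (hF₁.isClosed_range_comp hlin) (isCompact_closedBall (0 : E) r₁)
    (fun w hw z hz => by
      have h1 := re_inner_le_norm_of_norm_eq_one w.norm_normal z
      have h2 := hL.lt_level w hw
      rw [mem_closedBall_zero_iff] at hz
      have : (inner ℂ w.normal z).re < w.level := by linarith
      exact this) (lt_min hδ (lt_min hd (by positivity : 0 < ε / 4)))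
  have hΦQ : ∀ ζ ∈ Q, ‖Φ (f ζ) - f ζ‖ ≤ min δ (min d (ε / 4)) := fun ζ hζ =>
    (hΦK _ (mem_closedBall_zero_iff.2 (hQr ζ hζ).le)).1
  have hSQ : ∀ ζ ∈ insert b' S, ζ ∈ Q := by
    intro ζ hζ
    rcases Finset.mem_insert.1 hζ with rfl | h
    · exact Or.inr (right_mem_segment ℝ _ _)
    · exact Or.inl (hSK ζ h)
  obtain ⟨C, hC, hCT, hCd⟩ := hcorr Φ (by
    intro x hx
    obtain ⟨ζ, hζ, rfl⟩ := Finset.mem_image.1 hx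
    exact (hΦQ ζ (hSQ ζ hζ)).trans (min_le_left _ _))
  have hΦQ1 : ∀ ζ ∈ Q, ‖Φ (f ζ)‖ ≤ r₁ + d := by
    intro ζ hζ
    have h1 := ((hΦQ ζ hζ).trans (min_le_right _ _)).trans (min_le_left _ _)
    have h2 := hQr ζ hζ
    have h3 := norm_sub_norm_le (Φ (f ζ)) (f ζ)
    linarith
  have hCQ : ∀ ζ ∈ Q, ‖C (Φ (f ζ)) - Φ (f ζ)‖ ≤ min d (ε / 4) := fun ζ hζ =>
    (hCd _ ((hΦQ1 ζ hζ).trans (by linarith))).1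
  have hF'S : ∀ ζ ∈ insert b' S, C (Φ (f ζ)) = f ζ := fun ζ hζ =>
    hCT _ (Finset.mem_image_of_mem f hζ)
  have hQcore : Q ⊆ core (fun ζ : ℂ => C (Φ (f ζ))) (r₁ + 3 * d) := by
    refine subset_core hQpre (Or.inl h0K) fun ζ hζ => ?_
    have h1 := (hCQ ζ hζ).trans (min_le_left _ _)
    have h2 := hΦQ1 ζ hζ
    have h3 := norm_sub_norm_le (C (Φ (f ζ))) (Φ (f ζ))
    linarith
  refine ⟨F₁.trans (Φ.trans C), r₁ + 3 * d, insert b' S, hF₁.trans (hΦ.trans hC), by linarith,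
    by linarith, Finset.subset_insert _ _, fun ζ hζ => hQcore (hSQ ζ hζ),
    ⟨b', Finset.mem_insert_self _ _, (hF'S b' (Finset.mem_insert_self _ _)).trans hb'p⟩,
    fun ζ hζ => (hF'S ζ (Finset.mem_insert_of_mem hζ)).trans (hF₁S ζ hζ),
    fun ζ hζ => ⟨?_, hQcore (Or.inl hζ)⟩, fun γ a c hac hγ ha hc => ?_⟩
  · have h1 := (hF₁K ζ hζ).trans (min_le_left _ _)
    have h2 := ((hΦQ ζ (Or.inl hζ)).trans (min_le_right _ _)).trans (min_le_right _ _)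
    have h3 := (hCQ ζ (Or.inl hζ)).trans (min_le_right _ _)
    have h4 := norm_sub_le_norm_sub_add_norm_sub (C (Φ (f ζ))) (Φ (f ζ)) (F (ζ • e₀))
    have h5 := norm_sub_le_norm_sub_add_norm_sub (Φ (f ζ)) (f ζ) (F (ζ • e₀))
    have h6 : ‖C (Φ (f ζ)) - F (ζ • e₀)‖ ≤ ε := by
      have h7 : ‖f ζ - F (ζ • e₀)‖ ≤ ε / 2 := h1
      linarith
    exact h6
  · exact hL.one_le_two_mul_eVariationOn (hΦ.contDiff.continuous.comp hfd.continuous) hΦL hC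
      (d := d) (by linarith) (fun z hz => (hCd z hz).2.trans (min_le_left _ _)) (by linarith)
      (by linarith) hac hγ (hΦQ1 _ (Or.inl ha)) (hQcore (Or.inl ha)) hc

end StepTheorem

section Tower

variable {E : Type*} [NormedAddCommGroup E] [NormedSpace ℂ E]

/-- A sequence of entire curves together with an exhaustion by cores on which it converges to an
injective immersion into the unit ball hitting the points `p k`, any path which crosses infinitely
many cores having infinite length. -/
structure Tower (p : ℕ → E) (φ : ℕ → ℂ → E) (r : ℕ → ℝ) : Prop where
  differentiable : ∀ k, Differentiable ℂ (φ k)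
  norm_zero_lt : ∀ k, ‖φ k 0‖ < r k
  lt_one : ∀ k, r k < 1
  lt_succ : ∀ k, r k < r (k + 1)
  exists_le_norm_sub : ∀ k, ∃ c > 0, ∀ x y : ℂ, ‖φ k x‖ ≤ 1 → ‖φ k y‖ ≤ 1 →
    c * ‖x - y‖ ≤ ‖φ k x - φ k y‖
  closure_subset : ∀ k, closure (core (φ k) ((1 + r k) / 2)) ⊆ core (φ (k + 1)) (r (k + 1))
  norm_sub_le : ∀ k, ∀ ζ ∈ closure (core (φ k) ((1 + r k) / 2)),
    ‖φ (k + 1) ζ - φ k ζ‖ ≤ (1 - r k) / 4 * (1 / 2) ^ k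
  norm_increment_le : ∀ k, ∀ x ∈ closure (core (φ k) (r k)), ∀ y ∈ closure (core (φ k) (r k)),
    ‖(φ (k + 1) x - φ k x) - (φ (k + 1) y - φ k y)‖ ≤ (1 / 2) ^ (k + 2) * ‖φ k x - φ k y‖
  hit : ∀ k, ∃ ζ ∈ core (φ (k + 1)) (r (k + 1)), ∀ j, k + 1 ≤ j → φ j ζ = p k
  one_le_eVariationOn : ∀ k, ∀ (γ : ℝ → ℂ) (a b : ℝ), a ≤ b → ContinuousOn γ (Icc a b) →
    γ a ∈ core (φ k) (r k) → γ b ∉ core (φ (k + 1)) (r (k + 1)) →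
    1 ≤ 2 * eVariationOn (fun t => φ (k + 1) (γ t)) (Icc a b)

end Tower

section TowerExists

variable {E : Type*} [NormedAddCommGroup E] [InnerProductSpace ℂ E] [FiniteDimensional ℂ E]

structure Stage (e₀ : E) where
  aut : E ≃ E
  radius : ℝ
  nodes : Finset ℂ
  isHolAut : IsHolAut aut
  norm_lt : ‖aut ((0 : ℂ) • e₀)‖ < radius
  lt_one : radius < 1
  mem_core : ∀ ζ ∈ nodes, ζ ∈ core (fun ζ : ℂ => aut (ζ • e₀)) radius

variable {e₀ : E}

def Stage.curve (s : Stage e₀) (ζ : ℂ) : E := s.aut (ζ • e₀)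

structure Stage.Refines (s s' : Stage e₀) (p : E) (k : ℕ) : Prop where
  lt : s.radius < s'.radius
  nodes_subset : s.nodes ⊆ s'.nodes
  hit : ∃ ζ ∈ s'.nodes, s'.curve ζ = p
  curve_eq : ∀ ζ ∈ s.nodes, s'.curve ζ = s.curve ζ
  closure_subset : closure (core s.curve ((1 + s.radius) / 2)) ⊆ core s'.curve s'.radius
  norm_sub_le : ∀ ζ ∈ closure (core s.curve ((1 + s.radius) / 2)),
    ‖s'.curve ζ - s.curve ζ‖ ≤ (1 - s.radius) / 4 * (1 / 2) ^ k
  norm_increment_le : ∀ x ∈ closure (core s.curve s.radius), ∀ y ∈ closure (core s.curve s.radius),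
    ‖(s'.curve x - s.curve x) - (s'.curve y - s.curve y)‖ ≤
      (1 / 2) ^ (k + 2) * ‖s.curve x - s.curve y‖
  one_le_eVariationOn : ∀ (γ : ℝ → ℂ) (a b : ℝ), a ≤ b → ContinuousOn γ (Icc a b) →
    γ a ∈ core s.curve s.radius → γ b ∉ core s'.curve s'.radius →
    1 ≤ 2 * eVariationOn (fun t => s'.curve (γ t)) (Icc a b)

theorem Stage.exists_refines (hE : 2 ≤ Module.finrank ℂ E)
    {π₀ π₁ : E →L[ℂ] ℂ} {e₁ : E} (h00 : π₀ e₀ = 1) (h10 : π₁ e₀ = 0) (h11 : π₁ e₁ = 1)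
    (s : Stage e₀) {p : E} (hp : ‖p‖ < 1) (k : ℕ) : ∃ s' : Stage e₀, s.Refines s' p k := by
  have hr1 := s.lt_one
  have hrρ : s.radius < (1 + s.radius) / 2 := by linarith
  obtain ⟨ε, hε, hinc⟩ := s.isHolAut.exists_norm_sub_le h00 s.norm_lt hrρ hr1.le
    (by positivity : (0 : ℝ) < (1 / 2) ^ (k + 2))
  have hpos : 0 < (1 - s.radius) / 4 * (1 / 2) ^ k := by
    have : 0 < 1 - s.radius := by linarith
    positivity
  obtain ⟨F', r', S', hF', hrr', hr'1, hSS', hS', hhit, heq, hcl, hpath⟩ :=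
    s.isHolAut.exists_step hE h00 h10 h11 s.norm_lt hr1 s.mem_core hp (lt_min hε hpos)
  have hφc : Continuous s.curve := s.isHolAut.differentiable_line.continuous
  have h0 : (0 : ℂ) ∈ core (fun ζ : ℂ => F' (ζ • e₀)) r' :=
    (hcl 0 (subset_closure (zero_mem_core (s.norm_lt.trans hrρ)))).2
  refine ⟨⟨F', r', S', hF', norm_lt_of_mem_core h0, hr'1, hS'⟩, hrr', hSS', hhit, heq,
    fun ζ hζ => (hcl ζ hζ).2, fun ζ hζ => (hcl ζ hζ).1.trans (min_le_right _ _), ?_, ?_⟩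
  · exact hinc (fun ζ => F' (ζ • e₀) - s.curve ζ)
      (hF'.differentiable_line.sub s.isHolAut.differentiable_line)
      fun ζ hζ => (hcl ζ hζ).1.trans (min_le_left _ _)
  · intro γ a b hab hγ ha hb
    exact hpath γ a b hab hγ
      (subset_closure (closure_core_subset_core hφc s.norm_lt hrρ (subset_closure ha))) hb

theorem exists_tower (hE : 2 ≤ Module.finrank ℂ E)
    {π₀ π₁ : E →L[ℂ] ℂ} {e₁ : E} (h00 : π₀ e₀ = 1) (h10 : π₁ e₀ = 0) (h11 : π₁ e₁ = 1)
    {p : ℕ → E} (hp : ∀ k, ‖p k‖ < 1) : ∃ φ r, Tower p φ r := by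
  choose next hnext using fun (k : ℕ) (s : Stage e₀) =>
    s.exists_refines hE h00 h10 h11 (hp k) k
  let s₀ : Stage e₀ := ⟨Equiv.refl E, 1 / 2, ∅, .refl, by simp, by norm_num, by simp⟩
  obtain ⟨s, hs⟩ : ∃ s : ℕ → Stage e₀, ∀ k, s (k + 1) = next k (s k) :=
    ⟨fun k => Nat.rec s₀ next k, fun _ => rfl⟩
  have hR : ∀ k, (s k).Refines (s (k + 1)) (p k) k := fun k => hs k ▸ hnext k (s k)
  refine ⟨fun k => (s k).curve, fun k => (s k).radius, fun k => (s k).isHolAut.differentiable_line,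
    fun k => (s k).norm_lt, fun k => (s k).lt_one, fun k => (hR k).lt,
    fun k => (s k).isHolAut.exists_le_norm_sub h00, fun k => (hR k).closure_subset,
    fun k => (hR k).norm_sub_le, fun k => (hR k).norm_increment_le, fun k => ?_,
    fun k => (hR k).one_le_eVariationOn⟩
  obtain ⟨ζ, hζ, hζp⟩ := (hR k).hit
  refine ⟨ζ, (s (k + 1)).mem_core ζ hζ, fun j hj => ?_⟩
  suffices h : ζ ∈ (s j).nodes ∧ (s j).curve ζ = p k from h.2
  induction j, hj using Nat.le_induction with
  | base => exact ⟨hζ, hζp⟩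
  | succ j hj ih => exact ⟨(hR j).nodes_subset ih.1, ((hR j).curve_eq ζ ih.1).trans ih.2⟩

end TowerExists

section Limit

open Filter Topology

theorem eVariationOn_le_mul_of_edist_le {α E F : Type*} [LinearOrder α] [PseudoEMetricSpace E]
    [PseudoEMetricSpace F] {f : α → E} {g : α → F} {s : Set α} {C : ℝ≥0∞}
    (h : ∀ x ∈ s, ∀ y ∈ s, edist (f x) (f y) ≤ C * edist (g x) (g y)) :
    eVariationOn f s ≤ C * eVariationOn g s := by
  refine iSup_le fun q => ?_
  calc _ ≤ ∑ i ∈ Finset.range q.1, C * edist (g (q.2.1 (i + 1))) (g (q.2.1 i)) :=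
        Finset.sum_le_sum fun i _ => h _ (q.2.2.2 _) _ (q.2.2.2 _)
    _ = C * ∑ i ∈ Finset.range q.1, edist (g (q.2.1 (i + 1))) (g (q.2.1 i)) := by
        rw [Finset.mul_sum]
    _ ≤ _ := mul_le_mul_right (eVariationOn.sum_le q.2.2.1 q.2.2.2) C

namespace Tower

variable {E : Type*} [NormedAddCommGroup E] [NormedSpace ℂ E] {p : ℕ → E} {φ : ℕ → ℂ → E}
  {r : ℕ → ℝ}

theorem pos (h : Tower p φ r) (k : ℕ) : 0 < r k := (norm_nonneg _).trans_lt (h.norm_zero_lt k)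

theorem continuous (h : Tower p φ r) (k : ℕ) : Continuous (φ k) := (h.differentiable k).continuous

theorem lt_half (h : Tower p φ r) (k : ℕ) : r k < (1 + r k) / 2 := by linarith [h.lt_one k]

theorem closure_subset_closure (h : Tower p φ r) (k : ℕ) :
    closure (core (φ k) (r k)) ⊆ closure (core (φ k) ((1 + r k) / 2)) :=
  (closure_core_subset_core (h.continuous k) (h.norm_zero_lt k) (h.lt_half k)).trans subset_closure

theorem closure_subset_succ (h : Tower p φ r) (k : ℕ) :
    closure (core (φ k) (r k)) ⊆ core (φ (k + 1)) (r (k + 1)) :=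
  (h.closure_subset_closure k).trans (h.closure_subset k)

theorem monotone_core (h : Tower p φ r) : Monotone fun k => core (φ k) (r k) :=
  monotone_nat_of_le_succ fun k => subset_closure.trans (h.closure_subset_succ k)

theorem monotone_closure (h : Tower p φ r) : Monotone fun k => closure (core (φ k) (r k)) :=
  monotone_nat_of_le_succ fun k => (h.closure_subset_succ k).trans subset_closure

theorem isCompact_closure (h : Tower p φ r) (k : ℕ) : IsCompact (closure (core (φ k) (r k))) := by
  refine isCompact_closure_core (h.continuous k) ?_
  obtain ⟨c, hc, hle⟩ := h.exists_le_norm_sub k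
  refine (isBounded_closedBall (x := (0 : ℂ)) (r := 2 / c)).subset fun ζ hζ => ?_
  have hζ' : ‖φ k ζ‖ ≤ 1 := le_trans hζ (h.lt_one k).le
  have h0 : ‖φ k 0‖ ≤ 1 := ((h.norm_zero_lt k).trans (h.lt_one k)).le
  have h1 := hle ζ 0 hζ' h0
  have h2 := _root_.norm_sub_le (φ k ζ) (φ k 0)
  rw [mem_closedBall_zero_iff, le_div_iff₀ hc]
  rw [sub_zero] at h1
  linarith

variable [CompleteSpace E]

theorem tendsto_limUnder_and_norm_sub_le (h : Tower p φ r) {k : ℕ} {ζ : ℂ}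
    (hζ : ζ ∈ closure (core (φ k) (r k))) :
    Tendsto (fun j => φ j ζ) atTop (𝓝 (limUnder atTop fun j => φ j ζ)) ∧
      ‖φ k ζ - limUnder atTop fun j => φ j ζ‖ ≤ (1 - r k) / 2 * (1 / 2) ^ k := by
  have hr : Monotone r := monotone_nat_of_le_succ fun k => (h.lt_succ k).le
  have hd : ∀ j, dist (φ (k + j) ζ) (φ (k + (j + 1)) ζ) ≤
      ((1 - r k) / 4 * (1 / 2) ^ k) * (1 / 2) ^ j := by
    intro j
    have h1 := h.norm_sub_le (k + j) ζ (h.closure_subset_closure _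
      (h.monotone_closure (Nat.le_add_right k j) hζ))
    rw [dist_comm, dist_eq_norm]
    refine h1.trans ?_
    rw [mul_assoc, ← pow_add]
    have := hr (Nat.le_add_right k j)
    gcongr
  have hc : CauchySeq fun j => φ (k + j) ζ := cauchySeq_of_le_geometric (1 / 2) _ (by norm_num) hd
  obtain ⟨a, ha⟩ := cauchySeq_tendsto_of_complete hc
  have ha' : Tendsto (fun j => φ j ζ) atTop (𝓝 a) := by
    rw [← tendsto_add_atTop_iff_nat k]
    simpa only [add_comm] using ha
  rw [ha'.limUnder_eq]
  refine ⟨ha', ?_⟩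
  have := dist_le_of_le_geometric_of_tendsto₀ (1 / 2) _ (by norm_num) hd ha
  rw [dist_eq_norm] at this
  refine this.trans (le_of_eq ?_)
  ring

theorem norm_limUnder_lt (h : Tower p φ r) {k : ℕ} {ζ : ℂ} (hζ : ζ ∈ core (φ k) (r k)) :
    ‖limUnder atTop fun j => φ j ζ‖ < 1 := by
  have h1 := (h.tendsto_limUnder_and_norm_sub_le (subset_closure hζ)).2
  have h2 := norm_lt_of_mem_core hζ
  have h3 : ((1 : ℝ) / 2) ^ k ≤ 1 := pow_le_one₀ (by norm_num) (by norm_num)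
  have h4 := h.lt_one k
  have h5 := norm_sub_norm_le (limUnder atTop fun j => φ j ζ) (φ k ζ)
  rw [norm_sub_rev] at h5
  nlinarith

theorem differentiableOn_limUnder (h : Tower p φ r) (k : ℕ) :
    DifferentiableOn ℂ (fun ζ => limUnder atTop fun j => φ j ζ) (core (φ k) (r k)) := by
  have hu : TendstoUniformlyOn φ (fun ζ => limUnder atTop fun j => φ j ζ) atTop
      (core (φ k) (r k)) := by
    rw [Metric.tendstoUniformlyOn_iff]
    intro ε hε
    obtain ⟨N, hN⟩ := exists_pow_lt_of_lt_one hε (by norm_num : (1 : ℝ) / 2 < 1)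
    filter_upwards [eventually_ge_atTop (max k N)] with j hj ζ hζ
    have h1 := (h.tendsto_limUnder_and_norm_sub_le
      (subset_closure (h.monotone_core ((le_max_left _ _).trans hj) hζ))).2
    rw [dist_comm, dist_eq_norm]
    refine (h1.trans ?_).trans_lt hN
    have h2 : ((1 : ℝ) / 2) ^ j ≤ (1 / 2) ^ N :=
      pow_le_pow_of_le_one (by norm_num) (by norm_num) ((le_max_right _ _).trans hj)
    have h3 := h.pos j
    have h4 := h.lt_one j
    have h5 : (0 : ℝ) < (1 / 2) ^ j := by positivity
    nlinarith
  exact hu.tendstoLocallyUniformlyOn.differentiableOn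
    (Eventually.of_forall fun j => (h.differentiable j).differentiableOn)
    (isOpen_core (h.continuous k))

theorem norm_sub_le_two_mul (h : Tower p φ r) {k : ℕ} {x y : ℂ}
    (hx : x ∈ closure (core (φ k) (r k))) (hy : y ∈ closure (core (φ k) (r k))) :
    ‖φ k x - φ k y‖ ≤ 2 * ‖(limUnder atTop fun j => φ j x) - limUnder atTop fun j => φ j y‖ := by
  have key : ∀ j, k ≤ j →
      (1 / 2 + (1 / 2) ^ (j + 1)) * ‖φ k x - φ k y‖ ≤ ‖φ j x - φ j y‖ := by
    intro j hj
    induction j, hj using Nat.le_induction with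
    | base =>
      have h3 : ((1 : ℝ) / 2) ^ k ≤ 1 := pow_le_one₀ (by norm_num) (by norm_num)
      rw [pow_succ]
      nlinarith [norm_nonneg (φ k x - φ k y)]
    | succ j hj ih =>
      have h1 := h.norm_increment_le j x (h.monotone_closure hj hx) y (h.monotone_closure hj hy)
      have h2 := norm_sub_norm_le (φ j x - φ j y)
        (-((φ (j + 1) x - φ j x) - (φ (j + 1) y - φ j y)))
      rw [norm_neg, show φ j x - φ j y - -((φ (j + 1) x - φ j x) - (φ (j + 1) y - φ j y)) =
        φ (j + 1) x - φ (j + 1) y by abel] at h2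
      obtain ⟨u, hu⟩ : ∃ u : ℝ, u = (1 / 2) ^ (j + 1) := ⟨_, rfl⟩
      have hu0 : 0 < u := by rw [hu]; positivity
      have hu1 : u ≤ 1 / 2 := by
        rw [hu, pow_succ]
        have h3 : ((1 : ℝ) / 2) ^ j ≤ 1 := pow_le_one₀ (by norm_num) (by norm_num)
        linarith
      rw [pow_succ _ (j + 1), ← hu] at h1 ⊢
      rw [← hu] at ih
      have h4 : (1 - u / 2) * ((1 / 2 + u) * ‖φ k x - φ k y‖) ≤ (1 - u / 2) * ‖φ j x - φ j y‖ :=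
        mul_le_mul_of_nonneg_left ih (by linarith)
      have h5 : (1 / 2 + u * (1 / 2)) * ‖φ k x - φ k y‖ ≤
          ((1 - u / 2) * (1 / 2 + u)) * ‖φ k x - φ k y‖ :=
        mul_le_mul_of_nonneg_right (by nlinarith) (norm_nonneg _)
      linarith
  have hlim := (((h.tendsto_limUnder_and_norm_sub_le hx).1).sub
    (h.tendsto_limUnder_and_norm_sub_le hy).1).norm
  have : 1 / 2 * ‖φ k x - φ k y‖ ≤
      ‖(limUnder atTop fun j => φ j x) - limUnder atTop fun j => φ j y‖ := by
    refine ge_of_tendsto hlim ?_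
    filter_upwards [eventually_ge_atTop k] with j hj
    refine le_trans ?_ (key j hj)
    gcongr
    linarith [(by positivity : (0 : ℝ) < (1 / 2) ^ (j + 1))]
  linarith

theorem exists_le_norm_sub_limUnder (h : Tower p φ r) (k : ℕ) :
    ∃ c > 0, ∀ x ∈ core (φ k) (r k), ∀ y ∈ core (φ k) (r k),
      c * ‖x - y‖ ≤ ‖(limUnder atTop fun j => φ j x) - limUnder atTop fun j => φ j y‖ := by
  obtain ⟨c, hc, hle⟩ := h.exists_le_norm_sub k
  refine ⟨c / 2, by positivity, fun x hx y hy => ?_⟩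
  have h1 := hle x y ((norm_lt_of_mem_core hx).trans (h.lt_one k)).le
    ((norm_lt_of_mem_core hy).trans (h.lt_one k)).le
  have h2 := h.norm_sub_le_two_mul (subset_closure hx) (subset_closure hy)
  linarith

/-- A path from one core to the complement of the next one is long, as measured by the limit. -/
theorem one_le_four_mul_eVariationOn (h : Tower p φ r) {k : ℕ} {γ : ℝ → ℂ} {a b : ℝ} (hab : a ≤ b)
    (hγ : ContinuousOn γ (Icc a b)) (ha : γ a ∈ core (φ k) (r k))
    (hb : γ b ∉ core (φ (k + 1)) (r (k + 1))) :
    1 ≤ 4 * eVariationOn (fun t => limUnder atTop fun j => φ j (γ t)) (Icc a b) := by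
  have hclosed : IsClosed (Icc a b ∩ γ ⁻¹' (core (φ (k + 1)) (r (k + 1)))ᶜ) :=
    hγ.preimage_isClosed_of_isClosed isClosed_Icc (isOpen_core (h.continuous _)).isClosed_compl
  obtain ⟨c, ⟨hc, hcr⟩, hcmin⟩ :=
    (isCompact_Icc.of_isClosed_subset hclosed inter_subset_left).exists_isLeast
      ⟨b, right_mem_Icc.2 hab, hb⟩
  have ha' := h.monotone_core k.le_succ ha
  have hac : a < c := lt_of_le_of_ne hc.1 (by rintro rfl; exact hcr ha')
  have hsub : Icc a c ⊆ Icc a b := Icc_subset_Icc_right hc.2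
  have hlt : ∀ t ∈ Ico a c, γ t ∈ core (φ (k + 1)) (r (k + 1)) := by
    intro t ht
    by_contra hcon
    exact ht.2.not_ge (hcmin ⟨⟨ht.1, ht.2.le.trans hc.2⟩, hcon⟩)
  have hle : MapsTo γ (Icc a c) (closure (core (φ (k + 1)) (r (k + 1)))) := by
    rw [← closure_Ico hac.ne]
    refine MapsTo.closure_of_continuousOn hlt ?_
    rw [closure_Ico hac.ne]
    exact hγ.mono hsub
  have h1 := h.one_le_eVariationOn k γ a c hac.le (hγ.mono hsub) ha hcr
  have h2 : eVariationOn (fun t => φ (k + 1) (γ t)) (Icc a c) ≤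
      2 * eVariationOn (fun t => limUnder atTop fun j => φ j (γ t)) (Icc a c) := by
    refine eVariationOn_le_mul_of_edist_le fun x hx y hy => ?_
    have := h.norm_sub_le_two_mul (hle hx) (hle hy)
    rw [edist_dist, edist_dist, dist_eq_norm, dist_eq_norm, show (2 : ℝ≥0∞) =
      ENNReal.ofReal 2 by simp,
      ← ENNReal.ofReal_mul (by norm_num)]
    exact ENNReal.ofReal_le_ofReal this
  calc (1 : ℝ≥0∞) ≤ _ := h1
    _ ≤ 2 * (2 * eVariationOn (fun t => limUnder atTop fun j => φ j (γ t)) (Icc a c)) :=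
      mul_le_mul_right h2 _
    _ ≤ 2 * (2 * eVariationOn (fun t => limUnder atTop fun j => φ j (γ t)) (Icc a b)) :=
      mul_le_mul_right (mul_le_mul_right (eVariationOn.mono _ hsub) _) _
    _ = _ := by rw [← mul_assoc]; norm_num

theorem eVariationOn_eq_top (h : Tower p φ r) {γ : ℝ → ℂ}
    (hγ : DivergentPathIn (⋃ k, core (φ k) (r k)) γ) :
    eVariationOn (fun t => limUnder atTop fun j => φ j (γ t)) (Ico 0 1) = ⊤ := by
  obtain ⟨hγc, hγm, hγd⟩ := hγ
  set f := fun t => limUnder atTop fun j => φ j (γ t) with hf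
  have hstep : ∀ t ∈ Ico (0 : ℝ) 1, ∃ t' ∈ Ico (0 : ℝ) 1, t ≤ t' ∧ 1 ≤ 4 * eVariationOn f
    (Icc t t') := by
    intro t ht
    obtain ⟨k, hk⟩ := mem_iUnion.1 (hγm t ht)
    obtain ⟨t₀, ht₀, hout⟩ := hγd (closure (core (φ (k + 1)) (r (k + 1))))
      ((h.closure_subset_succ (k + 1)).trans (subset_iUnion (fun k => core (φ k) (r k)) _))
      (h.isCompact_closure _)
    have hm : max t t₀ < 1 := max_lt ht.2 ht₀.2
    refine ⟨max t t₀, ⟨ht.1.trans (le_max_left _ _), hm⟩, le_max_left _ _, ?_⟩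
    exact h.one_le_four_mul_eVariationOn (le_max_left _ _)
      (hγc.mono fun s hs => ⟨ht.1.trans hs.1, hs.2.trans_lt hm⟩) hk
      fun hcon => hout _ ⟨le_max_right _ _, hm⟩ (subset_closure hcon)
  have hn : ∀ n : ℕ, ∃ t ∈ Ico (0 : ℝ) 1, (n : ℝ≥0∞) ≤ 4 * eVariationOn f (Icc 0 t) := by
    intro n
    induction n with
    | zero => exact ⟨0, by simp, by simp⟩
    | succ n ih =>
      obtain ⟨t, ht, hle⟩ := ih
      obtain ⟨t', ht', htt', hle'⟩ := hstep t ht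
      refine ⟨t', ht', ?_⟩
      have h1 := eVariationOn.Icc_add_Icc f (s := univ) ht.1 htt' (mem_univ _)
      simp only [univ_inter] at h1
      rw [← h1, mul_add]
      push_cast
      exact add_le_add hle hle'
  by_contra hne
  have hne' : 4 * eVariationOn f (Ico 0 1) ≠ ⊤ := ENNReal.mul_ne_top (by norm_num) hne
  obtain ⟨n, hlt⟩ := ENNReal.exists_nat_gt hne'
  obtain ⟨t, ht, hle⟩ := hn n
  refine (hle.trans (mul_le_mul_right (eVariationOn.mono f fun s hs => ?_) 4)).not_gt hlt
  exact ⟨hs.1, hs.2.trans_lt ht.2⟩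

end Tower

end Limit

section RiemannMap

open Filter Topology ComplexConjugate

/-- Hurwitz's theorem: a locally uniform limit of nonvanishing holomorphic functions on a connected
open set vanishes identically or nowhere. -/
theorem eqOn_zero_or_ne_zero_of_tendstoLocallyUniformlyOn {ι : Type*} {l : Filter ι} [l.NeBot]
    {U : Set ℂ} (hU : IsOpen U) (hUc : IsPreconnected U) {F : ι → ℂ → ℂ} {f : ℂ → ℂ}
    (hF : ∀ n, DifferentiableOn ℂ (F n) U) (hF0 : ∀ n, ∀ z ∈ U, F n z ≠ 0)
    (hlim : TendstoLocallyUniformlyOn F f l U) : EqOn f 0 U ∨ ∀ z ∈ U, f z ≠ 0 := by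
  by_contra! hcon
  obtain ⟨hne, z₀, hz₀, hfz₀⟩ := hcon
  have hf : DifferentiableOn ℂ f U := hlim.differentiableOn (Eventually.of_forall hF) hU
  have hfa : AnalyticOnNhd ℂ f U := hf.analyticOnNhd hU
  have hiso : ∀ᶠ z in 𝓝[≠] z₀, f z ≠ 0 := by
    refine (hfa z₀ hz₀).eventually_eq_zero_or_eventually_ne_zero.resolve_left fun h => hne ?_
    exact hfa.eqOn_zero_of_preconnected_of_eventuallyEq_zero hUc hz₀ h
  rw [eventually_nhdsWithin_iff] at hiso
  obtain ⟨R, hR, hball⟩ := Metric.eventually_nhds_iff_ball.1 (hiso.and (hU.mem_nhds hz₀))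
  have hr : 0 < R / 2 := by positivity
  have hsub : closedBall z₀ (R / 2) ⊆ ball z₀ R := closedBall_subset_ball (by linarith)
  have hsubU : closedBall z₀ (R / 2) ⊆ U := fun z hz => (hball z (hsub hz)).2
  obtain ⟨ε, hε, hεf⟩ : ∃ ε > 0, ∀ z ∈ sphere z₀ (R / 2), ε ≤ ‖f z‖ := by
    obtain ⟨w, hw, hmin⟩ := (isCompact_sphere z₀ (R / 2)).exists_isMinOn
      (NormedSpace.sphere_nonempty.2 hr.le)
      ((hf.continuousOn.mono (sphere_subset_closedBall.trans hsubU)).norm)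
    refine ⟨‖f w‖, norm_pos_iff.2 ((hball w (hsub (sphere_subset_closedBall hw))).1 ?_), hmin⟩
    rintro rfl
    simp [hr.ne] at hw
  have hunif := (tendstoLocallyUniformlyOn_iff_forall_isCompact hU).1 hlim _ hsubU
    (isCompact_closedBall _ _)
  rw [Metric.tendstoUniformlyOn_iff] at hunif
  obtain ⟨n, hn⟩ := (hunif (ε / 4) (by positivity)).exists
  have hinv : DiffContOnCl ℂ (fun z => (F n z)⁻¹) (ball z₀ (R / 2)) := by
    refine DifferentiableOn.diffContOnCl ?_
    rw [closure_ball _ hr.ne']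
    exact ((hF n).mono hsubU).inv fun z hz => hF0 n z (hsubU hz)
  have hmax := Complex.norm_le_of_forall_mem_frontier_norm_le isBounded_ball hinv (C := 2 / ε)
    (fun z hz => ?_) (subset_closure (mem_ball_self hr))
  · have h1 := hn z₀ (mem_closedBall_self hr.le)
    rw [hfz₀, dist_eq_norm, zero_sub, norm_neg] at h1
    have h2 : 0 < ‖F n z₀‖ := norm_pos_iff.2 (hF0 n z₀ hz₀)
    rw [norm_inv, inv_eq_one_div, div_le_div_iff₀ h2 hε] at hmax
    linarith
  · rw [frontier_ball _ hr.ne'] at hz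
    have h1 := hn z (sphere_subset_closedBall hz)
    have h2 := hεf z hz
    rw [dist_eq_norm] at h1
    have h3 := norm_sub_norm_le (f z) (F n z)
    have h4 : 0 < ‖F n z‖ := by linarith
    rw [norm_inv, inv_eq_one_div, div_le_div_iff₀ h4 hε]
    linarith

/-- Pointwise convergence of bounded holomorphic functions is locally uniform. -/
theorem tendstoLocallyUniformlyOn_of_norm_lt_one {ι : Type*} {l : Filter ι} [l.NeBot]
    {U : Set ℂ} (hU : IsOpen U) {F : ι → ℂ → ℂ} {f : ℂ → ℂ}
    (hF : ∀ n, DifferentiableOn ℂ (F n) U) (hF1 : ∀ n, ∀ z ∈ U, ‖F n z‖ < 1)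
    (hlim : ∀ z ∈ U, Tendsto (fun n => F n z) l (𝓝 (f z))) : TendstoLocallyUniformlyOn F f l U := by
  rw [Metric.tendstoLocallyUniformlyOn_iff]
  intro ε hε z hz
  obtain ⟨R, hR, hRU⟩ := Metric.isOpen_iff.1 hU z hz
  have hlip : ∀ n, ∀ w ∈ ball z R, dist (F n w) (F n z) ≤ 2 / R * dist w z := fun n w hw =>
    Complex.dist_le_div_mul_dist_of_mapsTo_ball ((hF n).mono hRU) (fun v hv => by
      rw [mem_closedBall, dist_eq_norm]
      refine (norm_sub_le _ _).trans ?_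
      linarith [hF1 n v (hRU hv), hF1 n z hz]) hw
  have hlip' : ∀ w ∈ ball z R, dist (f w) (f z) ≤ 2 / R * dist w z := fun w hw =>
    le_of_tendsto ((hlim w (hRU hw)).dist (hlim z hz)) (Eventually.of_forall fun n => hlip n w hw)
  refine ⟨ball z (min R (ε * R / 8)), mem_nhdsWithin_of_mem_nhds (ball_mem_nhds _ (by positivity)),
    ?_⟩
  filter_upwards [(Metric.tendsto_nhds.1 (hlim z hz)) (ε / 4) (by positivity)] with n hn w hw
  have hwR : w ∈ ball z R := ball_subset_ball (min_le_left _ _) hw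
  have hw' : 2 / R * dist w z ≤ ε / 4 := by
    have : dist w z < ε * R / 8 := (mem_ball.1 hw).trans_le (min_le_right _ _)
    calc 2 / R * dist w z ≤ 2 / R * (ε * R / 8) := by gcongr
      _ = ε / 4 := by field_simp; ring
  have h1 := hlip n w hwR
  have h2 := hlip' w hwR
  have h3 := dist_triangle4 (f w) (f z) (F n z) (F n w)
  rw [dist_comm (f z) (F n z), dist_comm (F n z) (F n w)] at h3
  linarith

/-- A holomorphic embedding of an open set into the unit disc. -/
structure DiscEmbedding (D : Set ℂ) (f : ℂ → ℂ) : Prop where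
  differentiableOn : DifferentiableOn ℂ f D
  injOn : InjOn f D
  deriv_ne_zero : ∀ z ∈ D, deriv f z ≠ 0
  norm_lt_one : ∀ z ∈ D, ‖f z‖ < 1

/-- The automorphism of the disc moving `a` to the origin. -/
def mobius (a z : ℂ) : ℂ := (z - a) / (1 - conj a * z)

theorem one_sub_conj_mul_ne_zero {a z : ℂ} (ha : ‖a‖ < 1) (hz : ‖z‖ < 1) : 1 - conj a * z ≠ 0 := by
  intro h
  have h1 : ‖conj a * z‖ = 1 := by rw [← sub_eq_zero.1 h]; simp
  rw [norm_mul, RCLike.norm_conj] at h1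
  nlinarith [norm_nonneg a, norm_nonneg z]

theorem norm_mobius_lt_one {a z : ℂ} (ha : ‖a‖ < 1) (hz : ‖z‖ < 1) : ‖mobius a z‖ < 1 := by
  have hne := one_sub_conj_mul_ne_zero ha hz
  rw [mobius, norm_div, div_lt_one (norm_pos_iff.2 hne)]
  refine lt_of_pow_lt_pow_left₀ 2 (norm_nonneg _) ?_
  have ha' : Complex.normSq a < 1 := by
    rw [Complex.normSq_eq_norm_sq]; nlinarith [norm_nonneg a]
  have hz' : Complex.normSq z < 1 := by
    rw [Complex.normSq_eq_norm_sq]; nlinarith [norm_nonneg z]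
  rw [← Complex.normSq_eq_norm_sq, ← Complex.normSq_eq_norm_sq]
  simp only [Complex.normSq_apply, Complex.sub_re, Complex.sub_im, Complex.mul_re, Complex.mul_im,
    Complex.conj_re, Complex.conj_im, Complex.one_re, Complex.one_im] at *
  nlinarith [mul_pos (sub_pos.2 ha') (sub_pos.2 hz')]

theorem mobius_injOn {a : ℂ} (ha : ‖a‖ < 1) : InjOn (mobius a) (ball 0 1) := by
  intro z hz w hw h
  rw [mem_ball_zero_iff] at hz hw
  rw [mobius, mobius, div_eq_div_iff (one_sub_conj_mul_ne_zero ha hz)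
    (one_sub_conj_mul_ne_zero ha hw)] at h
  have h1 : (1 - conj a * a) * (z - w) = 0 := by linear_combination h
  rcases mul_eq_zero.1 h1 with h2 | h2
  · exact absurd h2 (one_sub_conj_mul_ne_zero ha ha)
  · exact sub_eq_zero.1 h2

theorem hasDerivAt_mobius {a z : ℂ} (ha : ‖a‖ < 1) (hz : ‖z‖ < 1) :
    HasDerivAt (mobius a) ((1 - conj a * a) / (1 - conj a * z) ^ 2) z := by
  have h := ((hasDerivAt_id' z).sub_const a).fun_div
    (((hasDerivAt_id' z).const_mul (conj a)).const_sub 1) (one_sub_conj_mul_ne_zero ha hz)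
  refine h.congr_deriv ?_
  ring

namespace DiscEmbedding

variable {D : Set ℂ} {f g : ℂ → ℂ}

theorem hasDerivAt (hf : DiscEmbedding D f) {z : ℂ} (hz : z ∈ D) : HasDerivAt f (deriv f z) z :=
  (differentiableAt_of_deriv_ne_zero (hf.deriv_ne_zero z hz)).hasDerivAt

theorem hasDerivAt_mobius_comp (hf : DiscEmbedding D f) {a z : ℂ} (ha : ‖a‖ < 1) (hz : z ∈ D) :
    HasDerivAt (fun z => mobius a (f z))
      ((1 - conj a * a) / (1 - conj a * f z) ^ 2 * deriv f z) z :=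
  (hasDerivAt_mobius ha (hf.norm_lt_one z hz)).comp z (hf.hasDerivAt hz)

theorem mobius_comp (hf : DiscEmbedding D f) {a : ℂ} (ha : ‖a‖ < 1) :
    DiscEmbedding D fun z => mobius a (f z) where
  differentiableOn z hz :=
    (hf.hasDerivAt_mobius_comp ha hz).differentiableAt.differentiableWithinAt
  injOn := (mobius_injOn ha).comp hf.injOn fun z hz => mem_ball_zero_iff.2 (hf.norm_lt_one z hz)
  deriv_ne_zero z hz := by
    rw [(hf.hasDerivAt_mobius_comp ha hz).deriv]
    exact mul_ne_zero (div_ne_zero (one_sub_conj_mul_ne_zero ha ha)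
      (pow_ne_zero _ (one_sub_conj_mul_ne_zero ha (hf.norm_lt_one z hz)))) (hf.deriv_ne_zero z hz)
  norm_lt_one z hz := norm_mobius_lt_one ha (hf.norm_lt_one z hz)

theorem deriv_eq_of_sq (hD : IsOpen D) (hg : DifferentiableOn ℂ g D)
    (hgf : ∀ z ∈ D, g z ^ 2 = f z) {z : ℂ} (hz : z ∈ D) : deriv f z = 2 * g z * deriv g z := by
  have h1 : HasDerivAt (fun z => g z ^ 2) (2 * g z * deriv g z) z := by
    simpa using ((hg.differentiableAt (hD.mem_nhds hz)).hasDerivAt.fun_pow 2)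
  have h2 : f =ᶠ[𝓝 z] fun z => g z ^ 2 := by
    filter_upwards [hD.mem_nhds hz] with w hw using (hgf w hw).symm
  exact (h1.congr_of_eventuallyEq h2).deriv

theorem of_sq (hf : DiscEmbedding D f) (hD : IsOpen D) (hg : DifferentiableOn ℂ g D)
    (hgf : ∀ z ∈ D, g z ^ 2 = f z) : DiscEmbedding D g where
  differentiableOn := hg
  injOn z hz w hw h := hf.injOn hz hw (by rw [← hgf z hz, ← hgf w hw, h])
  deriv_ne_zero z hz h := hf.deriv_ne_zero z hz (by rw [deriv_eq_of_sq hD hg hgf hz, h, mul_zero])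
  norm_lt_one z hz := by
    have := hf.norm_lt_one z hz
    rw [← hgf z hz, norm_pow] at this
    exact (sq_lt_one_iff₀ (norm_nonneg _)).1 this

end DiscEmbedding

theorem exists_discEmbedding {D : Set ℂ} (hD : IsOpen D) (h0 : (0 : ℂ) ∈ D) (hDu : D ≠ univ)
    (hsqrt : ∀ f : ℂ → ℂ, DifferentiableOn ℂ f D → (∀ z ∈ D, f z ≠ 0) →
      ∃ g : ℂ → ℂ, DifferentiableOn ℂ g D ∧ ∀ z ∈ D, g z ^ 2 = f z) :
    ∃ f, DiscEmbedding D f := by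
  obtain ⟨a, ha⟩ := (ne_univ_iff_exists_notMem D).1 hDu
  obtain ⟨g, hg, hgz⟩ := hsqrt (fun z => z - a) (by fun_prop)
    fun z hz h => ha (by rwa [← sub_eq_zero.1 h])
  have hg0 : ∀ z ∈ D, g z ≠ 0 := fun z hz h => by
    have := hgz z hz
    rw [h, zero_pow two_ne_zero] at this
    exact ha (by rwa [← sub_eq_zero.1 this.symm])
  have hgi : ∀ z ∈ D, ∀ w ∈ D, g z ^ 2 = g w ^ 2 → z = w := fun z hz w hw h => by
    rw [hgz z hz, hgz w hw] at h
    exact sub_left_injective h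
  have hgd : ∀ z ∈ D, deriv g z ≠ 0 := fun z hz h => by
    have := DiscEmbedding.deriv_eq_of_sq hD hg hgz hz
    rw [h] at this
    simp at this
  have hstrict : HasStrictDerivAt g (deriv g 0) 0 :=
    ((hg.analyticAt (hD.mem_nhds h0)).contDiffAt (n := 1)).hasStrictDerivAt one_ne_zero
  obtain ⟨ε, hε, hball⟩ : ∃ ε > 0, ball (g 0) ε ⊆ g '' D := by
    refine Metric.mem_nhds_iff.1 ?_
    rw [← hstrict.map_nhds_eq (hgd 0 h0)]
    exact image_mem_map (hD.mem_nhds h0)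
  have hfar : ∀ z ∈ D, ε ≤ ‖g z + g 0‖ := by
    intro z hz
    by_contra! hlt
    obtain ⟨w, hw, hwz⟩ := hball (show -g z ∈ ball (g 0) ε by
      rwa [mem_ball, dist_eq_norm, ← norm_neg, neg_sub, sub_neg_eq_add, add_comm])
    have := hgi w hw z hz (by rw [hwz]; ring)
    subst this
    refine hg0 w hw ?_
    linear_combination hwz / 2
  have hne : ∀ z ∈ D, g z + g 0 ≠ 0 := fun z hz h => by
    have := hfar z hz
    rw [h, norm_zero] at this
    linarith
  have hder : ∀ z ∈ D, HasDerivAt (fun z => (ε / 2 : ℂ) / (g z + g 0))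
      (-((ε / 2 : ℂ) * deriv g z) / (g z + g 0) ^ 2) z := by
    intro z hz
    have := (hasDerivAt_const z (ε / 2 : ℂ)).fun_div
      ((hg.differentiableAt (hD.mem_nhds hz)).hasDerivAt.add_const (g 0)) (hne z hz)
    simpa using this
  have hε2 : (ε / 2 : ℂ) ≠ 0 := by
    have : (ε : ℂ) ≠ 0 := by exact_mod_cast hε.ne'
    simpa using this
  refine ⟨fun z => (ε / 2 : ℂ) / (g z + g 0),
    fun z hz => (hder z hz).differentiableAt.differentiableWithinAt, fun z hz w hw h => ?_,
    fun z hz => ?_, fun z hz => ?_⟩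
  · have h' : (ε / 2 : ℂ) / (g z + g 0) = (ε / 2 : ℂ) / (g w + g 0) := h
    rw [div_eq_div_iff (hne z hz) (hne w hw)] at h'
    have := add_right_cancel (mul_left_cancel₀ hε2 h')
    exact hgi z hz w hw (by rw [this])
  · rw [(hder z hz).deriv]
    exact div_ne_zero (neg_ne_zero.2 (mul_ne_zero hε2 (hgd z hz))) (pow_ne_zero _ (hne z hz))
  · have h1 := hfar z hz
    rw [norm_div, div_lt_one (by linarith)]
    rw [norm_div, Complex.norm_real, Real.norm_of_nonneg hε.le]
    norm_num
    linarith

end RiemannMap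

section RiemannMapExistence

open Filter Topology ComplexConjugate

variable {D : Set ℂ}

/-- A limit of holomorphic embeddings into the disc fixing the origin, whose derivatives there do
not degenerate, is again such an embedding. -/
theorem DiscEmbedding.of_tendsto {ι : Type*} {l : Filter ι} [l.NeBot] (hD : IsOpen D)
    (hDc : IsPreconnected D) (h0 : (0 : ℂ) ∈ D) {F : ι → ℂ → ℂ} {f : ℂ → ℂ}
    (hF : ∀ n, DiscEmbedding D (F n)) (hF0 : ∀ n, F n 0 = 0)
    (hlim : ∀ z ∈ D, Tendsto (fun n => F n z) l (𝓝 (f z))) {M : ℝ} (hM : 0 < M)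
    (hder : Tendsto (fun n => ‖deriv (F n) 0‖) l (𝓝 M)) :
    DiscEmbedding D f ∧ f 0 = 0 ∧ ‖deriv f 0‖ = M := by
  have hloc : TendstoLocallyUniformlyOn F f l D :=
    tendstoLocallyUniformlyOn_of_norm_lt_one hD (fun n => (hF n).differentiableOn)
      (fun n => (hF n).norm_lt_one) hlim
  have hFd : ∀ᶠ n in l, DifferentiableOn ℂ (F n) D :=
    Eventually.of_forall fun n => (hF n).differentiableOn
  have hf : DifferentiableOn ℂ f D := hloc.differentiableOn hFd hD
  have hloc' := hloc.deriv hFd hD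
  have hf0 : f 0 = 0 := tendsto_nhds_unique (hlim 0 h0) (by simp [hF0])
  have hfM : ‖deriv f 0‖ = M := tendsto_nhds_unique (hloc'.tendsto_at h0).norm hder
  have hd : ∀ z ∈ D, deriv f z ≠ 0 := by
    refine (eqOn_zero_or_ne_zero_of_tendstoLocallyUniformlyOn hD hDc
      (fun n => (hF n).differentiableOn.deriv hD) (fun n => (hF n).deriv_ne_zero)
      hloc').resolve_left fun h => ?_
    have h1 := h h0
    rw [Pi.zero_apply] at h1
    rw [h1, norm_zero] at hfM
    exact hM.ne hfM
  refine ⟨⟨hf, fun a ha b hb hab => ?_, hd, fun z hz => ?_⟩, hf0, hfM⟩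
  · by_contra hne
    obtain ⟨R, hR, hRD⟩ := Metric.isOpen_iff.1 (hD.sdiff (isClosed_singleton (x := a))) b
      ⟨hb, fun h => hne h.symm⟩
    have hsub : ball b R ⊆ D := fun z hz => (hRD hz).1
    have hlim' : TendstoLocallyUniformlyOn (fun n z => F n z - F n a) (fun z => f z - f a) l
        (ball b R) := by
      rw [Metric.tendstoLocallyUniformlyOn_iff]
      intro ε hε x hx
      obtain ⟨t, ht, hn⟩ := Metric.tendstoLocallyUniformlyOn_iff.1 (hloc.mono hsub) (ε / 2)
        (by positivity) x hx
      refine ⟨t, ht, ?_⟩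
      filter_upwards [hn, Metric.tendsto_nhds.1 (hlim a ha) (ε / 2) (by positivity)]
        with n h1 h2 z hz
      have := dist_sub_sub_le (f z) (f a) (F n z) (F n a)
      rw [dist_comm (f a)] at this
      linarith [h1 z hz]
    rcases eqOn_zero_or_ne_zero_of_tendstoLocallyUniformlyOn isOpen_ball
      (convex_ball b R).isPreconnected
      (fun n => ((hF n).differentiableOn.mono hsub).sub_const (F n a))
      (fun n z hz h => (hRD hz).2 ((hF n).injOn (hsub hz) ha (sub_eq_zero.1 h))) hlim' with h | h
    · refine hd b hb ?_
      have h1 : f =ᶠ[𝓝 b] fun _ => f a := by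
        filter_upwards [ball_mem_nhds b hR] with z hz using sub_eq_zero.1 (h hz)
      rw [h1.deriv_eq, deriv_const]
    · exact h b (mem_ball_self hR) (sub_eq_zero.2 hab.symm)
  · have hle : ∀ w ∈ D, ‖f w‖ ≤ 1 := fun w hw =>
      le_of_tendsto (hlim w hw).norm (Eventually.of_forall fun n => ((hF n).norm_lt_one w hw).le)
    refine lt_of_le_of_ne (hle z hz) fun h1 => ?_
    have := Complex.norm_eqOn_of_isPreconnected_of_isMaxOn hDc hD hf hz
      (fun w hw => by simpa [h1] using hle w hw) h0
    simp [hf0, h1] at this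

theorem exists_isMaximal_discEmbedding (hD : IsOpen D) (hDc : IsPreconnected D)
    (h0 : (0 : ℂ) ∈ D) (hne : ∃ f, DiscEmbedding D f) :
    ∃ f, DiscEmbedding D f ∧ f 0 = 0 ∧
      ∀ g, DiscEmbedding D g → g 0 = 0 → ‖deriv g 0‖ ≤ ‖deriv f 0‖ := by
  set S : Set ℝ := {x | ∃ f, DiscEmbedding D f ∧ f 0 = 0 ∧ ‖deriv f 0‖ = x} with hS
  obtain ⟨f₀, hf₀⟩ := hne
  have hx₀ : ‖deriv (fun z => mobius (f₀ 0) (f₀ z)) 0‖ ∈ S :=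
    ⟨_, hf₀.mobius_comp (hf₀.norm_lt_one 0 h0), by simp [mobius], rfl⟩
  have hpos : 0 < ‖deriv (fun z => mobius (f₀ 0) (f₀ z)) 0‖ :=
    norm_pos_iff.2 ((hf₀.mobius_comp (hf₀.norm_lt_one 0 h0)).deriv_ne_zero 0 h0)
  obtain ⟨R, hR, hRD⟩ := Metric.isOpen_iff.1 hD 0 h0
  have hbdd : BddAbove S := by
    refine ⟨1 / R, ?_⟩
    rintro _ ⟨f, hf, hf0, rfl⟩
    refine Complex.norm_deriv_le_div_of_mapsTo_ball (hf.differentiableOn.mono hRD)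
      (fun z hz => ?_) hR
    rw [hf0, mem_closedBall_zero_iff]
    exact (hf.norm_lt_one z (hRD hz)).le
  obtain ⟨u, -, hu, huS⟩ := exists_seq_tendsto_sSup ⟨_, hx₀⟩ hbdd
  choose F hF hF0 hFu using huS
  have hex : ∀ z, ∃ w, z ∈ D → Tendsto (fun n => F n z) (hyperfilter ℕ : Filter ℕ) (𝓝 w) := by
    intro z
    by_cases hz : z ∈ D
    · obtain ⟨w, -, hw⟩ := (isCompact_closedBall (0 : ℂ) 1).ultrafilter_le_nhds
        ((hyperfilter ℕ).map fun n => F n z) (by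
          rw [le_principal_iff, Ultrafilter.coe_map, mem_map]
          exact Eventually.of_forall fun n : ℕ => mem_closedBall_zero_iff.2
            ((hF n).norm_lt_one z hz).le)
      exact ⟨w, fun _ => hw⟩
    · exact ⟨0, fun h => absurd h hz⟩
  choose f hf using hex
  obtain ⟨h1, h2, h3⟩ := DiscEmbedding.of_tendsto (M := sSup S) hD hDc h0 hF hF0 hf
    (hpos.trans_le (le_csSup hbdd hx₀)) (by
      simp only [hFu]
      exact hu.mono_left Nat.hyperfilter_le_atTop)
  exact ⟨f, h1, h2, fun g hg hg0 => h3 ▸ le_csSup hbdd ⟨g, hg, hg0, rfl⟩⟩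

/-- The Riemann mapping theorem for domains on which nonvanishing holomorphic functions have
holomorphic square roots. -/
theorem exists_discEmbedding_image_eq_ball (hD : IsOpen D) (hDc : IsPreconnected D)
    (h0 : (0 : ℂ) ∈ D) (hDu : D ≠ univ)
    (hsqrt : ∀ f : ℂ → ℂ, DifferentiableOn ℂ f D → (∀ z ∈ D, f z ≠ 0) →
      ∃ g : ℂ → ℂ, DifferentiableOn ℂ g D ∧ ∀ z ∈ D, g z ^ 2 = f z) :
    ∃ f, DiscEmbedding D f ∧ f '' D = ball 0 1 := by
  obtain ⟨f, hf, hf0, hmax⟩ := exists_isMaximal_discEmbedding hD hDc h0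
    (exists_discEmbedding hD h0 hDu hsqrt)
  refine ⟨f, hf, Subset.antisymm ?_ fun w hw => ?_⟩
  · rintro _ ⟨z, hz, rfl⟩
    exact mem_ball_zero_iff.2 (hf.norm_lt_one z hz)
  by_contra hwf
  rw [mem_ball_zero_iff] at hw
  have hh := hf.mobius_comp hw
  obtain ⟨g, hg, hgf⟩ := hsqrt _ hh.differentiableOn fun z hz h => by
    rw [mobius, div_eq_zero_iff] at h
    rcases h with h | h
    · exact hwf ⟨z, hz, sub_eq_zero.1 h⟩
    · exact one_sub_conj_mul_ne_zero hw (hf.norm_lt_one z hz) h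
  have hgE := hh.of_sq hD hg hgf
  have hg0 := hgE.norm_lt_one 0 h0
  have hk := hmax _ (hgE.mobius_comp hg0) (by simp [mobius])
  have hd := DiscEmbedding.deriv_eq_of_sq hD hg hgf h0
  rw [(hf.hasDerivAt_mobius_comp hw h0).deriv] at hd
  rw [(hgE.hasDerivAt_mobius_comp hg0 h0).deriv] at hk
  have hg2 : g 0 ^ 2 = -w := by rw [hgf 0 h0, hf0]; simp [mobius]
  have hnw : ‖w‖ = ‖g 0‖ ^ 2 := by rw [← norm_pow, hg2, norm_neg]
  have hw0 : w ≠ 0 := by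
    rintro rfl
    exact hwf ⟨0, h0, hf0⟩
  have hs : 0 < ‖g 0‖ := by
    refine norm_pos_iff.2 fun h => hw0 ?_
    rw [h] at hg2
    simpa using hg2.symm
  have hcw : ∀ a : ℂ, ‖a‖ < 1 → ‖1 - conj a * a‖ = 1 - ‖a‖ ^ 2 := fun a ha => by
    rw [RCLike.conj_mul]
    have : (1 : ℂ) - ((‖a‖ : ℝ) : ℂ) ^ 2 = ((1 - ‖a‖ ^ 2 : ℝ) : ℂ) := by push_cast; ring
    rw [show (1 : ℂ) - (RCLike.ofReal ‖a‖ : ℂ) ^ 2 = _ from this, Complex.norm_real,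
      Real.norm_of_nonneg]
    nlinarith [norm_nonneg a]
  have hd' := congrArg norm hd
  rw [hf0, mul_zero, sub_zero, one_pow, div_one, norm_mul, norm_mul, norm_mul, hcw w hw,
    hnw] at hd'
  rw [norm_mul, norm_div, norm_pow, hcw _ hg0] at hk
  have hf'pos : 0 < ‖deriv f 0‖ := norm_pos_iff.2 (hf.deriv_ne_zero 0 h0)
  simp only [Complex.norm_ofNat] at hd'
  have hq : 0 < 1 - ‖g 0‖ ^ 2 := by nlinarith
  rw [div_mul_eq_mul_div, div_le_iff₀ (by positivity)] at hk
  have hk' : ‖deriv g 0‖ ≤ ‖deriv f 0‖ * (1 - ‖g 0‖ ^ 2) := by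
    refine le_of_mul_le_mul_left (hk.trans (le_of_eq ?_)) hq
    ring
  have h5 : (1 - ‖g 0‖ ^ 2) * ‖deriv f 0‖ * (1 + ‖g 0‖ ^ 2) =
      2 * ‖g 0‖ * ‖deriv g 0‖ := by linear_combination hd'
  have h6 : 0 < ‖deriv f 0‖ * (1 - ‖g 0‖ ^ 2) := by positivity
  nlinarith [mul_le_mul_of_nonneg_left hk' hs.le, mul_pos h6 (pow_pos (sub_pos.2 hg0) 2)]

/-- The inverse of a Riemann map. -/
theorem DiscEmbedding.exists_inverse {f : ℂ → ℂ} (hf : DiscEmbedding D f) (hD : IsOpen D)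
    (hfD : f '' D = ball 0 1) :
    ∃ g : ℂ → ℂ, DifferentiableOn ℂ g (ball 0 1) ∧ (∀ w ∈ ball (0 : ℂ) 1, deriv g w ≠ 0) ∧
      (∀ w ∈ ball (0 : ℂ) 1, g w ∈ D ∧ f (g w) = w) ∧ ∀ z ∈ D, g (f z) = z := by
  have hgD : ∀ w ∈ ball (0 : ℂ) 1, Function.invFunOn f D w ∈ D ∧
      f (Function.invFunOn f D w) = w := fun w hw => by
    rw [← hfD] at hw
    exact ⟨Function.invFunOn_mem hw, Function.invFunOn_eq hw⟩
  have hgf : ∀ z ∈ D, Function.invFunOn f D (f z) = z := fun z hz =>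
    hf.injOn.leftInvOn_invFunOn hz
  have hder : ∀ w ∈ ball (0 : ℂ) 1, HasDerivAt (Function.invFunOn f D)
      (deriv f (Function.invFunOn f D w))⁻¹ w := by
    intro w hw
    obtain ⟨h1, h2⟩ := hgD w hw
    set z := Function.invFunOn f D w with hz
    have hstrict : HasStrictDerivAt f (deriv f z) z :=
      ((hf.differentiableOn.analyticAt (hD.mem_nhds h1)).contDiffAt (n := 1)).hasStrictDerivAt
        one_ne_zero
    refine HasDerivAt.of_local_left_inverse ?_ (hf.hasDerivAt h1) (hf.deriv_ne_zero z h1) ?_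
    · change Tendsto _ (𝓝 w) (𝓝 z)
      rw [← h2, ← hstrict.map_nhds_eq (hf.deriv_ne_zero z h1), tendsto_map'_iff]
      refine tendsto_id.congr' ?_
      filter_upwards [hD.mem_nhds h1] with x hx using (hgf x hx).symm
    · filter_upwards [isOpen_ball.mem_nhds hw] with x hx using (hgD x hx).2
  refine ⟨Function.invFunOn f D, fun w hw => (hder w hw).differentiableAt.differentiableWithinAt,
    fun w hw => ?_, hgD, hgf⟩
  rw [(hder w hw).deriv]
  exact inv_ne_zero (hf.deriv_ne_zero _ (hgD w hw).1)

end RiemannMapExistence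

section Exhaustion

open Filter Topology

theorem Polynomial.exists_derivative_eq_eval_zero (p : Polynomial ℂ) :
    ∃ q : Polynomial ℂ, q.derivative = p ∧ q.eval 0 = 0 := by
  suffices h : ∃ q : Polynomial ℂ, q.derivative = p by
    obtain ⟨q, hq⟩ := h
    exact ⟨q - C (q.eval 0), by simp [hq], by simp⟩
  induction p using Polynomial.induction_on' with
  | add p q hp hq =>
    obtain ⟨p', rfl⟩ := hp
    obtain ⟨q', rfl⟩ := hq
    exact ⟨p' + q', Polynomial.derivative_add⟩
  | monomial n a =>
    refine ⟨monomial (n + 1) (a / (n + 1 : ℕ)), ?_⟩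
    rw [Polynomial.derivative_monomial, Nat.add_sub_cancel, div_mul_cancel₀]
    exact Nat.cast_ne_zero.2 n.succ_ne_zero

variable {U : ℕ → Set ℂ}

/-- Holomorphic functions on a domain exhausted by relatively compact connected open sets without
holes have primitives. -/
theorem exists_primitive_of_exhaustion (hUo : ∀ k, IsOpen (U k)) (hUc : ∀ k, IsPreconnected (U k))
    (h0 : ∀ k, (0 : ℂ) ∈ U k) (hUK : ∀ k, IsCompact (closure (U k)))
    (hUs : ∀ k, closure (U k) ⊆ U (k + 1))
    (hull : ∀ k S, IsCompact S → frontier S ⊆ closure (U k) → S ⊆ ⋃ j, U j)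
    {f : ℂ → ℂ} (hf : DifferentiableOn ℂ f (⋃ j, U j)) :
    ∃ F : ℂ → ℂ, ∀ z ∈ ⋃ j, U j, HasDerivAt F (f z) z := by
  have hmono : Monotone U := monotone_nat_of_le_succ fun k => subset_closure.trans (hUs k)
  have hp : ∀ k : ℕ, ∃ p : Polynomial ℂ, ∀ z ∈ closure (U k), ‖f z - p.eval z‖ ≤ 1 / (k + 1 : ℝ) :=
    fun k => runge (hUK k) (isOpen_iUnion hUo) hf (fun S hS _ hfr => hull k S hS hfr)
      (by positivity)
  choose p hp using hp
  choose q hq hq0 using fun k => (p k).exists_derivative_eq_eval_zero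
  have hder : ∀ n z, HasDerivAt (fun z => (q n).eval z) ((p n).eval z) z := fun n z => by
    simpa [hq] using (q n).hasDerivAt z
  have hunif : ∀ k, TendstoUniformlyOn (fun n z => (p n).eval z) f atTop (U k) := by
    intro k
    rw [Metric.tendstoUniformlyOn_iff]
    intro ε hε
    filter_upwards [eventually_ge_atTop k,
      (tendsto_one_div_add_atTop_nhds_zero_nat (𝕜 := ℝ)).eventually_lt_const hε] with n hn hnε z hz
    rw [dist_eq_norm]
    exact (hp n z (subset_closure (hmono hn hz))).trans_lt hnε
  have hcau : ∀ z, ∃ w, z ∈ ⋃ j, U j → Tendsto (fun n => (q n).eval z) atTop (𝓝 w) := by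
    intro z
    by_cases hz : z ∈ ⋃ j, U j
    · obtain ⟨k, hk⟩ := mem_iUnion.1 hz
      have hc : Cauchy (map (fun n => (q n).eval z) atTop) := by
        refine cauchy_map_of_uniformCauchySeqOn_fderiv (𝕜 := ℂ)
          (f' := fun n z => ContinuousLinearMap.toSpanSingleton ℂ ((p n).eval z)) (hUo k) (hUc k) ?_
          (fun n z _ => (hder n z).hasFDerivAt) (h0 k) hk (by simp only [hq0]; exact
            tendsto_const_nhds.cauchy_map)
        intro u hu
        obtain ⟨ε, hε, hεu⟩ := Metric.mem_uniformity_dist.1 hu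
        filter_upwards [(hunif k).uniformCauchySeqOn _ (Metric.dist_mem_uniformity hε)]
          with m hm x hx
        refine hεu ?_
        rw [dist_eq_norm, show ∀ a b : ℂ, ContinuousLinearMap.toSpanSingleton ℂ a -
          ContinuousLinearMap.toSpanSingleton ℂ b = ContinuousLinearMap.toSpanSingleton ℂ (a - b)
          from fun a b => by ext; simp, ContinuousLinearMap.norm_toSpanSingleton, ← dist_eq_norm]
        exact hm x hx
      obtain ⟨w, hw⟩ := CompleteSpace.complete hc
      exact ⟨w, fun _ => hw⟩
    · exact ⟨0, fun h => absurd h hz⟩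
  choose F hF using hcau
  refine ⟨F, fun z hz => ?_⟩
  obtain ⟨k, hk⟩ := mem_iUnion.1 hz
  exact hasDerivAt_of_tendstoLocallyUniformlyOn (hUo k) (hunif k).tendstoLocallyUniformlyOn
    (Eventually.of_forall fun n z _ => hder n z) (fun z hz => hF z (mem_iUnion.2 ⟨k, hz⟩)) hk

/-- A nonvanishing holomorphic function on a connected open set on which holomorphic functions have
primitives has a holomorphic square root. -/
theorem exists_sqrt_of_exists_primitive {D : Set ℂ} (hD : IsOpen D) (hDc : IsPreconnected D)
    (hprim : ∀ f : ℂ → ℂ, DifferentiableOn ℂ f D → ∃ F : ℂ → ℂ, ∀ z ∈ D, HasDerivAt F (f z) z)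
    {f : ℂ → ℂ} (hf : DifferentiableOn ℂ f D) (hf0 : ∀ z ∈ D, f z ≠ 0) :
    ∃ g : ℂ → ℂ, DifferentiableOn ℂ g D ∧ ∀ z ∈ D, g z ^ 2 = f z := by
  obtain ⟨L, hL⟩ := hprim (fun z => deriv f z / f z) ((hf.deriv hD).div hf hf0)
  have hder : ∀ z ∈ D, HasDerivAt (fun z => f z * Complex.exp (-L z)) 0 z := by
    intro z hz
    refine ((hf.differentiableAt (hD.mem_nhds hz)).hasDerivAt.fun_mul
      (hL z hz).fun_neg.cexp).congr_deriv ?_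
    field_simp [hf0 z hz]
    ring
  obtain ⟨c, hc⟩ := hD.exists_is_const_of_deriv_eq_zero hDc
    (fun z hz => (hder z hz).differentiableAt.differentiableWithinAt) fun z hz => (hder z hz).deriv
  obtain ⟨s, hs⟩ := IsAlgClosed.exists_pow_nat_eq c two_pos
  refine ⟨fun z => s * Complex.exp (L z / 2), fun z hz =>
    (((hL z hz).div_const 2).cexp.const_mul s).differentiableAt.differentiableWithinAt,
    fun z hz => ?_⟩
  rw [mul_pow, ← Complex.exp_nat_mul, hs, ← hc z hz, mul_assoc, ← Complex.exp_add]
  simp [mul_div_cancel₀]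

end Exhaustion

section CompleteDisc

open Filter Topology

variable {E : Type*} [NormedAddCommGroup E] [NormedSpace ℂ E]

/-- A holomorphic curve with a local lower Lipschitz bound is immersed. -/
theorem deriv_ne_zero_of_le_norm_sub {f : ℂ → E} {U : Set ℂ} {z : ℂ} {c : ℝ} (hU : U ∈ 𝓝 z)
    (hc : 0 < c) (hf : DifferentiableAt ℂ f z)
    (hle : ∀ x ∈ U, ∀ y ∈ U, c * ‖x - y‖ ≤ ‖f x - f y‖) : deriv f z ≠ 0 := by
  intro h0
  have hs := (hasDerivAt_iff_tendsto_slope.1 hf.hasDerivAt).norm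
  rw [h0, norm_zero] at hs
  refine hc.not_ge (ge_of_tendsto hs ?_)
  filter_upwards [self_mem_nhdsWithin, mem_nhdsWithin_of_mem_nhds hU] with w hw hwU
  rw [slope_def_module, norm_smul, norm_inv, ← div_eq_inv_mul,
    le_div_iff₀ (norm_pos_iff.2 (sub_ne_zero.2 hw))]
  exact hle w hwU z (mem_of_mem_nhds hU)

theorem DivergentPathIn.comp_inverse {D V : Set ℂ} {f g : ℂ → ℂ} {γ : ℝ → ℂ}
    (hγ : DivergentPathIn V γ) (hg : ContinuousOn g V) (hf : ContinuousOn f D)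
    (hgD : ∀ w ∈ V, g w ∈ D ∧ f (g w) = w) (hfV : MapsTo f D V) :
    DivergentPathIn D (g ∘ γ) := by
  obtain ⟨hc, hm, hd⟩ := hγ
  refine ⟨hg.comp hc hm, fun t ht => (hgD _ (hm t ht)).1, fun K hK hKc => ?_⟩
  obtain ⟨t₀, ht₀, hout⟩ := hd (f '' K) (hfV.mono_left hK).image_subset
    (hKc.image_of_continuousOn (hf.mono hK))
  exact ⟨t₀, ht₀, fun t ht hK => hout t ht
    ⟨g (γ t), hK, (hgD _ (hm t ⟨ht₀.1.trans ht.1, ht.2⟩)).2⟩⟩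

namespace Tower

variable {p : ℕ → E} {φ : ℕ → ℂ → E} {r : ℕ → ℝ}

theorem exists_limUnder_eq (h : Tower p φ r) (k : ℕ) :
    ∃ ζ ∈ ⋃ k, core (φ k) (r k), (limUnder atTop fun j => φ j ζ) = p k := by
  obtain ⟨ζ, hζ, hj⟩ := h.hit k
  refine ⟨ζ, mem_iUnion.2 ⟨k + 1, hζ⟩, Tendsto.limUnder_eq ?_⟩
  exact tendsto_const_nhds.congr' (by
    filter_upwards [eventually_ge_atTop (k + 1)] with j hk using (hj j hk).symm)

theorem isOpen_iUnion_core (h : Tower p φ r) : IsOpen (⋃ k, core (φ k) (r k)) :=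
  isOpen_iUnion fun k => isOpen_core (h.continuous k)

theorem isPreconnected_iUnion_core (h : Tower p φ r) :
    IsPreconnected (⋃ k, core (φ k) (r k)) :=
  isPreconnected_iUnion ⟨0, mem_iInter.2 fun k => zero_mem_core (h.norm_zero_lt k)⟩
    fun _ => isPreconnected_core

theorem exists_sqrt (h : Tower p φ r) {f : ℂ → ℂ}
    (hf : DifferentiableOn ℂ f (⋃ k, core (φ k) (r k)))
    (hf0 : ∀ z ∈ ⋃ k, core (φ k) (r k), f z ≠ 0) :
    ∃ g : ℂ → ℂ, DifferentiableOn ℂ g (⋃ k, core (φ k) (r k)) ∧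
      ∀ z ∈ ⋃ k, core (φ k) (r k), g z ^ 2 = f z := by
  refine exists_sqrt_of_exists_primitive h.isOpen_iUnion_core h.isPreconnected_iUnion_core
    (fun f hf => ?_) hf hf0
  refine exists_primitive_of_exhaustion (fun k => isOpen_core (h.continuous k))
    (fun _ => isPreconnected_core) (fun k => zero_mem_core (h.norm_zero_lt k)) h.isCompact_closure
    h.closure_subset_succ (fun k S hS hfr => ?_) hf
  exact (subset_core_of_frontier_subset (h.differentiable k) (h.norm_zero_lt k) (h.lt_half k) hS
    hfr).trans (subset_closure.trans ((h.closure_subset k).trans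
      (subset_iUnion (fun k => core (φ k) (r k)) (k + 1))))

variable [CompleteSpace E]

theorem differentiableAt_limUnder (h : Tower p φ r) {ζ : ℂ} (hζ : ζ ∈ ⋃ k, core (φ k) (r k)) :
    DifferentiableAt ℂ (fun ζ => limUnder atTop fun j => φ j ζ) ζ := by
  obtain ⟨k, hk⟩ := mem_iUnion.1 hζ
  exact (h.differentiableOn_limUnder k).differentiableAt
    ((isOpen_core (h.continuous k)).mem_nhds hk)

theorem deriv_limUnder_ne_zero (h : Tower p φ r) {ζ : ℂ} (hζ : ζ ∈ ⋃ k, core (φ k) (r k)) :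
    deriv (fun ζ => limUnder atTop fun j => φ j ζ) ζ ≠ 0 := by
  obtain ⟨k, hk⟩ := mem_iUnion.1 hζ
  obtain ⟨c, hc, hle⟩ := h.exists_le_norm_sub_limUnder k
  exact deriv_ne_zero_of_le_norm_sub ((isOpen_core (h.continuous k)).mem_nhds hk) hc
    (h.differentiableAt_limUnder hζ) hle

theorem injOn_limUnder (h : Tower p φ r) :
    InjOn (fun ζ => limUnder atTop fun j => φ j ζ) (⋃ k, core (φ k) (r k)) := by
  intro x hx y hy hxy
  obtain ⟨i, hi⟩ := mem_iUnion.1 hx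
  obtain ⟨j, hj⟩ := mem_iUnion.1 hy
  obtain ⟨c, hc, hle⟩ := h.exists_le_norm_sub_limUnder (max i j)
  have h1 := hle x (h.monotone_core (le_max_left i j) hi) y (h.monotone_core (le_max_right i j) hj)
  have hxy' : (limUnder atTop fun j => φ j x) = limUnder atTop fun j => φ j y := hxy
  rw [hxy', sub_self, norm_zero] at h1
  have h2 : ‖x - y‖ ≤ 0 := nonpos_of_mul_nonpos_right h1 hc
  exact sub_eq_zero.1 (norm_le_zero_iff.1 h2)

theorem norm_limUnder_lt_one (h : Tower p φ r) {ζ : ℂ} (hζ : ζ ∈ ⋃ k, core (φ k) (r k)) :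
    ‖limUnder atTop fun j => φ j ζ‖ < 1 := by
  obtain ⟨k, hk⟩ := mem_iUnion.1 hζ
  exact h.norm_limUnder_lt hk

theorem iUnion_core_ne_univ (h : Tower p φ r) : (⋃ k, core (φ k) (r k)) ≠ univ := by
  intro hu
  have hd : Differentiable ℂ (fun ζ => limUnder atTop fun j => φ j ζ) := fun ζ =>
    h.differentiableAt_limUnder (hu ▸ mem_univ ζ)
  have hb : Bornology.IsBounded (range (fun ζ => limUnder atTop fun j => φ j ζ)) := by
    refine isBounded_closedBall (x := (0 : E)) (r := 1) |>.subset ?_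
    rintro _ ⟨ζ, rfl⟩
    exact mem_closedBall_zero_iff.2 (h.norm_limUnder_lt_one (hu ▸ mem_univ ζ)).le
  exact zero_ne_one (h.injOn_limUnder (hu ▸ mem_univ 0) (hu ▸ mem_univ 1)
    (hd.apply_eq_apply_of_bounded hb 0 1))

/-- The limit curve of a tower, parametrised by the disc. -/
theorem exists_complete_disc (h : Tower p φ r) :
    ∃ ψ : ℂ → E, DifferentiableOn ℂ ψ (ball 0 1) ∧ InjOn ψ (ball 0 1) ∧
      (∀ ζ ∈ ball (0 : ℂ) 1, deriv ψ ζ ≠ 0) ∧ (∀ ζ ∈ ball (0 : ℂ) 1, ‖ψ ζ‖ < 1) ∧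
      (∀ k, p k ∈ ψ '' ball 0 1) ∧
      ∀ γ : ℝ → ℂ, DivergentPathIn (ball 0 1) γ →
        eVariationOn (fun t => ψ (γ t)) (Ico 0 1) = ⊤ := by
  obtain ⟨f, hf, hfD⟩ := exists_discEmbedding_image_eq_ball h.isOpen_iUnion_core
    h.isPreconnected_iUnion_core (mem_iUnion.2 ⟨0, zero_mem_core (h.norm_zero_lt 0)⟩)
    h.iUnion_core_ne_univ fun f => h.exists_sqrt
  obtain ⟨g, hg, hg', hgD, hgf⟩ := hf.exists_inverse h.isOpen_iUnion_core hfD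
  have hfm : MapsTo f (⋃ k, core (φ k) (r k)) (ball 0 1) := hfD ▸ mapsTo_image f _
  have hder : ∀ ζ ∈ ball (0 : ℂ) 1, HasDerivAt (fun w => limUnder atTop fun j => φ j (g w))
      (deriv g ζ • deriv (fun ζ => limUnder atTop fun j => φ j ζ) (g ζ)) ζ := fun ζ hζ =>
    (h.differentiableAt_limUnder (hgD ζ hζ).1).hasDerivAt.scomp ζ
      (hg.differentiableAt (isOpen_ball.mem_nhds hζ)).hasDerivAt
  refine ⟨fun w => limUnder atTop fun j => φ j (g w),
    fun ζ hζ => (hder ζ hζ).differentiableAt.differentiableWithinAt, fun x hx y hy hxy => ?_,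
    fun ζ hζ => ?_, fun ζ hζ => h.norm_limUnder_lt_one (hgD ζ hζ).1, fun k => ?_, fun γ hγ => ?_⟩
  · rw [← (hgD x hx).2, ← (hgD y hy).2, h.injOn_limUnder (hgD x hx).1 (hgD y hy).1 hxy]
  · rw [(hder ζ hζ).deriv]
    exact smul_ne_zero (hg' ζ hζ) (h.deriv_limUnder_ne_zero (hgD ζ hζ).1)
  · obtain ⟨ζ, hζ, hk⟩ := h.exists_limUnder_eq k
    exact ⟨f ζ, hfm hζ, by simpa only [hgf ζ hζ] using hk⟩
  · exact h.eVariationOn_eq_top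
      (hγ.comp_inverse hg.continuousOn hf.differentiableOn.continuousOn hgD hfm)

end Tower

end CompleteDisc

/-- Simply connected case of the Alarcón–Forstnerič hitting theorem: for every countable
subset `Λ` of 𝔹ₙ (`n ≥ 2`) there is a complete bounded injectively immersed holomorphic disc
in 𝔹ₙ whose image contains `Λ`. -/
theorem complete_injective_immersed_disc_Bn_hitting (n : ℕ) (hn : 2 ≤ n)
    (Λ : Set (EuclideanSpace ℂ (Fin n)))
    (hΛsub : Λ ⊆ Metric.ball (0 : EuclideanSpace ℂ (Fin n)) 1)
    (hΛcount : Λ.Countable) :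
    ∃ φ : ℂ → EuclideanSpace ℂ (Fin n),
      DifferentiableOn ℂ φ (Metric.ball (0 : ℂ) 1) ∧
      Set.InjOn φ (Metric.ball (0 : ℂ) 1) ∧
      (∀ ζ ∈ Metric.ball (0 : ℂ) 1, deriv φ ζ ≠ 0) ∧
      (∀ ζ ∈ Metric.ball (0 : ℂ) 1, φ ζ ∈ Metric.ball (0 : EuclideanSpace ℂ (Fin n)) 1) ∧
      Λ ⊆ φ '' Metric.ball (0 : ℂ) 1 ∧
      (∀ γ : ℝ → ℂ, DivergentPathIn (Metric.ball (0 : ℂ) 1) γ →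
        eVariationOn (fun t => φ (γ t)) (Set.Ico 0 1) = ⊤) := by
  obtain ⟨p, hp, hΛ⟩ : ∃ p : ℕ → EuclideanSpace ℂ (Fin n), (∀ k, ‖p k‖ < 1) ∧ Λ ⊆ range p := by
    rcases Λ.eq_empty_or_nonempty with rfl | hne
    · exact ⟨fun _ => 0, by simp, empty_subset _⟩
    · obtain ⟨p, rfl⟩ := hΛcount.exists_eq_range hne
      exact ⟨p, fun k => mem_ball_zero_iff.1 (hΛsub (mem_range_self k)), Subset.rfl⟩
  obtain ⟨φ, r, h⟩ := exists_tower (E := EuclideanSpace ℂ (Fin n)) (by simpa using hn)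
    (π₀ := EuclideanSpace.proj ⟨0, by omega⟩) (π₁ := EuclideanSpace.proj ⟨1, by omega⟩)
    (e₀ := EuclideanSpace.single ⟨0, by omega⟩ 1) (e₁ := EuclideanSpace.single ⟨1, by omega⟩ 1)
    (by simp) (by simp) (by simp) hp
  obtain ⟨ψ, h1, h2, h3, h4, h5, h6⟩ := h.exists_complete_disc
  refine ⟨ψ, h1, h2, h3, fun ζ hζ => mem_ball_zero_iff.2 (h4 ζ hζ), fun x hx => ?_, h6⟩
  obtain ⟨k, rfl⟩ := hΛ hx
  exact h5 k
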